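/- arXiv:1908.03801 — 3 statements merged into one kernel-verified Lean document; each statement's English description precedes it below -/
import Mathlib

section
/- Let F be a finitely generated free group, let w ∈ F and let d ≥ 1 be an integer. If for every N ∈ ℤ_{≥1} and every homomorphism φ : F → S_N, the permutation φ(w) is a d-th power in S_N, then w is a d-th power in F, i.e., w = v^d for some v ∈ F. -/
open Equiv
open FreeGroup (IsReduced IsCyclicallyReduced)

/-- If `τ ^ p ^ a` has no fixed point, every fixed point of `τ ^ p ^ (a + 1)` lies on a
`p ^ (a + 1)`-cycle of `τ`. -/
theorem pow_succ_dvd_card_fixedPoints_pow {Ω : Type*} [Finite Ω] {p : ℕ} (hp : p.Prime) (a : ℕ)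
    (τ : Perm Ω) (hτ : ∀ z, (τ ^ p ^ a) z ≠ z) :
    p ^ (a + 1) ∣ Nat.card {z // (τ ^ p ^ (a + 1)) z = z} := by
  classical
  have := Fintype.ofFinite Ω
  have hper : ∀ z, (τ ^ p ^ (a + 1)) z = z → Function.minimalPeriod τ z = p ^ (a + 1) := by
    intro z hz
    have h1 : Function.minimalPeriod τ z ∣ p ^ (a + 1) := by
      apply Function.IsPeriodicPt.minimalPeriod_dvd
      rw [Function.IsPeriodicPt, Function.IsFixedPt, Perm.iterate_eq_pow]; exact hz
    have h2 : ¬ Function.minimalPeriod τ z ∣ p ^ a := by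
      rw [← Function.isPeriodicPt_iff_minimalPeriod_dvd, Function.IsPeriodicPt, Function.IsFixedPt,
        Perm.iterate_eq_pow]
      exact hτ z
    exact Nat.eq_prime_pow_of_dvd_least_prime_pow hp h2 h1
  have hinv : ∀ z, (τ ^ p ^ (a + 1)) (τ z) = τ z ↔ (τ ^ p ^ (a + 1)) z = z := by
    intro z
    rw [← Perm.mul_apply, ← pow_succ, pow_succ', Perm.mul_apply, τ.injective.eq_iff]
  let t : Perm {z // (τ ^ p ^ (a + 1)) z = z} := τ.subtypePerm hinv
  have htpow : ∀ (k : ℕ) z, ((t ^ k) z : Ω) = (τ ^ k) z := by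
    intro k z; simp [t, Perm.subtypePerm_pow]
  have ht1 : t ^ p ^ (a + 1) = 1 := by
    ext z; rw [htpow]; exact z.2
  rcases isEmpty_or_nonempty {z // (τ ^ p ^ (a + 1)) z = z} with hE | ⟨⟨z0⟩⟩
  · simp
  have hord : orderOf t = p ^ (a + 1) := by
    refine orderOf_eq_prime_pow (hp := ⟨hp⟩) (fun h => ?_) ht1
    apply hτ z0
    rw [← htpow, h]; rfl
  have hstab : ∀ z : {z // (τ ^ p ^ (a + 1)) z = z}, MulAction.stabilizer (Subgroup.zpowers t) z = ⊥ := by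
    intro z
    rw [eq_bot_iff]
    rintro ⟨g, hg⟩ hgz
    obtain ⟨k, rfl⟩ := (mem_powers_iff_mem_zpowers (x := t)).2 hg
    have h3 : (t ^ k) z = z := hgz
    have h4 : (τ ^ k) z = z := by rw [← htpow, h3]
    have h5 : Function.minimalPeriod τ z ∣ k := by
      apply Function.IsPeriodicPt.minimalPeriod_dvd
      rw [Function.IsPeriodicPt, Function.IsFixedPt, Perm.iterate_eq_pow]; exact h4
    rw [hper z z.2, ← hord] at h5
    rw [Subgroup.mem_bot]
    ext1
    exact orderOf_dvd_iff_pow_eq_one.1 h5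
  rw [Nat.card_eq_fintype_card,
    MulAction.card_eq_sum_card_group_div_card_stabilizer (Subgroup.zpowers t)]
  refine Finset.dvd_sum fun ω _ => ?_
  have : Fintype.card (MulAction.stabilizer (Subgroup.zpowers t) ω.out) = 1 := by
    rw [← Nat.card_eq_fintype_card, hstab]; simp
  rw [this, Nat.div_one, ← Nat.card_eq_fintype_card, Nat.card_zpowers, hord]

theorem natCast_div_mem_of_dvd_card {M : ℕ} [NeZero M] (S : AddSubgroup (ZMod M)) {e : ℕ}
    (he : e ∣ Nat.card S) : ((M / e : ℕ) : ZMod M) ∈ S := by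
  classical
  have hS : 0 < Nat.card S := Nat.card_pos
  have hM : Nat.card S ∣ M := by simpa using S.card_addSubgroup_dvd_card
  have hsub : (S : Set (ZMod M)).toFinset ⊆ Finset.univ.filter (fun x => Nat.card S • x = 0) := by
    intro x hx
    have hx : x ∈ S := by simpa using hx
    have h := card_nsmul_eq_zero' (x := (⟨x, hx⟩ : S))
    exact Finset.mem_filter.2 ⟨Finset.mem_univ _, congrArg Subtype.val h⟩
  have heq := Finset.eq_of_subset_of_card_le hsub (by
    refine (IsAddCyclic.card_nsmul_eq_zero_le hS).trans ?_
    rw [← Set.ncard_eq_toFinset_card']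
    rfl)
  have : ((M / e : ℕ) : ZMod M) ∈ (S : Set (ZMod M)).toFinset := by
    rw [heq]
    simp only [Finset.mem_filter, Finset.mem_univ, true_and]
    obtain ⟨c, hc⟩ := he
    obtain ⟨b, hb⟩ : e ∣ M := (Dvd.intro _ hc.symm).trans hM
    have he0 : 0 < e := Nat.pos_of_ne_zero (by rintro rfl; omega)
    rw [nsmul_eq_mul, ← Nat.cast_mul, ZMod.natCast_eq_zero_iff, hc, hb,
      Nat.mul_div_cancel_left _ he0]
    exact ⟨c, by ring⟩
  simpa using this

/-- The translations of `ZMod M` preserving a function. -/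
def periodSubgroup {β : Type*} {M : ℕ} (W : ZMod M → β) : AddSubgroup (ZMod M) where
  carrier := {c | ∀ k, W (c + k) = W k}
  zero_mem' := by simp
  add_mem' {a b} ha hb k := by rw [add_assoc, ha, hb]
  neg_mem' {a} ha k := by rw [← ha, add_neg_cancel_left]

theorem mem_periodSubgroup {β : Type*} {M : ℕ} {W : ZMod M → β} {c : ZMod M} :
    c ∈ periodSubgroup W ↔ ∀ k, W (c + k) = W k := Iff.rfl

theorem mk_map_range_mul {α : Type*} {f : ℕ → α × Bool} {c : ℕ} (hf : ∀ k, f (k + c) = f k)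
    (n : ℕ) : FreeGroup.mk ((List.range (c * n)).map f) =
      FreeGroup.mk ((List.range c).map f) ^ n := by
  induction n with
  | zero => simp [FreeGroup.one_eq_mk]
  | succ n ih =>
    have h : ∀ n k, f (c * n + k) = f k := by
      intro n k
      induction n with
      | zero => simp
      | succ n ih => rw [← ih, ← hf (c * n + k)]; congr 1; ring
    rw [Nat.mul_succ, List.range_add, List.map_append, ← FreeGroup.mul_mk, ih, pow_succ,
      List.map_map]
    congr 3
    funext k
    exact h n k

/-- A nonempty cyclically reduced word extends to a periodic sequence of letters. -/
theorem exists_periodic_letters {α : Type*} {L : List (α × Bool)} (hL : IsCyclicallyReduced L)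
    (hne : L ≠ []) : ∃ f : ℕ → α × Bool, (∀ k, f (k + L.length) = f k) ∧
      (∀ k, (f k).1 = (f (k + 1)).1 → (f k).2 = (f (k + 1)).2) ∧
      L = (List.range L.length).map f := by
  have hl : 0 < L.length := List.length_pos_iff.2 hne
  refine ⟨fun k => L[k % L.length]'(Nat.mod_lt _ hl), fun k => by simp, fun k => ?_, ?_⟩
  · have hk := Nat.mod_lt k hl
    rcases (Nat.succ_le_of_lt hk).lt_or_eq with h | h
    · have h' : (k + 1) % L.length = k % L.length + 1 := by
        rw [Nat.add_mod, Nat.mod_eq_of_lt (a := 1) (by omega), Nat.mod_eq_of_lt (by omega)]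
      simp only [h']
      exact (List.isChain_iff_getElem.1 hL.1) _ (by omega)
    · have h' : (k + 1) % L.length = 0 := by
        rw [← Nat.mod_add_mod, ← Nat.succ_eq_add_one, h, Nat.mod_self]
      simp only [h']
      refine hL.2 _ ?_ _ ?_
      · rw [List.getLast?_eq_getElem?]
        simp only [Option.mem_def]
        rw [List.getElem?_eq_some_iff]
        refine ⟨by omega, ?_⟩
        congr 1
        omega
      · simp [List.head?_eq_getElem?, hl]
  · apply List.ext_getElem
    · simp
    · intro i h1 h2
      simp [Nat.mod_eq_of_lt h1]

/-- The permutation by which a letter acts. -/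
def letterPerm {α X : Type*} (φ : α → Perm X) (s : α × Bool) : Perm X :=
  cond s.2 (φ s.1) (φ s.1)⁻¹

theorem lift_mk_cons {α X : Type*} (φ : α → Perm X) (s : α × Bool) (l : List (α × Bool)) (v : X) :
    FreeGroup.lift φ (FreeGroup.mk (s :: l)) v =
      letterPerm φ s (FreeGroup.lift φ (FreeGroup.mk l) v) := by
  simp [FreeGroup.lift_mk, letterPerm]

/-- Every cyclically reduced cyclic word can be read along a cycle of a permutation action. -/
theorem exists_letterPerm_add_one {α : Type*} {M : ℕ} [NeZero M] {W : ZMod M → α × Bool}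
    (hW : ∀ i, (W i).1 = (W (i + 1)).1 → (W i).2 = (W (i + 1)).2) :
    ∃ φ : α → Perm (ZMod M), ∀ i, letterPerm φ (W i) (i + 1) = i := by
  classical
  have key : ∀ x : α, ∃ g : Perm (ZMod M), (∀ i, W i = (x, true) → g (i + 1) = i) ∧
      ∀ i, W i = (x, false) → g i = i + 1 := by
    intro x
    let s : Set (ZMod M) := {v | W (v - 1) = (x, true) ∨ W v = (x, false)}
    let F : ZMod M → ZMod M := fun v => if W (v - 1) = (x, true) then v - 1 else v + 1
    have hF : Set.InjOn F s := by
      have aux : ∀ v v', W (v - 1) = (x, true) → W v' = (x, false) → v - 1 ≠ v' + 1 := by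
        intro v v' h h' e
        have := hW v'
        rw [← e, h, h'] at this
        simp at this
      intro v hv v' hv' e
      by_cases h : W (v - 1) = (x, true) <;> by_cases h' : W (v' - 1) = (x, true) <;>
        simp only [F, h, h', if_true, if_false] at e
      · simpa using e
      · exact absurd e (aux _ _ h (hv'.resolve_left h'))
      · exact absurd e.symm (aux _ _ h' (hv.resolve_left h))
      · simpa using e
    obtain ⟨g, hg⟩ := Set.MapsTo.exists_equiv_extend_of_card_eq (α := ZMod M)
      (t := (Finset.univ : Finset (ZMod M))) Finset.card_univ.symm (s := s) (f := F)
      (fun _ _ => by simp) hF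
    refine ⟨g.trans (Equiv.subtypeUnivEquiv (by simp)), fun i hi => ?_, fun i hi => ?_⟩
    · have := hg (i + 1) (by simp [s, hi])
      simpa [F, hi] using this
    · have := hg i (by simp [s, hi])
      have h2 : W (i - 1) ≠ (x, true) := by
        intro h
        have := hW (i - 1)
        rw [h, sub_add_cancel, hi] at this
        simp at this
      simpa [F, h2] using this
  choose φ h1 h2 using key
  refine ⟨φ, fun i => ?_⟩
  rcases hi : W i with ⟨x, _ | _⟩
  · rw [letterPerm, cond_false, Perm.inv_eq_iff_eq]
    exact (h2 x i hi).symm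
  · simp [letterPerm, h1 x i hi]

/-- A sequence whose period divides `M` descends to `ZMod M`. -/
theorem val_natCast_of_periodic {β : Type*} {f : ℕ → β} {c M : ℕ} (hf : ∀ k, f (k + c) = f k)
    (hM : c ∣ M) (k : ℕ) : f ((k : ZMod M).val) = f k := by
  obtain ⟨n, rfl⟩ := hM
  have h : ∀ m k, f (k + c * m) = f k := by
    intro m k
    induction m with
    | zero => simp
    | succ m ih => rw [← ih, ← hf (k + c * m)]; congr 1; ring
  rw [ZMod.val_natCast, ← h (k / (c * n) * n) (k % (c * n))]
  congr 1
  conv_rhs => rw [← Nat.mod_add_div k (c * n)]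
  ring

theorem exists_cyclic_word_of_periodic {α : Type*} {f : ℕ → α × Bool} {c M : ℕ} [NeZero M]
    (hf : ∀ k, f (k + c) = f k)
    (hchain : ∀ k, (f k).1 = (f (k + 1)).1 → (f k).2 = (f (k + 1)).2) (hM : c ∣ M) :
    ∃ W : ZMod M → α × Bool, (∀ k : ℕ, W k = f k) ∧
      ∀ i, (W i).1 = (W (i + 1)).1 → (W i).2 = (W (i + 1)).2 := by
  refine ⟨fun i => f i.val, val_natCast_of_periodic hf hM, fun i => ?_⟩
  have h1 : f (i + 1).val = f (i.val + 1) := by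
    rw [← val_natCast_of_periodic hf hM (i.val + 1)]; push_cast; rw [ZMod.natCast_zmod_val]
  beta_reduce
  rw [h1]
  exact hchain _

section ReadingWalks

variable {α : Type*} {M : ℕ}

/-- The oriented edge of the Schreier graph crossed by a letter at a point. -/
def crossedEdge {X : Type*} (φ : α → Perm X) (s : α × Bool) (v : X) : (α × X) × Bool :=
  ((s.1, cond s.2 v ((φ s.1)⁻¹ v)), s.2)

open Classical in
/-- The edges crossed by a word read from a point, those satisfying `C` being deleted. -/
noncomputable def edgeWord {X : Type*} (φ : α → Perm X) (C : α × X → Prop) :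
    List (α × Bool) → X → List ((α × X) × Bool)
  | [], _ => []
  | s :: l, v =>
    if C (crossedEdge φ s (FreeGroup.lift φ (FreeGroup.mk l) v)).1 then edgeWord φ C l v
    else crossedEdge φ s (FreeGroup.lift φ (FreeGroup.mk l) v) :: edgeWord φ C l v

/-- The extension of a permutation action by a labelling of the edges not satisfying `C`. -/
noncomputable def twistedPerm {X Y : Type*} (φ : α → Perm X) (C : α × X → Prop)
    (ρ : FreeGroup (α × X) →* Perm Y) (x : α) : Perm (X × Y) :=
  open Classical in
  Equiv.prodShear (φ x) fun v => if C (x, v) then 1 else ρ (FreeGroup.of (x, v))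

theorem lift_twistedPerm {X Y : Type*} (φ : α → Perm X) (C : α × X → Prop)
    (ρ : FreeGroup (α × X) →* Perm Y) (l : List (α × Bool)) (v : X) (y : Y) :
    FreeGroup.lift (twistedPerm φ C ρ) (FreeGroup.mk l) (v, y) =
      (FreeGroup.lift φ (FreeGroup.mk l) v, ρ (FreeGroup.mk (edgeWord φ C l v)) y) := by
  induction l with
  | nil => simp [edgeWord, ← FreeGroup.one_eq_mk]
  | cons s l ih =>
    rw [lift_mk_cons, ih, lift_mk_cons]
    set u := FreeGroup.lift φ (FreeGroup.mk l) v with hu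
    rcases s with ⟨x, _ | _⟩
    · rw [letterPerm, cond_false, Perm.inv_eq_iff_eq]
      by_cases h : C (x, (φ x)⁻¹ u)
      · have h' : edgeWord φ C ((x, false) :: l) v = edgeWord φ C l v := by
          rw [edgeWord, if_pos]; exact h
        rw [h']
        simp only [twistedPerm, letterPerm, cond_false, Equiv.prodShear_apply, h, if_true]
        simp
      · have h' : edgeWord φ C ((x, false) :: l) v =
            ((x, (φ x)⁻¹ u), false) :: edgeWord φ C l v := by
          rw [edgeWord, if_neg]
          · rfl
          · exact h
        rw [h', ← List.singleton_append, ← FreeGroup.mul_mk, map_mul]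
        have h2 : FreeGroup.mk [((x, (φ x)⁻¹ u), false)] = (FreeGroup.of (x, (φ x)⁻¹ u))⁻¹ := by
          rw [FreeGroup.of, FreeGroup.inv_mk]; rfl
        rw [h2, map_inv]
        simp only [twistedPerm, letterPerm, cond_false, Equiv.prodShear_apply, h, if_false]
        simp
    · by_cases h : C (x, u)
      · have h' : edgeWord φ C ((x, true) :: l) v = edgeWord φ C l v := by
          rw [edgeWord, if_pos]; exact h
        rw [h']
        simp [twistedPerm, letterPerm, h]
      · have h' : edgeWord φ C ((x, true) :: l) v = ((x, u), true) :: edgeWord φ C l v := by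
          rw [edgeWord, if_neg]
          · rfl
          · exact h
        rw [h', ← List.singleton_append, ← FreeGroup.mul_mk, map_mul]
        simp [twistedPerm, letterPerm, h, FreeGroup.of]

/-- The edges of the cycle labelled by the cyclic word `W`. -/
def IsCycleEdge (W : ZMod M → α × Bool) (e : α × ZMod M) : Prop :=
  W (e.2 - 1) = (e.1, true) ∨ W e.2 = (e.1, false)

variable {W : ZMod M → α × Bool} {φ : α → Perm (ZMod M)}

theorem isCycleEdge_crossedEdge_iff (hφ : ∀ i, letterPerm φ (W i) (i + 1) = i) (s : α × Bool)
    (u : ZMod M) :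
    IsCycleEdge W (crossedEdge φ s u).1 ↔ W (u - 1) = s ∨ W u = (s.1, !s.2) := by
  rcases s with ⟨x, _ | _⟩
  · obtain ⟨v, rfl⟩ := (φ x).surjective u
    have h1 : W (v - 1) = (x, true) → φ x v = v - 1 := by
      intro h
      simpa [letterPerm, h] using hφ (v - 1)
    have h2 : W v = (x, false) → φ x v = v + 1 := by
      intro h
      have := hφ v
      rw [h, letterPerm, cond_false, Perm.inv_eq_iff_eq] at this
      exact this.symm
    have h3 : W (φ x v) = (x, true) → v = φ x v + 1 := by
      intro h
      have := hφ (φ x v)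
      rw [h, letterPerm, cond_true] at this
      exact ((φ x).injective this).symm
    have h4 : W (φ x v - 1) = (x, false) → v = φ x v - 1 := by
      intro h
      have := hφ (φ x v - 1)
      rw [h, letterPerm, cond_false, Perm.inv_eq_iff_eq, sub_add_cancel] at this
      exact (φ x).injective this
    have hinv : (φ x)⁻¹ (φ x v) = v := by simp
    simp only [IsCycleEdge, crossedEdge, cond_false, hinv, Bool.not_false]
    constructor
    · rintro (h | h)
      · right; rw [h1 h, h]
      · left; rw [h2 h, add_sub_cancel_right, h]
    · rintro (h | h)
      · right; rw [h4 h, h]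
      · left; rw [h3 h, add_sub_cancel_right, h]
  · simp [IsCycleEdge, crossedEdge]

theorem lift_mk_of_forall_getElem_eq (hφ : ∀ i, letterPerm φ (W i) (i + 1) = i)
    (l : List (α × Bool)) (c : ZMod M) (hl : ∀ k (hk : k < l.length), l[k] = W (c + k)) :
    FreeGroup.lift φ (FreeGroup.mk l) (c + l.length) = c ∧
      edgeWord φ (IsCycleEdge W) l (c + l.length) = [] := by
  induction l generalizing c with
  | nil => simp [edgeWord, ← FreeGroup.one_eq_mk]
  | cons s l ih =>
    have h0 : s = W c := by
      have : s = W (c + (0 : ℕ)) := hl 0 (by simp)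
      simpa using this
    obtain ⟨h1, h2⟩ := ih (c + 1) (fun k hk => by
      have := hl (k + 1) (by simpa using hk)
      rw [List.getElem_cons_succ] at this
      rw [this]; congr 1; push_cast; ring)
    have h3 : c + ((s :: l).length : ZMod M) = c + 1 + l.length := by
      simp only [List.length_cons]; push_cast; ring
    rw [h3, lift_mk_cons, edgeWord, h1, h0]
    refine ⟨hφ c, ?_⟩
    rw [if_pos ((isCycleEdge_crossedEdge_iff hφ _ _).2 (by simp)), h2]

/-- A reduced word not longer than the cycle either runs along it in one direction, or leaves it,
in which case its current position lies beyond the last edge off the cycle. -/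
theorem edgeWord_cases (hφ : ∀ i, letterPerm φ (W i) (i + 1) = i) (l : List (α × Bool))
    (hl : IsReduced l) (hlen : l.length ≤ M) (v : ZMod M) :
    IsReduced (edgeWord φ (IsCycleEdge W) l v) ∧
    ((edgeWord φ (IsCycleEdge W) l v = [] ∧
        ((FreeGroup.lift φ (FreeGroup.mk l) v = v - l.length ∧
          ∀ k (hk : k < l.length), l[k] = W (v - l.length + k)) ∨
        (FreeGroup.lift φ (FreeGroup.mk l) v = v + l.length ∧
          ∀ k (hk : k < l.length), W (v + l.length - 1 - k) = (l[k].1, !l[k].2)))) ∨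
      ∃ e rest s l', edgeWord φ (IsCycleEdge W) l v = e :: rest ∧ l = s :: l' ∧
        ∃ j : ℕ, j < l.length ∧
          ((j = 0 ∧ FreeGroup.lift φ (FreeGroup.mk l) v = cond e.2 (φ e.1.1 e.1.2) e.1.2 ∧
            s = (e.1.1, e.2)) ∨
          (0 < j ∧ FreeGroup.lift φ (FreeGroup.mk l) v = cond e.2 (φ e.1.1 e.1.2) e.1.2 - j ∧
            W (FreeGroup.lift φ (FreeGroup.mk l) v) = s) ∨
          (0 < j ∧ FreeGroup.lift φ (FreeGroup.mk l) v = cond e.2 (φ e.1.1 e.1.2) e.1.2 + j ∧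
            W (FreeGroup.lift φ (FreeGroup.mk l) v - 1) = (s.1, !s.2)))) := by
  induction l with
  | nil => simp [edgeWord, ← FreeGroup.one_eq_mk]
  | cons s l ih =>
    obtain ⟨hred, ih⟩ := ih (List.IsChain.of_cons hl) (by simp at hlen; omega)
    have hlen' : l.length < M := by simpa using hlen
    have hhead : ∀ t l', l = t :: l' → s.1 = t.1 → s.2 = t.2 := by
      rintro t l' rfl
      exact (List.isChain_cons_cons.1 hl).1
    have hpos := lift_mk_cons φ s l v
    set u := FreeGroup.lift φ (FreeGroup.mk l) v with hu
    have hC := isCycleEdge_crossedEdge_iff hφ s u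
    have hcast : (((s :: l).length : ℕ) : ZMod M) = l.length + 1 := by simp
    have hnat : ∀ j : ℕ, 0 < j → j < M → (j : ZMod M) ≠ 0 := by
      intro j h0 hj h
      exact absurd (Nat.le_of_dvd h0 ((ZMod.natCast_eq_zero_iff _ _).1 h)) (by omega)
    by_cases hfwd : W (u - 1) = s
    · have hE : edgeWord φ (IsCycleEdge W) (s :: l) v = edgeWord φ (IsCycleEdge W) l v := by
        rw [edgeWord, if_pos]; exact hC.2 (Or.inl hfwd)
      have hp : FreeGroup.lift φ (FreeGroup.mk (s :: l)) v = u - 1 := by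
        rw [hpos, ← hfwd]; simpa using hφ (u - 1)
      rw [hE, hp]
      refine ⟨hred, ?_⟩
      rcases ih with ⟨he, ih⟩ | ⟨e, rest, t, l', he, hll, j, hj, ih⟩
      · left
        refine ⟨he, Or.inl ?_⟩
        have hu' : u = v - l.length ∧ ∀ k (hk : k < l.length), l[k] = W (v - l.length + k) := by
          rcases ih with ih | ih
          · exact ih
          · rcases l with _ | ⟨t, l'⟩
            · simpa using ih.1
            · exfalso
              have := ih.2 0 (by simp)
              have h2 : u - 1 = v + ((t :: l').length : ZMod M) - 1 - (0 : ℕ) := by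
                rw [ih.1]; simp
              rw [← h2, hfwd] at this
              have h3 := hhead t l' rfl
              simp [this] at h3
        rw [hcast]
        refine ⟨by rw [hu'.1]; ring, fun k hk => ?_⟩
        rcases k with _ | k
        · rw [List.getElem_cons_zero, ← hfwd, hu'.1]; congr 1; push_cast; ring
        · rw [List.getElem_cons_succ, hu'.2 k (by simpa using hk)]; congr 1; push_cast; ring
      · right
        refine ⟨e, rest, s, l, he, rfl, j + 1, by simpa using hj, Or.inr (Or.inl ⟨by omega, ?_⟩)⟩
        refine ⟨?_, hfwd⟩
        rcases ih with ⟨h0, h1, h2⟩ | ⟨h0, h1, h2⟩ | ⟨h0, h1, h2⟩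
        · rw [h1, h0]; simp
        · rw [h1]; push_cast; ring
        · exfalso
          have h3 := hhead t l' hll
          simp [← hfwd, h2] at h3
    by_cases hbwd : W u = (s.1, !s.2)
    · have hE : edgeWord φ (IsCycleEdge W) (s :: l) v = edgeWord φ (IsCycleEdge W) l v := by
        rw [edgeWord, if_pos]; exact hC.2 (Or.inr hbwd)
      have hp : FreeGroup.lift φ (FreeGroup.mk (s :: l)) v = u + 1 := by
        have h1 := hφ u
        rw [hbwd] at h1
        rw [hpos]
        rcases s with ⟨x, _ | _⟩ <;> simp only [letterPerm, Bool.not_false, Bool.not_true,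
          cond_true, cond_false] at h1 ⊢
        · rw [Perm.inv_eq_iff_eq, h1]
        · rw [Perm.inv_eq_iff_eq] at h1; exact h1.symm
      rw [hE, hp]
      refine ⟨hred, ?_⟩
      rcases ih with ⟨he, ih⟩ | ⟨e, rest, t, l', he, hll, j, hj, ih⟩
      · left
        refine ⟨he, Or.inr ?_⟩
        have hu' : u = v + l.length ∧ ∀ k (hk : k < l.length),
            W (v + l.length - 1 - k) = (l[k].1, !l[k].2) := by
          rcases ih with ih | ih
          · rcases l with _ | ⟨t, l'⟩
            · simpa using ih.1
            · exfalso
              have := ih.2 0 (by simp)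
              have h2 : v - ((t :: l').length : ZMod M) + (0 : ℕ) = u := by
                rw [ih.1]; simp
              rw [h2, hbwd] at this
              have h3 := hhead t l' rfl
              have h4 : t = (s.1, !s.2) := this
              simp [h4] at h3
          · exact ih
        rw [hcast]
        refine ⟨by rw [hu'.1]; ring, fun k hk => ?_⟩
        rcases k with _ | k
        · rw [List.getElem_cons_zero, ← hbwd, hu'.1]; congr 1; push_cast; ring
        · rw [List.getElem_cons_succ, ← hu'.2 k (by simpa using hk)]; congr 1; push_cast; ring
      · right
        refine ⟨e, rest, s, l, he, rfl, j + 1, by simpa using hj, Or.inr (Or.inr ⟨by omega, ?_⟩)⟩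
        refine ⟨?_, by rw [add_sub_cancel_right, hbwd]⟩
        rcases ih with ⟨h0, h1, h2⟩ | ⟨h0, h1, h2⟩ | ⟨h0, h1, h2⟩
        · rw [h1, h0]; simp
        · exfalso
          have h3 := hhead t l' hll
          simp [← h2, hbwd] at h3
        · rw [h1]; push_cast; ring
    · have hE : edgeWord φ (IsCycleEdge W) (s :: l) v =
          crossedEdge φ s u :: edgeWord φ (IsCycleEdge W) l v := by
        rw [edgeWord, if_neg]; rw [hC]; tauto
      rw [hE]
      constructor
      · rcases ih with ⟨he, ih⟩ | ⟨e, rest, t, l', he, hll, j, hj, ih⟩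
        · rw [he]; exact List.isChain_singleton _
        · rw [he] at hred ⊢
          refine List.isChain_cons_cons.2 ⟨fun h => ?_, hred⟩
          by_contra hne
          have hs : s.1 = e.1.1 := congrArg Prod.fst h
          have hs2 : s.2 = !e.2 := by
            change s.2 ≠ e.2 at hne
            revert hne; cases s.2 <;> cases e.2 <;> simp
          have hend : u = cond e.2 (φ e.1.1 e.1.2) e.1.2 := by
            have h' : cond s.2 u ((φ s.1)⁻¹ u) = e.1.2 := congrArg Prod.snd h
            rw [hs2, hs] at h'
            revert h'
            cases e.2
            · exact id
            · intro h'; exact (Perm.inv_eq_iff_eq.1 h')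
          rcases ih with ⟨h0, h1, h2⟩ | ⟨h0, h1, h2⟩ | ⟨h0, h1, h2⟩
          · have h3 := hhead t l' hll
            simp [h2, hs, hs2] at h3
          · rw [← hend] at h1
            exact hnat j h0 (by omega) (by simpa using h1.symm)
          · rw [← hend] at h1
            exact hnat j h0 (by omega) (by simpa using h1)
      · right
        refine ⟨_, _, s, l, rfl, rfl, 0, by simp, Or.inl ⟨rfl, ?_, rfl⟩⟩
        rw [hpos]
        rcases s with ⟨x, _ | _⟩ <;> simp [letterPerm, crossedEdge]

end ReadingWalks

theorem exists_conj_isCyclicallyReduced {α : Type*} (h : FreeGroup α) :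
    ∃ (g : FreeGroup α) (L : List (α × Bool)), IsCyclicallyReduced L ∧
      h = g * FreeGroup.mk L * g⁻¹ := by
  classical
  refine ⟨FreeGroup.mk (FreeGroup.reduceCyclically.conjugator h.toWord),
    FreeGroup.reduceCyclically h.toWord,
    FreeGroup.reduceCyclically.isCyclicallyReduced FreeGroup.isReduced_toWord, ?_⟩
  rw [FreeGroup.inv_mk, FreeGroup.mul_mk, FreeGroup.mul_mk,
    FreeGroup.reduceCyclically.conj_conjugator_reduceCyclically, FreeGroup.mk_toWord]

theorem exists_perm_dvd_orderOf {α : Type*} {h : FreeGroup α} (hh : h ≠ 1) {q : ℕ} (hq : 0 < q) :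
    ∃ (M : ℕ) (_ : NeZero M) (φ : FreeGroup α →* Perm (ZMod M)), q ∣ orderOf (φ h) := by
  obtain ⟨g, L, hL, rfl⟩ := exists_conj_isCyclicallyReduced h
  have hne : L ≠ [] := by
    rintro rfl
    simp [← FreeGroup.one_eq_mk] at hh
  obtain ⟨f, hf, hchain, hLf⟩ := exists_periodic_letters hL hne
  have hl : 0 < L.length := List.length_pos_iff.2 hne
  set c := L.length with hc
  have hM : NeZero (c * q) := ⟨(Nat.mul_pos hl hq).ne'⟩
  obtain ⟨W, hWk, hW⟩ := exists_cyclic_word_of_periodic hf hchain (dvd_mul_right c q)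
  obtain ⟨φ, hφ⟩ := exists_letterPerm_add_one hW
  refine ⟨c * q, hM, FreeGroup.lift φ, ?_⟩
  have hstep : ∀ m : ℕ, FreeGroup.lift φ (FreeGroup.mk L) ((m * c + c : ℕ)) = (m * c : ℕ) := by
    intro m
    have := (lift_mk_of_forall_getElem_eq hφ L (m * c : ℕ) (fun k hk => by
      rw [← Nat.cast_add, hWk]
      have h2 : L[k] = f k := by
        have := List.getElem_of_eq hLf hk
        simpa using this
      have h3 : ∀ m, f (m * c + k) = f k := by
        intro m
        induction m with
        | zero => simp
        | succ m ih => rw [← ih, ← hf (m * c + k)]; congr 1; ring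
      rw [h2, h3])).1
    rw [← this]
    push_cast
    rfl
  have hpow : ∀ m : ℕ, (FreeGroup.lift φ (FreeGroup.mk L) ^ m) ((m * c : ℕ)) = 0 := by
    intro m
    induction m with
    | zero => simp
    | succ m ih =>
      rw [pow_succ, Perm.mul_apply, Nat.succ_mul, hstep, ih]
  have hconj : orderOf (FreeGroup.lift φ (g * FreeGroup.mk L * g⁻¹)) =
      orderOf (FreeGroup.lift φ (FreeGroup.mk L)) := by
    rw [map_mul, map_mul, map_inv, ← MulAut.conj_apply, MulEquiv.orderOf_eq]
  rw [hconj]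
  have h0 := hpow (orderOf (FreeGroup.lift φ (FreeGroup.mk L)))
  rw [pow_orderOf_eq_one, Perm.one_apply, ZMod.natCast_eq_zero_iff, mul_comm _ c] at h0
  exact Nat.dvd_of_mul_dvd_mul_left hl h0

/-- Finitely many nontrivial elements of a free group act without fixed points on a common finite
set of cardinality prime to `p`. -/
theorem exists_perm_forall_ne_of_ne_one {α : Type} (T : Finset (FreeGroup α))
    (hT : ∀ h ∈ T, h ≠ 1) {p : ℕ} (hp : p.Prime) :
    ∃ (Y : Type) (_ : Finite Y) (ρ : FreeGroup α →* Perm Y), ¬ p ∣ Nat.card Y ∧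
      ∀ h ∈ T, ∀ y, ρ h y ≠ y := by
  obtain ⟨q, hpq, hq⟩ := Nat.exists_infinite_primes (p + 1)
  have := fun h : T => exists_perm_dvd_orderOf (hT h h.2) hq.pos
  choose M hM φ hφ using this
  let G := ∀ h : T, Perm (ZMod (M h))
  let Φ : FreeGroup α →* G := MonoidHom.pi φ
  have : Fact p.Prime := ⟨hp⟩
  let P : Sylow p G := default
  refine ⟨G ⧸ (P : Subgroup G), inferInstance, (MulAction.toPermHom G _).comp Φ, ?_, ?_⟩
  · exact P.not_dvd_index
  · intro h hh y hy
    obtain ⟨g, rfl⟩ := QuotientGroup.mk_surjective y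
    have hmem : g⁻¹ * (Φ h * g) ∈ (P : Subgroup G) := QuotientGroup.eq.1 (Eq.symm hy)
    obtain ⟨k, hk⟩ := IsPGroup.iff_orderOf.1 P.isPGroup' ⟨_, hmem⟩
    have h1 : orderOf (Φ h) = p ^ k := by
      rw [← hk, Subgroup.orderOf_mk, ← mul_assoc]
      have : g⁻¹ * Φ h * g = MulAut.conj g⁻¹ (Φ h) := by
        rw [MulAut.conj_apply, inv_inv]
      rw [this, MulEquiv.orderOf_eq]
    have h2 : q ∣ p ^ k := by
      rw [← h1]
      exact (hφ ⟨h, hh⟩).trans (orderOf_map_dvd (Pi.evalMonoidHom _ (⟨h, hh⟩ : T)) (Φ h))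
    have := (Nat.prime_dvd_prime_iff_eq hq hp).1 (hq.dvd_of_dvd_pow h2)
    omega

theorem eq_nil_of_mk_eq_one {α : Type*} {L : List (α × Bool)} (hL : IsReduced L)
    (h : FreeGroup.mk L = 1) : L = [] := by
  classical
  rw [← hL.reduce_eq, ← FreeGroup.toWord_mk, h, FreeGroup.toWord_one]

/-- If a cyclically reduced word of length `c` has a `p ^ a`-th root in every finite permutation
action, then it has period `c / p ^ a`. -/
theorem periodic_div_of_forall_perm_eq_pow {α : Type} {f : ℕ → α × Bool} {c : ℕ} (hc : 0 < c)
    (hf : ∀ k, f (k + c) = f k)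
    (hchain : ∀ k, (f k).1 = (f (k + 1)).1 → (f k).2 = (f (k + 1)).2)
    {p a : ℕ} (hp : p.Prime)
    (h : ∀ (Ω : Type) [Finite Ω] (ψ : FreeGroup α →* Perm Ω),
      ∃ τ : Perm Ω, ψ (FreeGroup.mk ((List.range c).map f)) = τ ^ p ^ a) :
    p ^ a ∣ c ∧ ∀ k, f (k + c / p ^ a) = f k := by
  classical
  have hM : NeZero (c * p) := ⟨(Nat.mul_pos hc hp.pos).ne'⟩
  obtain ⟨W, hWk, hW⟩ := exists_cyclic_word_of_periodic hf hchain (dvd_mul_right c p)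
  obtain ⟨φ, hφ⟩ := exists_letterPerm_add_one hW
  let l := (List.range (c * p)).map f
  have hllen : l.length = c * p := by simp [l]
  have hlk : ∀ k (hk : k < l.length), l[k] = W k := by
    intro k hk
    simp [l, hWk]
  have hlred : IsReduced l := by
    rw [FreeGroup.IsReduced, List.isChain_iff_getElem]
    intro i hi
    simpa [l] using hchain i
  have hMcast : ((l.length : ℕ) : ZMod (c * p)) = 0 := by rw [hllen]; exact ZMod.natCast_self _
  set w := FreeGroup.mk ((List.range c).map f) with hw
  have hlw : FreeGroup.mk l = w ^ p := mk_map_range_mul hf p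
  let T : Finset (FreeGroup (α × ZMod (c * p))) :=
    (Finset.univ.image fun v => FreeGroup.mk (edgeWord φ (IsCycleEdge W) l v)).filter (· ≠ 1)
  obtain ⟨Y, hY, ρ, hYp, hρ⟩ :=
    exists_perm_forall_ne_of_ne_one T (fun h hh => (Finset.mem_filter.1 hh).2) hp
  let ψ := FreeGroup.lift (twistedPerm φ (IsCycleEdge W) ρ)
  let S := periodSubgroup W
  have hcS : (c : ZMod (c * p)) ∈ S := by
    intro k
    rw [← ZMod.natCast_zmod_val k, ← Nat.cast_add, hWk, hWk, add_comm, hf]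
  have hfix_of_mem : ∀ v ∈ S, ∀ y, ψ (w ^ p) (v, y) = (v, y) := by
    intro v hv y
    obtain ⟨h1, h2⟩ := lift_mk_of_forall_getElem_eq hφ l v (fun k hk => by rw [hlk, hv])
    rw [hMcast, add_zero] at h1 h2
    rw [← hlw, lift_twistedPerm, h1, h2, ← FreeGroup.one_eq_mk, map_one, Perm.one_apply]
  have hmem_of_fix : ∀ v y, ψ (w ^ p) (v, y) = (v, y) → v ∈ S := by
    intro v y hvy
    rw [← hlw, lift_twistedPerm] at hvy
    obtain ⟨hred, hcases⟩ := edgeWord_cases hφ l hlred hllen.le v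
    have hone : FreeGroup.mk (edgeWord φ (IsCycleEdge W) l v) = 1 := by
      by_contra hne
      exact hρ _ (Finset.mem_filter.2 ⟨Finset.mem_image_of_mem _ (Finset.mem_univ v), hne⟩) y
        (congrArg Prod.snd hvy)
    have hnil := eq_nil_of_mk_eq_one hred hone
    rw [hMcast, sub_zero, add_zero] at hcases
    have hval : ∀ k : ZMod (c * p), k.val < l.length := fun k => by
      rw [hllen]; exact ZMod.val_lt k
    rcases hcases with ⟨-, ⟨-, h1⟩ | ⟨-, h1⟩⟩ | ⟨e, rest, -, -, he, -⟩
    · intro k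
      have h2 := h1 k.val (hval k)
      rw [hlk, ZMod.natCast_zmod_val] at h2
      exact h2.symm
    · exfalso
      have h2 : ∀ k, W (v - 1 - k) = ((W k).1, !(W k).2) := by
        intro k
        have h2 := h1 k.val (hval k)
        rwa [hlk, ZMod.natCast_zmod_val] at h2
      obtain ⟨m, hm⟩ := Nat.even_or_odd' (v - 1).val
      have hv : v - 1 = ((v - 1).val : ℕ) := (ZMod.natCast_zmod_val _).symm
      have h3 := h2 m
      rcases hm with hm | hm
      · have h4 : v - 1 - m = m := by rw [hv, hm]; push_cast; ring
        rw [h4] at h3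
        have := congrArg Prod.snd h3
        simp at this
      · have h4 : v - 1 - m = m + 1 := by rw [hv, hm]; push_cast; ring
        rw [h4] at h3
        have h5 := hW m
        simp [h3] at h5
    · rw [hnil] at he
      exact absurd he (by simp)
  have hnofix : ∀ z, ψ w z ≠ z := by
    rintro ⟨v, y⟩ hvy
    have hv : v ∈ S := by
      apply hmem_of_fix v y
      rw [map_pow, ← Perm.iterate_eq_pow]
      exact Function.iterate_fixed hvy p
    have hvc : v - c ∈ S := S.sub_mem hv hcS
    have h1 := (lift_mk_of_forall_getElem_eq hφ ((List.range c).map f) (v - c) (fun k hk => by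
      rw [hvc, hWk]; simp)).1
    rw [List.length_map, List.length_range, sub_add_cancel] at h1
    have h2 := congrArg Prod.fst hvy
    rw [hw, lift_twistedPerm] at h2
    rw [h1] at h2
    have h3 : (c : ZMod (c * p)) = 0 := sub_eq_self.1 h2
    rw [ZMod.natCast_eq_zero_iff] at h3
    have h4 := Nat.le_of_dvd hc h3
    nlinarith [hp.two_le]
  obtain ⟨τ, hτ⟩ := h (ZMod (c * p) × Y) ψ
  have hdvd := pow_succ_dvd_card_fixedPoints_pow hp a τ (by rw [← hτ]; exact hnofix)
  have hcard : Nat.card {z // (τ ^ p ^ (a + 1)) z = z} = Nat.card S * Nat.card Y := by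
    rw [← Nat.card_prod]
    refine Nat.card_congr ((Equiv.subtypeEquivRight fun z => ?_).trans
      (Equiv.prodSubtypeFstEquivSubtypeProd (p := fun v => v ∈ S)))
    rw [pow_succ, pow_mul, ← hτ, ← map_pow]
    exact ⟨hmem_of_fix z.1 z.2, fun hz => hfix_of_mem z.1 hz z.2⟩
  rw [hcard] at hdvd
  have hdS : p ^ (a + 1) ∣ Nat.card S :=
    (Nat.Coprime.pow_left _ ((Nat.Prime.coprime_iff_not_dvd hp).2 hYp)).dvd_of_dvd_mul_right hdvd
  have hS : Nat.card S ∣ c * p := by simpa using S.card_addSubgroup_dvd_card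
  have hdiv : p ^ a ∣ c := by
    have := hdS.trans hS
    rw [pow_succ] at this
    exact Nat.dvd_of_mul_dvd_mul_right hp.pos this
  refine ⟨hdiv, fun k => ?_⟩
  have hmem := natCast_div_mem_of_dvd_card S hdS k
  rw [pow_succ, Nat.mul_div_mul_right _ _ hp.pos, ← Nat.cast_add, hWk, hWk] at hmem
  rw [add_comm, hmem]

/-- A sequence of period `c` has period `c / d` as soon as it has period `c / p ^ a` for every prime
power `p ^ a` dividing `d`. -/
theorem periodic_div_of_prime_pow {β : Type*} {f : ℕ → β} {c d : ℕ} (hc : 0 < c)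
    (hf : ∀ k, f (k + c) = f k)
    (h : ∀ p a : ℕ, p.Prime → p ^ a ∣ d → p ^ a ∣ c ∧ ∀ k, f (k + c / p ^ a) = f k) :
    d ∣ c ∧ ∀ k, f (k + c / d) = f k := by
  have hM : NeZero c := ⟨hc.ne'⟩
  let W : ZMod c → β := fun i => f i.val
  have hWk : ∀ k : ℕ, W k = f k := val_natCast_of_periodic hf dvd_rfl
  let S := periodSubgroup W
  have hdS : d ∣ Nat.card S := by
    refine (Nat.dvd_iff_prime_pow_dvd_dvd _ _).2 fun p a hp hpa => ?_
    obtain ⟨h1, h2⟩ := h p a hp hpa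
    have hmem : ((c / p ^ a : ℕ) : ZMod c) ∈ S := by
      intro k
      rw [← ZMod.natCast_zmod_val k, ← Nat.cast_add, hWk, hWk, add_comm, h2]
    have hord : addOrderOf ((c / p ^ a : ℕ) : ZMod c) = p ^ a := by
      rw [ZMod.addOrderOf_coe _ hc.ne', Nat.gcd_eq_right (Nat.div_dvd_of_dvd h1),
        Nat.div_div_self h1 hc.ne']
    rw [← hord, ← AddSubgroup.addOrderOf_mk _ hmem]
    exact addOrderOf_dvd_natCard _
  refine ⟨hdS.trans (by simpa using S.card_addSubgroup_dvd_card), fun k => ?_⟩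
  have hmem := natCast_div_mem_of_dvd_card S hdS k
  rw [← Nat.cast_add, hWk, hWk] at hmem
  rw [add_comm, hmem]

/-- Let `F` be a finitely generated free group, `w ∈ F` and `d ≥ 1`.  If for every
`N ≥ 1` and every homomorphism `φ : F →* S_N` the permutation `φ w` is a `d`-th power
in `S_N`, then `w` is a `d`-th power in `F`. -/
theorem power_of_all_symmetric_images_power
    (r : ℕ) (w : FreeGroup (Fin r)) (d : ℕ) (hd : 1 ≤ d)
    (h : ∀ N : ℕ, 1 ≤ N → ∀ φ : FreeGroup (Fin r) →* Equiv.Perm (Fin N),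
      ∃ τ : Equiv.Perm (Fin N), φ w = τ ^ d) :
    ∃ v : FreeGroup (Fin r), w = v ^ d := by
  obtain ⟨g, L, hL, rfl⟩ := exists_conj_isCyclicallyReduced w
  by_cases hne : L = []
  · exact ⟨1, by simp [hne, ← FreeGroup.one_eq_mk]⟩
  obtain ⟨f, hf, hchain, hLf⟩ := exists_periodic_letters hL hne
  have hc : 0 < L.length := List.length_pos_iff.2 hne
  have hroot : ∀ (Ω : Type) [Finite Ω] (ψ : FreeGroup (Fin r) →* Perm Ω),
      ∃ τ : Perm Ω, ψ (FreeGroup.mk L) = τ ^ d := by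
    intro Ω _ ψ
    rcases isEmpty_or_nonempty Ω with hΩ | hΩ
    · exact ⟨1, Subsingleton.elim _ _⟩
    let E : Perm Ω ≃* Perm (Fin (Nat.card Ω)) := (Finite.equivFin Ω).permCongrHom
    obtain ⟨τ, hτ⟩ := h (Nat.card Ω) Nat.card_pos (E.toMonoidHom.comp ψ)
    refine ⟨(ψ g)⁻¹ * E.symm τ * ψ g, ?_⟩
    have h1 : ψ (g * FreeGroup.mk L * g⁻¹) = E.symm τ ^ d := by
      rw [← map_pow, MulEquiv.eq_symm_apply]
      exact hτ
    have h2 : ((ψ g)⁻¹ * E.symm τ * ψ g) ^ d = (ψ g)⁻¹ * E.symm τ ^ d * ψ g := by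
      simpa using conj_pow (a := (ψ g)⁻¹) (b := E.symm τ) (i := d)
    rw [h2, ← h1, map_mul, map_mul, map_inv]
    group
  obtain ⟨hdvd, hper⟩ := periodic_div_of_prime_pow (d := d) hc hf fun p a hp hpa =>
    periodic_div_of_forall_perm_eq_pow hc hf hchain hp fun Ω _ ψ => by
      obtain ⟨τ, hτ⟩ := hroot Ω ψ
      refine ⟨τ ^ (d / p ^ a), ?_⟩
      rw [← hLf, hτ, ← pow_mul, Nat.div_mul_cancel hpa]
  refine ⟨g * FreeGroup.mk ((List.range (L.length / d)).map f) * g⁻¹, ?_⟩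
  rw [conj_pow, ← mk_map_range_mul hper, Nat.div_mul_cancel hdvd, ← hLf]
end

section
/- Let F = F_r be the free group on a basis x_1, …, x_r and let d ≥ 1 be an integer. If w ∈ F induces the same measure as x_1^d on the symmetric group S_N for every N ∈ ℤ_{≥1} (i.e., for every N and every σ ∈ S_N, the number of homomorphisms φ : F → S_N with φ(w) = σ equals the number with φ(x_1^d) = σ), then there is an automorphism of F mapping x_1^d to w. -/
section SubsetExpansion

open Filter Asymptotics Finset
open scoped Classical

variable {ι : Type*}

/-- A family of real sequences indexed by the subsets of `ι` has a *subset expansion* if it is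
eventually given by summing over the subsets `T` of the index a term of order `N ^ (-|T|)`. -/
def HasSubsetExpansion (g : Finset ι → ℕ → ℝ) : Prop :=
  ∃ c : Finset ι → ℕ → ℝ, (∀ A, ∀ᶠ N in atTop, g A N = ∑ T ∈ A.powerset, c T N) ∧
    ∀ T, c T =O[atTop] fun N => ((N : ℝ)⁻¹) ^ #T

namespace HasSubsetExpansion

theorem inv_pow_isBigO {a b : ℕ} (h : a ≤ b) :
    (fun N : ℕ => ((N : ℝ)⁻¹) ^ b) =O[atTop] fun N => ((N : ℝ)⁻¹) ^ a := by
  refine IsBigO.of_bound 1 ?_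
  filter_upwards [eventually_ge_atTop 1] with N hN
  have hN' : (1 : ℝ) ≤ N := by exact_mod_cast hN
  rw [one_mul, Real.norm_of_nonneg (by positivity), Real.norm_of_nonneg (by positivity)]
  exact pow_le_pow_of_le_one (by positivity) (inv_le_one_of_one_le₀ hN') h

theorem const (a : ℝ) : HasSubsetExpansion (fun (_ : Finset ι) _ => a) := by
  refine ⟨fun T _ => if T = ∅ then a else 0, fun A => ?_, fun T => ?_⟩
  · refine Eventually.of_forall fun N => ?_
    rw [Finset.sum_ite_eq' A.powerset ∅]
    simp
  · by_cases hT : T = ∅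
    · subst hT
      simpa using isBigO_const_const a (one_ne_zero (α := ℝ)) _
    · simpa [hT] using isBigO_zero _ _

theorem add {g g' : Finset ι → ℕ → ℝ} (hg : HasSubsetExpansion g) (hg' : HasSubsetExpansion g') :
    HasSubsetExpansion (fun A N => g A N + g' A N) := by
  obtain ⟨c, hc, hO⟩ := hg
  obtain ⟨c', hc', hO'⟩ := hg'
  refine ⟨fun T N => c T N + c' T N, fun A => ?_, fun T => (hO T).add (hO' T)⟩
  filter_upwards [hc A, hc' A] with N h h'
  rw [h, h', Finset.sum_add_distrib]

theorem mul {g g' : Finset ι → ℕ → ℝ} (hg : HasSubsetExpansion g) (hg' : HasSubsetExpansion g') :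
    HasSubsetExpansion (fun A N => g A N * g' A N) := by
  obtain ⟨c, hc, hO⟩ := hg
  obtain ⟨c', hc', hO'⟩ := hg'
  refine ⟨fun T N => ∑ p ∈ T.powerset ×ˢ T.powerset with p.1 ∪ p.2 = T, c p.1 N * c' p.2 N,
    fun A => ?_, fun T => ?_⟩
  · filter_upwards [hc A, hc' A] with N h h'
    rw [h, h', Finset.sum_mul_sum, ← Finset.sum_product']
    rw [← Finset.sum_fiberwise_of_maps_to (s := A.powerset ×ˢ A.powerset) (t := A.powerset)
      (g := fun p => p.1 ∪ p.2)]
    · refine Finset.sum_congr rfl fun T hT => Finset.sum_congr ?_ fun _ _ => rfl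
      ext p
      simp only [mem_filter, mem_product, mem_powerset] at hT ⊢
      constructor
      · rintro ⟨_, rfl⟩
        exact ⟨⟨subset_union_left, subset_union_right⟩, rfl⟩
      · rintro ⟨_, rfl⟩
        exact ⟨⟨subset_union_left.trans hT, subset_union_right.trans hT⟩, rfl⟩
    · rintro p hp
      simp only [mem_product, mem_powerset] at hp ⊢
      exact union_subset hp.1 hp.2
  · refine IsBigO.fun_sum fun p hp => ?_
    have hp' : p.1 ∪ p.2 = T := (mem_filter.mp hp).2
    refine ((hO p.1).mul (hO' p.2)).trans ?_
    simp_rw [← pow_add]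
    exact inv_pow_isBigO (hp' ▸ card_union_le _ _)

theorem pow {g : Finset ι → ℕ → ℝ} (hg : HasSubsetExpansion g) (n : ℕ) :
    HasSubsetExpansion (fun A N => g A N ^ n) := by
  induction n with
  | zero => simpa using const 1
  | succ n ih => simpa [pow_succ] using ih.mul hg

theorem sum {κ : Type*} (s : Finset κ) {g : κ → Finset ι → ℕ → ℝ}
    (hg : ∀ k, HasSubsetExpansion (g k)) :
    HasSubsetExpansion (fun A N => ∑ k ∈ s, g k A N) := by
  induction s using Finset.induction_on with
  | empty => simpa using const 0
  | insert a s ha ih => simpa [Finset.sum_insert ha] using (hg a).add ih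

theorem prod {κ : Type*} (s : Finset κ) {g : κ → Finset ι → ℕ → ℝ}
    (hg : ∀ k, HasSubsetExpansion (g k)) :
    HasSubsetExpansion (fun A N => ∏ k ∈ s, g k A N) := by
  induction s using Finset.induction_on with
  | empty => simpa using const 1
  | insert a s ha ih => simpa [Finset.prod_insert ha] using (hg a).mul ih

theorem indicator (i : ι) :
    HasSubsetExpansion (fun A N => if i ∈ A then (N : ℝ)⁻¹ else 0) := by
  refine ⟨fun T N => if T = {i} then (N : ℝ)⁻¹ else 0, fun A => ?_, fun T => ?_⟩
  · refine Eventually.of_forall fun N => ?_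
    rw [Finset.sum_ite_eq' A.powerset {i}]
    simp
  · by_cases hT : T = {i}
    · subst hT
      simpa using isBigO_refl _ _
    · simpa [hT] using isBigO_zero _ _

/-- Möbius inversion on the Boolean lattice, keeping track of orders of decay. -/
theorem exists_moebius {g : Finset ι → ℕ → ℝ} {K : ℕ}
    (hg : ∀ A, g A =O[atTop] fun N => ((N : ℝ)⁻¹) ^ K) :
    ∃ c : Finset ι → ℕ → ℝ, (∀ A N, g A N = ∑ T ∈ A.powerset, c T N) ∧
      ∀ T, c T =O[atTop] fun N => ((N : ℝ)⁻¹) ^ K := by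
  let c : Finset ι → ℕ → ℝ := WellFounded.fix (C := fun _ => ℕ → ℝ) (wellFounded_lt (α := Finset ι))
    fun A ih N => g A N - ∑ T ∈ A.ssubsets.attach, ih T.1 (mem_ssubsets.mp T.2) N
  have hc : ∀ A, c A = fun N => g A N - ∑ T ∈ A.ssubsets, c T N := by
    intro A
    have := WellFounded.fix_eq (C := fun _ => ℕ → ℝ) (wellFounded_lt (α := Finset ι))
      (fun A ih N => g A N - ∑ T ∈ A.ssubsets.attach, ih T.1 (mem_ssubsets.mp T.2) N) A
    refine this.trans ?_
    funext N
    rw [← Finset.sum_attach A.ssubsets]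
  refine ⟨c, fun A N => ?_, fun T => ?_⟩
  · rw [← Finset.sum_erase_add _ _ (mem_powerset_self A), hc A]
    simp [ssubsets]
  · induction T using Finset.strongInduction with
    | H A ih =>
      rw [hc A]
      exact (hg A).sub (IsBigO.fun_sum fun T hT => ih T (mem_ssubsets.mp hT))

theorem of_isBigO [Fintype ι] {g : Finset ι → ℕ → ℝ}
    (hg : ∀ A, g A =O[atTop] fun N => ((N : ℝ)⁻¹) ^ Fintype.card ι) :
    HasSubsetExpansion g := by
  obtain ⟨c, hc, hO⟩ := exists_moebius hg
  exact ⟨c, fun A => Eventually.of_forall fun N => hc A N,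
    fun T => (hO T).trans (inv_pow_isBigO (card_le_univ T))⟩

theorem congr {g g' : Finset ι → ℕ → ℝ} (hg : HasSubsetExpansion g)
    (h : ∀ A, ∀ᶠ N in atTop, g' A N = g A N) : HasSubsetExpansion g' := by
  obtain ⟨c, hc, hO⟩ := hg
  exact ⟨c, fun A => by filter_upwards [hc A, h A] with N h1 h2; rw [h2, h1], hO⟩

theorem inv_one_sub [Fintype ι] {h : Finset ι → ℕ → ℝ} (hh : HasSubsetExpansion h)
    (hO : ∀ A, h A =O[atTop] fun N => (N : ℝ)⁻¹) :
    HasSubsetExpansion (fun A N => (1 - h A N)⁻¹) := by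
  have hlim : ∀ A, Tendsto (h A) atTop (nhds 0) := fun A =>
    (hO A).trans_tendsto tendsto_inv_atTop_nhds_zero_nat
  have hlim' : ∀ A, Tendsto (fun N => (1 - h A N)⁻¹) atTop (nhds 1) := fun A => by
    simpa using ((tendsto_const_nhds (x := (1 : ℝ))).sub (hlim A)).inv₀ (by simp)
  have htail : HasSubsetExpansion
      (fun A N => h A N ^ Fintype.card ι * (1 - h A N)⁻¹) := by
    refine of_isBigO fun A => ?_
    simpa using ((hO A).pow (Fintype.card ι)).mul ((hlim' A).isBigO_one ℝ)
  refine ((sum (range (Fintype.card ι)) fun k => hh.pow k).add htail).congr fun A => ?_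
  filter_upwards [(hlim A).eventually_ne zero_ne_one] with N hN
  have h1 : (1 - h A N) ≠ 0 := sub_ne_zero.mpr (Ne.symm hN)
  have := geom_sum_mul_neg (h A N) (Fintype.card ι)
  field_simp
  linarith

end HasSubsetExpansion

end SubsetExpansion

section Counting

open Finset
open scoped Classical

/-- The number of functions that are injective on each fibre of `p`, counted by choosing the
values one after the other. -/
theorem card_fiberInjective_fin {C α : Type*} [Fintype α] (m : ℕ) (p : Fin m → C) :
    Nat.card {f : Fin m → α // ∀ x y, p x = p y → f x = f y → x = y} =
      ∏ j, (Nat.card α - Nat.card {i // i < j ∧ p i = p j}) := by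
  induction m with
  | zero =>
    have : Unique {f : Fin 0 → α // ∀ x y, p x = p y → f x = f y → x = y} :=
      ⟨⟨⟨Fin.elim0, fun x => x.elim0⟩⟩, fun f => Subtype.ext (funext fun x => x.elim0)⟩
    simp
  | succ m ih =>
    let e : {f : Fin (m + 1) → α // ∀ x y, p x = p y → f x = f y → x = y} ≃
        Σ g : {f : Fin m → α // ∀ x y, p x.castSucc = p y.castSucc → f x = f y → x = y},
          {a : α // a ∉ Set.range
            fun i : {i : Fin m // p i.castSucc = p (Fin.last m)} => g.1 i.1} :=
      { toFun := fun f => ⟨⟨fun i => f.1 i.castSucc, fun x y h h' =>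
          Fin.castSucc_injective m (f.2 _ _ h h')⟩, ⟨f.1 (Fin.last m), by
            rintro ⟨⟨i, hi⟩, h⟩
            exact (Fin.castSucc_lt_last i).ne (f.2 _ _ hi h)⟩⟩
        invFun := fun g => ⟨Fin.snoc (α := fun _ => α) g.1.1 g.2.1, by
          intro x y hp hf
          induction x using Fin.lastCases with
          | last =>
            induction y using Fin.lastCases with
            | last => rfl
            | cast y =>
              refine (g.2.2 ⟨⟨y, hp.symm⟩, ?_⟩).elim
              simpa using hf.symm
          | cast x =>
            induction y using Fin.lastCases with
            | last =>
              refine (g.2.2 ⟨⟨x, hp⟩, ?_⟩).elim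
              simpa using hf
            | cast y =>
              rw [g.1.2 x y hp (by simpa using hf)]⟩
        left_inv := fun f => by
          apply Subtype.ext
          funext x
          induction x using Fin.lastCases <;> simp
        right_inv := fun g => by
          rcases g with ⟨⟨g, hg⟩, ⟨a, ha⟩⟩
          have h1 : (fun i => Fin.snoc (α := fun _ => α) g a (Fin.castSucc i)) = g := by
            funext i
            simp
          refine Sigma.ext (Subtype.ext h1) ?_
          refine (Subtype.heq_iff_coe_heq rfl ?_).mpr ?_
          · simp
          · simp }
    rw [Nat.card_congr e, Nat.card_sigma, Fin.prod_univ_castSucc]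
    have hfib : ∀ g : {f : Fin m → α // ∀ x y, p x.castSucc = p y.castSucc → f x = f y → x = y},
        Nat.card {a : α // a ∉ Set.range
            fun i : {i : Fin m // p i.castSucc = p (Fin.last m)} => g.1 i.1} =
          Nat.card α - Nat.card {i // i < Fin.last m ∧ p i = p (Fin.last m)} := by
      intro g
      have hinj : Function.Injective
          fun i : {i : Fin m // p i.castSucc = p (Fin.last m)} => g.1 i.1 := fun x y hxy =>
        Subtype.ext (g.2 _ _ (x.2.trans y.2.symm) hxy)
      have h1 : Nat.card {i // i < Fin.last m ∧ p i = p (Fin.last m)} =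
          Nat.card {i : Fin m // p i.castSucc = p (Fin.last m)} := by
        refine (Nat.card_congr (Equiv.ofBijective
          (fun i : {i : Fin m // p i.castSucc = p (Fin.last m)} =>
            (⟨i.1.castSucc, Fin.castSucc_lt_last _, i.2⟩ :
              {i // i < Fin.last m ∧ p i = p (Fin.last m)})) ⟨?_, ?_⟩)).symm
        · intro x y hxy
          exact Subtype.ext (Fin.castSucc_injective m (congrArg Subtype.val hxy))
        · rintro ⟨i, hi, hp⟩
          induction i using Fin.lastCases with
          | last => exact (lt_irrefl _ hi).elim
          | cast i => exact ⟨⟨i, hp⟩, rfl⟩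
      rw [h1, ← Nat.card_range_of_injective hinj]
      have := Set.ncard_compl (Set.range
        fun i : {i : Fin m // p i.castSucc = p (Fin.last m)} => g.1 i.1)
      exact this
    simp_rw [hfib]
    rw [Finset.sum_const, smul_eq_mul, Finset.card_univ, ← Nat.card_eq_fintype_card,
      ih (fun i => p i.castSucc)]
    congr 1
    refine Finset.prod_congr rfl fun j _ => ?_
    congr 1
    refine Nat.card_congr (Equiv.ofBijective
          (fun i : {i : Fin m // i < j ∧ p i.castSucc = p j.castSucc} =>
            (⟨i.1.castSucc, Fin.castSucc_lt_castSucc_iff.mpr i.2.1, i.2.2⟩ :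
              {i // i < j.castSucc ∧ p i = p j.castSucc})) ⟨?_, ?_⟩)
    · intro x y hxy
      exact Subtype.ext (Fin.castSucc_injective m (congrArg Subtype.val hxy))
    · rintro ⟨i, hi, hp⟩
      induction i using Fin.lastCases with
      | last => exact absurd hi (not_lt.mpr (Fin.le_last _))
      | cast i => exact ⟨⟨i, Fin.castSucc_lt_castSucc_iff.mp hi, hp⟩, rfl⟩

/-- The functions that are injective on each fibre of `p`. -/
abbrev FiberInjective {Q C : Type*} (p : Q → C) (α : Type*) : Type _ :=
  {f : Q → α // ∀ x y, p x = p y → f x = f y → x = y}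

theorem card_fiberInjective {Q C α : Type*} [Fintype Q] [Fintype α] (p : Q → C) :
    Nat.card (FiberInjective p α) =
      ∏ q, (Nat.card α -
        Nat.card {q' // Fintype.equivFin Q q' < Fintype.equivFin Q q ∧ p q' = p q}) := by
  set o := Fintype.equivFin Q
  have h := card_fiberInjective_fin (α := α) _ (fun i => p (o.symm i))
  rw [← Equiv.prod_comp o] at h
  have h1 : Nat.card (FiberInjective p α) =
      Nat.card (FiberInjective (fun i => p (o.symm i)) α) := by
    refine Nat.card_congr ((Equiv.arrowCongr o (Equiv.refl α)).subtypeEquiv fun f => ?_)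
    constructor
    · intro hf x y hp he
      exact o.symm.injective (hf _ _ hp he)
    · intro hf x y hp he
      exact o.injective (hf (o x) (o y) (by simpa using hp) (by simpa using he))
  rw [h1]
  refine h.trans (Finset.prod_congr rfl fun q _ => ?_)
  congr 1
  refine Nat.card_congr (o.symm.subtypeEquiv fun i => ?_)
  simp

theorem card_fiberInjective_eq_prod_descFactorial {Q C α : Type*} [Finite Q] [Fintype C] [Finite α]
    (p : Q → C) :
    Nat.card (FiberInjective p α) =
      ∏ z, (Nat.card α).descFactorial (Nat.card {q // p q = z}) := by
  let e : FiberInjective p α ≃ (∀ z, {q // p q = z} ↪ α) :=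
    { toFun := fun f z => ⟨fun q => f.1 q.1, fun x y h =>
        Subtype.ext (f.2 _ _ (x.2.trans y.2.symm) h)⟩
      invFun := fun g => ⟨fun q => g (p q) ⟨q, rfl⟩, by
        intro x y hp hg
        have key : ∀ z (hz : p x = z), g (p x) ⟨x, rfl⟩ = g z ⟨x, hz⟩ := by rintro _ rfl; rfl
        exact congrArg Subtype.val ((g (p y)).injective ((key _ hp).symm.trans hg))⟩
      left_inv := fun f => rfl
      right_inv := fun g => by
        funext z
        ext ⟨q, rfl⟩
        rfl }
  have := Fintype.ofFinite α
  have := Fintype.ofFinite Q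
  rw [Nat.card_congr e, Nat.card_pi]
  refine Finset.prod_congr rfl fun z _ => ?_
  rw [Nat.card_eq_fintype_card, Fintype.card_embedding_eq]
  simp [Nat.card_eq_fintype_card]

theorem card_perm_extending {ι α : Type*} [Finite ι] [Finite α] (a t : ι → α)
    (h : ∀ x y, a x = a y ↔ t x = t y) :
    Nat.card {π : Equiv.Perm α // ∀ x, π (a x) = t x} =
      (Nat.card α - Nat.card (Set.range a)).factorial := by
  have := Fintype.ofFinite α
  obtain ⟨π₀, hπ₀⟩ : ∃ π : Equiv.Perm α, ∀ x, π (a x) = t x := by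
    let e : {y // y ∈ Set.range a} ≃ {y // y ∈ Set.range t} :=
      Equiv.ofBijective (fun y => ⟨t y.2.choose, _, rfl⟩) ⟨by
        intro x y hxy
        have := (h _ _).mpr (congrArg Subtype.val hxy)
        rw [x.2.choose_spec, y.2.choose_spec] at this
        exact Subtype.ext this, by
        rintro ⟨_, x, rfl⟩
        refine ⟨⟨a x, x, rfl⟩, Subtype.ext ?_⟩
        exact (h _ _).mp (Exists.choose_spec (⟨x, rfl⟩ : a x ∈ Set.range a))⟩
    refine ⟨e.extendSubtype, fun x => ?_⟩
    rw [Equiv.extendSubtype_apply_of_mem _ _ ⟨x, rfl⟩]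
    exact (h _ _).mp (Exists.choose_spec (⟨x, rfl⟩ : a x ∈ Set.range a))
  have e1 : {π : Equiv.Perm α // ∀ x, π (a x) = t x} ≃
      {π : Equiv.Perm α // ∀ y, ¬ (y ∉ Set.range a) → π y = y} :=
    (Equiv.mulLeft π₀⁻¹).subtypeEquiv fun π => by
      constructor
      · intro hπ y hy
        obtain ⟨x, rfl⟩ := not_not.mp hy
        simp [hπ, Equiv.symm_apply_eq, hπ₀]
      · intro hπ x
        have := hπ (a x) (not_not.mpr ⟨x, rfl⟩)
        simpa [Equiv.symm_apply_eq, hπ₀] using this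
  rw [Nat.card_congr (e1.trans (Equiv.Perm.subtypeEquivSubtypePerm _).symm), Nat.card_perm]
  congr 1
  exact Set.ncard_compl (Set.range a)

end Counting

section Graphs

open Filter Asymptotics Finset
open scoped Classical Nat

instance Setoid.instFinite {V : Type*} [Finite V] : Finite (Setoid V) :=
  Finite.of_injective (fun S : Setoid V => (S : V → V → Prop)) fun S T h =>
    Setoid.ext fun a b => by rw [show S a b = T a b from congrFun (congrFun h a) b]

noncomputable instance Setoid.instFintype {V : Type*} [Finite V] : Fintype (Setoid V) :=
  Fintype.ofFinite _

/-- A directed multigraph with vertices `V` and edges `E`, whose edges carry labels in `K`. -/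
structure LabelledGraph (V E K : Type*) where
  /-- the initial vertex of an edge -/
  src : E → V
  /-- the terminal vertex of an edge -/
  tgt : E → V
  /-- the label of an edge -/
  gen : E → K

namespace LabelledGraph

variable {V E K : Type*} (G : LabelledGraph V E K)

/-- A vertex partition is folded if in the quotient graph edges with the same label that share
one end share the other one as well. -/
def Folded (S : Setoid V) : Prop :=
  ∀ a b, G.gen a = G.gen b → (S (G.src a) (G.src b) ↔ S (G.tgt a) (G.tgt b))

/-- The identification of edges induced by an identification of vertices. -/
def edgeSetoid (S : Setoid V) : Setoid E := Setoid.ker G.gen ⊓ S.comap G.src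

theorem edgeSetoid_iff {S : Setoid V} {e e' : E} :
    G.edgeSetoid S e e' ↔ G.gen e = G.gen e' ∧ S (G.src e) (G.src e') := Iff.rfl

theorem folded_top : G.Folded ⊤ := fun _ _ _ => Iff.rfl

theorem Folded.inf {S T : Setoid V} (hS : G.Folded S) (hT : G.Folded T) : G.Folded (S ⊓ T) :=
  fun e e' h => and_congr (hS e e' h) (hT e e' h)

theorem folded_sInf {F : Set (Setoid V)} (hF : ∀ S ∈ F, G.Folded S) : G.Folded (sInf F) :=
  fun e e' h => forall₂_congr fun S hS => hF S hS e e' h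

theorem edgeSetoid_inf (S T : Setoid V) :
    G.edgeSetoid (S ⊓ T) = G.edgeSetoid S ⊓ G.edgeSetoid T := by
  ext e e'
  constructor
  · rintro ⟨h1, h2, h3⟩
    exact ⟨⟨h1, h2⟩, h1, h3⟩
  · rintro ⟨⟨h1, h2⟩, _, h3⟩
    exact ⟨h1, h2, h3⟩

theorem edgeSetoid_mono {S T : Setoid V} (h : S ≤ T) : G.edgeSetoid S ≤ G.edgeSetoid T :=
  fun _ _ he => ⟨he.1, h he.2⟩

/-- The ways to let the edge classes `C` act by permutations and the vertices be points, compatibly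
with the graph. -/
def Solutions {C : Type*} (c : E → C) (α : Type*) : Type _ :=
  {x : (C → Equiv.Perm α) × (V → α) // ∀ e, x.1 (c e) (x.2 (G.src e)) = x.2 (G.tgt e)}

/-- The expected number of lifts of the graph to `N` points, when each class of edges acts by an
independent uniform permutation. -/
noncomputable def psi {C : Type*} (c : E → C) (N : ℕ) : ℝ :=
  Nat.card (G.Solutions c (Fin N)) / (N ! : ℝ) ^ Nat.card C

theorem psi_comp_injective {C D : Type*} [Finite D] {j : C → D} (hj : Function.Injective j)
    (c : E → C) (N : ℕ) : G.psi (j ∘ c) N = G.psi c N := by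
  have : Finite C := Finite.of_injective j hj
  let e : G.Solutions (j ∘ c) (Fin N) ≃
      G.Solutions c (Fin N) × ({z // z ∉ Set.range j} → Equiv.Perm (Fin N)) :=
    { toFun := fun x => ⟨⟨⟨fun z => x.1.1 (j z), x.1.2⟩, x.2⟩, fun z => x.1.1 z.1⟩
      invFun := fun y => ⟨⟨fun z => if h : z ∈ Set.range j then y.1.1.1 h.choose else y.2 ⟨z, h⟩,
        y.1.1.2⟩, fun e => by
          have h : j (c e) ∈ Set.range j := ⟨_, rfl⟩
          simp only [Function.comp_apply, dif_pos h]
          rw [hj h.choose_spec]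
          exact y.1.2 e⟩
      left_inv := fun x => by
        apply Subtype.ext
        refine Prod.ext (funext fun z => ?_) rfl
        by_cases h : z ∈ Set.range j
        · simp only [dif_pos h]
          rw [h.choose_spec]
        · simp only [dif_neg h]
      right_inv := fun y => by
        refine Prod.ext (Subtype.ext (Prod.ext (funext fun z => ?_) rfl)) (funext fun z => ?_)
        · have h : j z ∈ Set.range j := ⟨_, rfl⟩
          simp only [dif_pos h]
          rw [hj h.choose_spec]
        · simp only [dif_neg z.2] }
  have hcard : Nat.card {z // z ∉ Set.range j} + Nat.card C = Nat.card D := by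
    rw [← Nat.card_range_of_injective hj, add_comm]
    exact Set.ncard_add_ncard_compl (Set.range j)
  have hN : (N ! : ℝ) ≠ 0 := by positivity
  rw [psi, psi, Nat.card_congr e, Nat.card_prod, Nat.card_fun, Nat.card_perm, Nat.card_fin, ← hcard,
    pow_add]
  push_cast
  field_simp

theorem psi_eq_psi_mk {C : Type*} [Finite C] {c : E → C} {S : Setoid E}
    (h : ∀ e e', S e e' ↔ c e = c e') (N : ℕ) : G.psi c N = G.psi (Quotient.mk S) N := by
  refine G.psi_comp_injective (j := Quotient.lift c fun e e' he => (h e e').mp he) ?_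
    (Quotient.mk S) N
  intro x y
  induction x using Quotient.inductionOn with | h x => ?_
  induction y using Quotient.inductionOn with | h y => ?_
  exact fun hxy => Quotient.sound ((h x y).mpr hxy)

/-- The expected number of lifts when edges act by the same permutation if they have the same label
and their initial vertices are identified by `S`. -/
noncomputable def phi (S : Setoid V) (N : ℕ) : ℝ := G.psi (Quotient.mk (G.edgeSetoid S)) N

/-- The projection between quotients, defined for arbitrary pairs of relations. -/
noncomputable def quotientProj {X : Type*} (S T : Setoid X) (q : Quotient S) : Quotient T :=
  Quotient.mk T q.out

theorem quotientProj_mk {X : Type*} {S T : Setoid X} (h : S ≤ T) (x : X) :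
    quotientProj S T (Quotient.mk S x) = Quotient.mk T x :=
  Quotient.sound (h (Quotient.mk_out x))

theorem card_inf_ker_eq {α : Type*} {S T : Setoid V} (h : S ≤ T) :
    Nat.card {i : V → α // T ⊓ Setoid.ker i = S} =
      Nat.card (FiberInjective (quotientProj S T) α) := by
  refine Nat.card_congr
    { toFun := fun i => ⟨Quotient.lift i.1 fun a b hab => ?_, ?_⟩
      invFun := fun f => ⟨fun v => f.1 (Quotient.mk S v), ?_⟩
      left_inv := fun i => rfl
      right_inv := fun f => ?_ }
  · have : (T ⊓ Setoid.ker i.1) a b := by rw [i.2]; exact hab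
    exact this.2
  · intro x y
    induction x using Quotient.inductionOn with | h x => ?_
    induction y using Quotient.inductionOn with | h y => ?_
    intro hp hi
    rw [quotientProj_mk h, quotientProj_mk h] at hp
    apply Quotient.sound
    have : (T ⊓ Setoid.ker i.1) x y := ⟨Quotient.exact hp, hi⟩
    rwa [i.2] at this
  · ext x y
    constructor
    · rintro ⟨h1, h2⟩
      refine Quotient.exact (f.2 _ _ ?_ h2)
      rw [quotientProj_mk h, quotientProj_mk h]
      exact Quotient.sound h1
    · intro hxy
      refine ⟨h hxy, ?_⟩
      exact congrArg f.1 (Quotient.sound hxy)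
  · apply Subtype.ext
    funext q
    induction q using Quotient.inductionOn with | h x => rfl

theorem folded_inf_ker_of_solution {α : Type*} {S : Setoid V} (hS : G.Folded S) {i : V → α}
    {b : Quotient (G.edgeSetoid S) → Equiv.Perm α}
    (hb : ∀ e, b (Quotient.mk _ e) (i (G.src e)) = i (G.tgt e)) : G.Folded (S ⊓ Setoid.ker i) := by
  intro e e' hgen
  have h1 := hS e e' hgen
  have key : S (G.src e) (G.src e') →
      (i (G.src e) = i (G.src e') ↔ i (G.tgt e) = i (G.tgt e')) := by
    intro hs
    have : (Quotient.mk (G.edgeSetoid S) e) = Quotient.mk _ e' := Quotient.sound ⟨hgen, hs⟩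
    rw [← hb e, ← hb e', this, Equiv.apply_eq_iff_eq]
  constructor
  · rintro ⟨h2, h3⟩
    exact ⟨h1.mp h2, (key h2).mp h3⟩
  · rintro ⟨h2, h3⟩
    exact ⟨h1.mpr h2, (key (h1.mpr h2)).mpr h3⟩

theorem card_solutions_of_folded {α : Type*} [Finite α] [Finite V] [Fintype E] {S : Setoid V}
    (hS : G.Folded S) {i : V → α} (hi : G.Folded (S ⊓ Setoid.ker i)) :
    Nat.card {b : Quotient (G.edgeSetoid S) → Equiv.Perm α //
      ∀ e, b (Quotient.mk _ e) (i (G.src e)) = i (G.tgt e)} =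
    ∏ z : Quotient (G.edgeSetoid S), (Nat.card α - Nat.card {q //
      quotientProj (G.edgeSetoid (S ⊓ Setoid.ker i)) (G.edgeSetoid S) q = z})! := by
  let e : {b : Quotient (G.edgeSetoid S) → Equiv.Perm α //
      ∀ e, b (Quotient.mk _ e) (i (G.src e)) = i (G.tgt e)} ≃
      ∀ z : Quotient (G.edgeSetoid S), {π : Equiv.Perm α //
        ∀ x : {e // Quotient.mk (G.edgeSetoid S) e = z}, π (i (G.src x)) = i (G.tgt x)} :=
    { toFun := fun b z => ⟨b.1 z, fun x => by
        obtain ⟨x, rfl⟩ := x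
        exact b.2 x⟩
      invFun := fun g => ⟨fun z => (g z).1, fun e => (g (Quotient.mk _ e)).2 ⟨e, rfl⟩⟩
      left_inv := fun b => rfl
      right_inv := fun g => rfl }
  rw [Nat.card_congr e, Nat.card_pi]
  refine Finset.prod_congr rfl fun z _ => ?_
  have hrel : ∀ x y : {e // Quotient.mk (G.edgeSetoid S) e = z},
      G.gen x = G.gen y ∧ S (G.src x) (G.src y) := fun x y =>
    Quotient.exact (x.2.trans y.2.symm)
  rw [card_perm_extending (fun x : {e // Quotient.mk (G.edgeSetoid S) e = z} => i (G.src x))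
    (fun x => i (G.tgt x))]
  · congr 2
    have hle : G.edgeSetoid (S ⊓ Setoid.ker i) ≤ G.edgeSetoid S := G.edgeSetoid_mono inf_le_left
    refine (Nat.card_congr (Equiv.ofBijective (fun q : {q //
      quotientProj (G.edgeSetoid (S ⊓ Setoid.ker i)) (G.edgeSetoid S) q = z} =>
        (⟨i (G.src q.1.out), ⟨q.1.out, q.2⟩, rfl⟩ : Set.range
          fun x : {e // Quotient.mk (G.edgeSetoid S) e = z} => i (G.src x))) ⟨?_, ?_⟩)).symm
    · intro x y hxy
      have h1 := hrel ⟨x.1.out, x.2⟩ ⟨y.1.out, y.2⟩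
      apply Subtype.ext
      rw [← x.1.out_eq, ← y.1.out_eq]
      exact Quotient.sound ⟨h1.1, h1.2, congrArg Subtype.val hxy⟩
    · rintro ⟨_, ⟨e, he⟩, rfl⟩
      refine ⟨⟨Quotient.mk _ e, (quotientProj_mk hle e).trans he⟩, Subtype.ext ?_⟩
      exact (Quotient.mk_out (s := G.edgeSetoid (S ⊓ Setoid.ker i)) e).2.2
  · intro x y
    have h1 := hrel x y
    have h2 := hi x y h1.1
    constructor
    · exact fun h => (h2.mp ⟨h1.2, h⟩).2
    · intro h
      exact (h2.mpr ⟨(hS _ _ h1.1).mp h1.2, h⟩).2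

/-- The counting formula, in terms of the folded partitions below a given one. -/
theorem phi_eq_sum [Finite V] [Finite E] {S : Setoid V} (hS : G.Folded S) {N : ℕ}
    (hN : Nat.card E ≤ N) :
    G.phi S N = ∑ T : Setoid V with G.Folded T ∧ T ≤ S,
      (Nat.card (FiberInjective (quotientProj T S) (Fin N)) : ℝ) /
      Nat.card (FiberInjective (quotientProj (G.edgeSetoid T) (G.edgeSetoid S)) (Fin N)) := by
  have := Fintype.ofFinite V
  have := Fintype.ofFinite E
  let F : Setoid V → ℕ := fun T => ∏ z : Quotient (G.edgeSetoid S), (N - Nat.card {q //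
      quotientProj (G.edgeSetoid T) (G.edgeSetoid S) q = z})!
  have hF : ∀ T, F T * Nat.card (FiberInjective (quotientProj (G.edgeSetoid T) (G.edgeSetoid S))
      (Fin N)) = N ! ^ Nat.card (Quotient (G.edgeSetoid S)) := by
    intro T
    rw [card_fiberInjective_eq_prod_descFactorial, ← Finset.prod_mul_distrib,
      Nat.card_eq_fintype_card (α := Quotient (G.edgeSetoid S)),
      Finset.prod_congr rfl fun z _ => ?_,
      Finset.prod_const, Finset.card_univ]
    rw [Nat.card_fin]
    refine Nat.factorial_mul_descFactorial (le_trans ?_ hN)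
    refine (Finite.card_subtype_le _).trans ?_
    exact Nat.card_le_card_of_surjective _ Quotient.mk_surjective
  let e : G.Solutions (Quotient.mk (G.edgeSetoid S)) (Fin N) ≃ Σ i : V → Fin N,
      {b : Quotient (G.edgeSetoid S) → Equiv.Perm (Fin N) //
        ∀ e, b (Quotient.mk _ e) (i (G.src e)) = i (G.tgt e)} :=
    { toFun := fun x => ⟨x.1.2, x.1.1, x.2⟩
      invFun := fun y => ⟨⟨y.2.1, y.1⟩, y.2.2⟩
      left_inv := fun _ => rfl
      right_inv := fun _ => rfl }
  have hfib : ∀ i : V → Fin N, Nat.card {b : Quotient (G.edgeSetoid S) → Equiv.Perm (Fin N) //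
        ∀ e, b (Quotient.mk _ e) (i (G.src e)) = i (G.tgt e)} =
      if G.Folded (S ⊓ Setoid.ker i) then F (S ⊓ Setoid.ker i) else 0 := by
    intro i
    split_ifs with hi
    · rw [G.card_solutions_of_folded hS hi, Nat.card_fin]
    · have : IsEmpty {b : Quotient (G.edgeSetoid S) → Equiv.Perm (Fin N) //
          ∀ e, b (Quotient.mk _ e) (i (G.src e)) = i (G.tgt e)} :=
        ⟨fun b => hi (G.folded_inf_ker_of_solution hS b.2)⟩
      exact Nat.card_of_isEmpty
  have hcount : Nat.card (G.Solutions (Quotient.mk (G.edgeSetoid S)) (Fin N)) =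
      ∑ T : Setoid V with G.Folded T ∧ T ≤ S,
        Nat.card (FiberInjective (quotientProj T S) (Fin N)) * F T := by
    rw [Nat.card_congr e, Nat.card_sigma, Finset.sum_congr rfl fun i _ => hfib i,
      ← Finset.sum_fiberwise_of_maps_to (t := univ) (g := fun i => S ⊓ Setoid.ker i)
        (fun _ _ => mem_univ _), Finset.sum_filter]
    refine Finset.sum_congr rfl fun T _ => ?_
    have h1 : ∀ i ∈ univ.filter (fun i : V → Fin N => S ⊓ Setoid.ker i = T),
        (if G.Folded (S ⊓ Setoid.ker i) then F (S ⊓ Setoid.ker i) else 0) =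
          if G.Folded T then F T else 0 := by
      intro i hi
      rw [(mem_filter.mp hi).2]
    rw [Finset.sum_congr rfl h1, Finset.sum_const, smul_eq_mul]
    by_cases hT : T ≤ S
    · rw [← card_inf_ker_eq hT, Nat.card_eq_fintype_card, Fintype.card_subtype]
      simp [hT]
    · have : univ.filter (fun i : V → Fin N => S ⊓ Setoid.ker i = T) = ∅ := by
        refine Finset.filter_eq_empty_iff.mpr fun i _ h => hT ?_
        rw [← h]
        exact inf_le_left
      simp [hT, this]
  rw [phi, psi, hcount]
  push_cast
  rw [Finset.sum_div]
  refine Finset.sum_congr rfl fun T _ => ?_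
  have h1 : ((F T : ℝ) * Nat.card (FiberInjective (quotientProj (G.edgeSetoid T) (G.edgeSetoid S))
      (Fin N))) = (N ! : ℝ) ^ Nat.card (Quotient (G.edgeSetoid S)) := by exact_mod_cast hF T
  have h2 : (N ! : ℝ) ^ Nat.card (Quotient (G.edgeSetoid S)) ≠ 0 := by positivity
  rw [← h1] at h2 ⊢
  have h3 := left_ne_zero_of_mul h2
  have h4 := right_ne_zero_of_mul h2
  field_simp

end LabelledGraph
end Graphs

section Expansion

open Filter Asymptotics Finset
open scoped Classical Nat

theorem card_fiberInjective_eq_pow_mul {Q C : Type*} [Fintype Q] (p : Q → C) {N : ℕ}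
    (hN : Nat.card Q ≤ N) (hN1 : 1 ≤ N) :
    (Nat.card (FiberInjective p (Fin N)) : ℝ) = (N : ℝ) ^ Nat.card Q *
      ∏ q, (1 - ∑ q', if Fintype.equivFin Q q' < Fintype.equivFin Q q ∧ p q' = p q
        then (N : ℝ)⁻¹ else 0) := by
  have hpow : (N : ℝ) ^ Nat.card Q = ∏ _q : Q, (N : ℝ) := by
    rw [Finset.prod_const, Finset.card_univ, Nat.card_eq_fintype_card]
  rw [card_fiberInjective, hpow, ← Finset.prod_mul_distrib]
  push_cast
  refine Finset.prod_congr rfl fun q _ => ?_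
  rw [Nat.card_fin, Nat.cast_sub ((Finite.card_subtype_le _).trans hN), ← Finset.sum_filter,
    Finset.sum_const, Nat.card_eq_fintype_card, Fintype.card_subtype, nsmul_eq_mul]
  have : (N : ℝ) ≠ 0 := by positivity
  field_simp

theorem HasSubsetExpansion.guarded_indicator {ι : Type*} [DecidableEq ι] (P : Prop)
    [Decidable P] (i : ι) :
    HasSubsetExpansion (fun A N => if P ∧ i ∈ A then (N : ℝ)⁻¹ else 0) := by
  by_cases hP : P
  · simp only [hP, true_and]
    convert indicator i
  · simpa [hP] using const 0

theorem isBigO_guarded (P : Prop) [Decidable P] :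
    (fun N : ℕ => if P then (N : ℝ)⁻¹ else 0) =O[atTop] fun N : ℕ => (N : ℝ)⁻¹ := by
  by_cases hP : P
  · simpa [hP] using isBigO_refl _ _
  · simpa [hP] using isBigO_zero _ _

namespace LabelledGraph

variable {V E K : Type*} (G : LabelledGraph V E K)

/-- The pairs of related points. -/
noncomputable def _root_.Setoid.pairs [Fintype V] (S : Setoid V) : Finset (V × V) :=
  univ.filter fun p => S p.1 p.2

/-- The Euler characteristic of a quotient graph. -/
noncomputable def euler (S : Setoid V) : ℤ :=
  Nat.card (Quotient S) - Nat.card (Quotient (G.edgeSetoid S))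

/-- The least folded partition containing a given one and given pairs. -/
def join (T : Setoid V) (B : Finset (V × V)) : Setoid V :=
  sInf {S | G.Folded S ∧ T ≤ S ∧ ∀ p ∈ B, S p.1 p.2}

theorem folded_join (T : Setoid V) (B : Finset (V × V)) : G.Folded (G.join T B) :=
  G.folded_sInf fun _ hS => hS.1

theorem join_le_iff {T S : Setoid V} {B : Finset (V × V)} (hS : G.Folded S) :
    G.join T B ≤ S ↔ T ≤ S ∧ ∀ p ∈ B, S p.1 p.2 := by
  constructor
  · intro h
    exact ⟨le_trans (le_sInf fun _ hS => hS.2.1) h, fun p hp => h fun _ hS => hS.2.2 p hp⟩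
  · exact fun h => sInf_le ⟨hS, h⟩

theorem le_join (T : Setoid V) (B : Finset (V × V)) : T ≤ G.join T B :=
  ((G.join_le_iff (G.folded_join T B)).mp le_rfl).1

theorem join_rel {T : Setoid V} {B : Finset (V × V)} {p : V × V} (hp : p ∈ B) :
    G.join T B p.1 p.2 :=
  ((G.join_le_iff (G.folded_join T B)).mp le_rfl).2 p hp

theorem join_empty {T : Setoid V} (hT : G.Folded T) : G.join T ∅ = T :=
  le_antisymm ((G.join_le_iff hT).mpr ⟨le_rfl, by simp⟩) (G.le_join T ∅)

variable [Fintype V] [Fintype E]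

/-- The factor by which the number of lifts with a given pattern of coincidences deviates from a
power of `N`. -/
noncomputable def correction (T : Setoid V) (A : Finset (V × V)) (N : ℕ) : ℝ :=
  (∏ q, (1 - ∑ q', if Fintype.equivFin (Quotient T) q' < Fintype.equivFin (Quotient T) q ∧
      (q'.out, q.out) ∈ A then (N : ℝ)⁻¹ else 0)) *
  ∏ q, (1 - ∑ q', if (Fintype.equivFin (Quotient (G.edgeSetoid T)) q' <
      Fintype.equivFin (Quotient (G.edgeSetoid T)) q ∧ G.gen q'.out = G.gen q.out) ∧
      (G.src q'.out, G.src q.out) ∈ A then (N : ℝ)⁻¹ else 0)⁻¹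

theorem hasSubsetExpansion_correction (T : Setoid V) : HasSubsetExpansion (G.correction T) := by
  refine HasSubsetExpansion.mul (HasSubsetExpansion.prod _ fun q => ?_)
    (HasSubsetExpansion.prod _ fun q => ?_)
  · have h := HasSubsetExpansion.sum univ fun q' => HasSubsetExpansion.guarded_indicator
      (Fintype.equivFin (Quotient T) q' < Fintype.equivFin (Quotient T) q) (q'.out, q.out)
    simpa [sub_eq_add_neg] using (HasSubsetExpansion.const 1).add
      ((HasSubsetExpansion.const (-1)).mul h)
  · refine HasSubsetExpansion.inv_one_sub (HasSubsetExpansion.sum univ fun q' =>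
      HasSubsetExpansion.guarded_indicator _ _) fun A => ?_
    exact IsBigO.fun_sum fun q' _ => isBigO_guarded _

theorem count_eq_pow_mul_correction {S T : Setoid V} {N : ℕ}
    (hV : Nat.card V ≤ N) (hE : Nat.card E ≤ N) (hN : 1 ≤ N) :
    (Nat.card (FiberInjective (quotientProj T S) (Fin N)) : ℝ) /
      Nat.card (FiberInjective (quotientProj (G.edgeSetoid T) (G.edgeSetoid S)) (Fin N)) =
    (N : ℝ) ^ G.euler T * G.correction T S.pairs N := by
  have hN0 : (N : ℝ) ≠ 0 := by positivity
  have hQV : Nat.card (Quotient T) ≤ N :=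
    (Nat.card_le_card_of_surjective _ Quotient.mk_surjective).trans hV
  have hQE : Nat.card (Quotient (G.edgeSetoid T)) ≤ N :=
    (Nat.card_le_card_of_surjective _ Quotient.mk_surjective).trans hE
  rw [card_fiberInjective_eq_pow_mul _ hQV hN, card_fiberInjective_eq_pow_mul _ hQE hN, euler,
    zpow_sub₀ hN0, zpow_natCast, zpow_natCast, correction, Finset.prod_inv_distrib, div_eq_mul_inv,
    mul_inv, div_eq_mul_inv]
  have h1 : ∀ q q' : Quotient T, quotientProj T S q' = quotientProj T S q ↔
      (q'.out, q.out) ∈ S.pairs := by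
    intro q q'
    rw [Setoid.pairs, mem_filter, quotientProj, quotientProj, Quotient.eq]
    simp
  have h2 : ∀ q q' : Quotient (G.edgeSetoid T),
      quotientProj (G.edgeSetoid T) (G.edgeSetoid S) q' = quotientProj _ (G.edgeSetoid S) q ↔
      G.gen q'.out = G.gen q.out ∧ (G.src q'.out, G.src q.out) ∈ S.pairs := by
    intro q q'
    rw [Setoid.pairs, mem_filter, quotientProj, quotientProj, Quotient.eq, edgeSetoid_iff]
    simp
  simp_rw [h1, h2, and_assoc]
  ring

/-- The lift counts as sums over folded partitions of terms with controlled growth. -/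
theorem exists_folded_terms : ∃ R : Setoid V → ℕ → ℝ,
    (∀ S, G.Folded S → ∀ᶠ N in atTop, G.phi S N = ∑ T with G.Folded T ∧ T ≤ S, R T N) ∧
    ∀ S, G.Folded S → (∀ T B, G.Folded T → G.join T B = S → ¬ (T = S ∧ B = ∅) →
      G.euler T - #B < G.euler S) →
      Tendsto (fun N => R S N / (N : ℝ) ^ G.euler S) atTop (nhds 1) := by
  choose c hc hO using fun T => G.hasSubsetExpansion_correction T
  refine ⟨fun S N => ∑ p : Setoid V × Finset (V × V) with G.Folded p.1 ∧ G.join p.1 p.2 = S,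
    (N : ℝ) ^ G.euler p.1 * c p.1 p.2 N, fun S hS => ?_, fun S hS hlt => ?_⟩
  · have hall : ∀ᶠ N in atTop, ∀ T, G.correction T S.pairs N = ∑ B ∈ S.pairs.powerset, c T B N :=
      eventually_all.mpr fun T => hc T S.pairs
    filter_upwards [hall, eventually_ge_atTop (Nat.card V), eventually_ge_atTop (Nat.card E),
      eventually_ge_atTop 1] with N hN hV hE h1
    rw [G.phi_eq_sum hS hE, Finset.sum_congr rfl fun T _ => G.count_eq_pow_mul_correction hV hE h1]
    simp_rw [hN, Finset.mul_sum]
    rw [← Finset.sum_product']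
    rw [← Finset.sum_fiberwise_of_maps_to
      (t := univ.filter fun T => G.Folded T ∧ T ≤ S) (g := fun p => G.join p.1 p.2)]
    · refine Finset.sum_congr rfl fun S' hS' => Finset.sum_congr ?_ fun _ _ => rfl
      ext ⟨T, B⟩
      simp only [mem_filter, mem_univ, true_and, mem_product, mem_powerset] at hS' ⊢
      constructor
      · rintro ⟨⟨h1, _⟩, h2⟩
        exact ⟨h1.1, h2⟩
      · rintro ⟨h1, rfl⟩
        have h3 := (G.join_le_iff hS).mp hS'.2
        exact ⟨⟨⟨h1, h3.1⟩, fun p hp => mem_filter.mpr ⟨mem_univ _, h3.2 p hp⟩⟩, rfl⟩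
    · rintro ⟨T, B⟩ hp
      simp only [mem_filter, mem_univ, true_and, mem_product, mem_powerset] at hp ⊢
      exact ⟨G.folded_join T B, (G.join_le_iff hS).mpr
        ⟨hp.1.2, fun p h => (mem_filter.mp (hp.2 h)).2⟩⟩
  · have hmem : (S, (∅ : Finset (V × V))) ∈ univ.filter
        fun p : Setoid V × Finset (V × V) => G.Folded p.1 ∧ G.join p.1 p.2 = S :=
      mem_filter.mpr ⟨mem_univ _, hS, G.join_empty hS⟩
    have h1 : ∀ᶠ N in atTop, c S ∅ N = 1 := by
      filter_upwards [hc S ∅] with N hN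
      have : G.correction S ∅ N = 1 := by simp [correction]
      rw [← this, hN]
      simp
    have hrest : ∀ p ∈ (univ.filter
        fun p : Setoid V × Finset (V × V) => G.Folded p.1 ∧ G.join p.1 p.2 = S).erase (S, ∅),
        Tendsto (fun N : ℕ => (N : ℝ) ^ G.euler p.1 * c p.1 p.2 N / (N : ℝ) ^ G.euler S) atTop
          (nhds 0) := by
      rintro ⟨T, B⟩ hp
      simp only [mem_erase, mem_filter, mem_univ, true_and, ne_eq, Prod.mk.injEq] at hp
      have hlt' := hlt T B hp.2.1 hp.2.2 hp.1
      have hb : (fun N : ℕ => (N : ℝ) ^ G.euler T * c T B N / (N : ℝ) ^ G.euler S) =O[atTop]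
          fun N : ℕ => (N : ℝ)⁻¹ := by
        have h2 : (fun N : ℕ => (N : ℝ) ^ G.euler T * c T B N / (N : ℝ) ^ G.euler S) =O[atTop]
            fun N : ℕ => (N : ℝ) ^ G.euler T * ((N : ℝ)⁻¹) ^ #B / (N : ℝ) ^ G.euler S := by
          simp_rw [div_eq_mul_inv]
          exact ((isBigO_refl _ _).mul (hO T B)).mul (isBigO_refl _ _)
        refine h2.trans (IsBigO.of_bound 1 ?_)
        filter_upwards [eventually_ge_atTop 1] with N hN
        have hN' : (1 : ℝ) ≤ N := by exact_mod_cast hN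
        have hN0 : (N : ℝ) ≠ 0 := by positivity
        rw [one_mul, Real.norm_of_nonneg (by positivity), Real.norm_of_nonneg (by positivity),
          inv_pow, ← zpow_natCast, ← zpow_neg, ← zpow_add₀ hN0, ← zpow_sub₀ hN0, ← zpow_neg_one]
        exact zpow_le_zpow_right₀ hN' (by omega)
      exact hb.trans_tendsto tendsto_inv_atTop_nhds_zero_nat
    have hsum := tendsto_finsetSum _ hrest
    have hmain : Tendsto (fun N : ℕ => (N : ℝ) ^ G.euler S * c S ∅ N / (N : ℝ) ^ G.euler S) atTop
        (nhds 1) := by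
      refine tendsto_const_nhds.congr' ?_
      filter_upwards [h1, eventually_ge_atTop 1] with N h2 hN
      have hN0 : (N : ℝ) ≠ 0 := by positivity
      rw [h2, mul_one, div_self (zpow_ne_zero _ hN0)]
    have := hmain.add hsum
    simp only [Finset.sum_const_zero, add_zero] at this
    simp_rw [Finset.sum_div]
    convert this using 2 with N
    exact (Finset.add_sum_erase _ (fun p : Setoid V × Finset (V × V) =>
      (N : ℝ) ^ G.euler p.1 * c p.1 p.2 N / (N : ℝ) ^ G.euler S) hmem).symm

end LabelledGraph
end Expansion

section Folding

open Finset
open scoped Classical Nat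

namespace Setoid

variable {X : Type*}

/-- The relation obtained by identifying the classes of two points. -/
noncomputable def merge (S : Setoid X) (a b : X) : Setoid X :=
  Setoid.ker fun x => if S x b then Quotient.mk S a else Quotient.mk S x

theorem merge_iff {S : Setoid X} {a b x y : X} :
    S.merge a b x y ↔ S x y ∨ (S x a ∧ S y b) ∨ (S x b ∧ S y a) := by
  have key : ∀ x y : X, Quotient.mk S x = Quotient.mk S y ↔ S x y := fun x y => Quotient.eq
  rw [merge, Setoid.ker_def]
  have hs : ∀ {x y}, S x y → S y x := fun h => S.symm h
  have ht : ∀ {x y z}, S x y → S y z → S x z := fun h h' => S.trans h h'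
  split_ifs with h1 h2 h2 <;> simp only [key]
  · exact ⟨fun _ => Or.inl (ht h1 (hs h2)), fun _ => trivial⟩
  · constructor
    · exact fun h => Or.inr (Or.inr ⟨h1, hs h⟩)
    · rintro (h | ⟨h, h'⟩ | ⟨h, h'⟩)
      · exact absurd (ht (hs h) h1) h2
      · exact absurd h' h2
      · exact hs h'
  · constructor
    · exact fun h => Or.inr (Or.inl ⟨h, h2⟩)
    · rintro (h | ⟨h, h'⟩ | ⟨h, h'⟩)
      · exact absurd (ht h h2) h1
      · exact h
      · exact absurd h h1
  · constructor
    · exact fun h => Or.inl h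
    · rintro (h | ⟨h, h'⟩ | ⟨h, h'⟩)
      · exact h
      · exact absurd h' h2
      · exact absurd h h1

theorem le_merge (S : Setoid X) (a b : X) : S ≤ S.merge a b := fun _ _ h => merge_iff.mpr (Or.inl h)

theorem merge_rel (S : Setoid X) (a b : X) : S.merge a b a b :=
  merge_iff.mpr (Or.inr (Or.inl ⟨S.refl a, S.refl b⟩))

theorem merge_le {S T : Setoid X} {a b : X} (h : S ≤ T) (hab : T a b) : S.merge a b ≤ T := by
  intro x y hxy
  rcases merge_iff.mp hxy with h' | ⟨h1, h2⟩ | ⟨h1, h2⟩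
  · exact h h'
  · exact T.trans (h h1) (T.trans hab (T.symm (h h2)))
  · exact T.trans (h h1) (T.trans (T.symm hab) (T.symm (h h2)))

theorem merge_comm (S : Setoid X) (a b : X) : S.merge a b = S.merge b a := by
  ext x y
  rw [merge_iff, merge_iff]
  tauto

theorem merge_eq_self {S : Setoid X} {a b : X} (h : S a b) : S.merge a b = S :=
  le_antisymm (merge_le le_rfl h) (S.le_merge a b)

theorem card_quotient_merge [Finite X] {S : Setoid X} {a b : X} (h : ¬ S a b) :
    Nat.card (Quotient (S.merge a b)) + 1 = Nat.card (Quotient S) := by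
  have h1 : Nat.card (Quotient (S.merge a b)) =
      Nat.card {q : Quotient S // q ∉ ({⟦b⟧} : Set _)} := by
    refine Nat.card_congr ((Setoid.quotientKerEquivRange _).trans (Equiv.setCongr ?_))
    ext q
    induction q using Quotient.inductionOn with | h q => ?_
    simp only [Set.mem_range]
    have key : ∀ x y : X, Quotient.mk S x = Quotient.mk S y ↔ S x y := fun x y => Quotient.eq
    constructor
    · rintro ⟨x, hx⟩ hq
      rw [hq] at hx
      split_ifs at hx with h2
      · exact h ((key _ _).mp hx)
      · exact h2 ((key _ _).mp hx)
    · intro hq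
      refine ⟨q, if_neg fun h2 => hq ((key _ _).mpr h2)⟩
  rw [h1, ← Set.ncard_singleton (Quotient.mk S b), add_comm]
  exact Set.ncard_add_ncard_compl _

end Setoid

namespace LabelledGraph

variable {V E K : Type*} (G : LabelledGraph V E K)

/-- Changing the points at some vertices by the difference of two permutations makes the edges of
the two corresponding classes act by the same permutation. -/
theorem psi_eq_of_gauge {C : Type*} (c : E → C) (f : C → C) (κ : V → Option C)
    (σ τ : C → Option C) (hsrc : ∀ e, κ (G.src e) = σ (c e)) (htgt : ∀ e, κ (G.tgt e) = τ (c e))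
    (hff : ∀ z, f (f z) = f z) (hκ : ∀ p z, κ p = some z → f z ≠ z)
    (hσ : ∀ x z, σ x = some z → f z ≠ z) (hτ : ∀ x z, τ x = some z → f z ≠ z)
    (hel : ∀ e, f (c e) ≠ c e → σ (c e) = none ∧ τ (c e) = some (c e) ∧
      σ (f (c e)) = none ∧ τ (f (c e)) = none) (N : ℕ) :
    G.psi c N = G.psi (f ∘ c) N := by
  let H : (C → Equiv.Perm (Fin N)) → Option C → Equiv.Perm (Fin N) := fun b o =>
    o.elim 1 fun z => b (f z) * (b z)⁻¹
  let H' : (C → Equiv.Perm (Fin N)) → Option C → Equiv.Perm (Fin N) := fun b o => o.elim 1 b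
  let F : (C → Equiv.Perm (Fin N)) → C → Equiv.Perm (Fin N) := fun b z =>
    if f z = z then H b (τ z) * b z * (H b (σ z))⁻¹ else b (f z) * (b z)⁻¹
  let F₁ : (C → Equiv.Perm (Fin N)) → C → Equiv.Perm (Fin N) := fun b z =>
    (H' b (τ z))⁻¹ * b z * H' b (σ z)
  let F' : (C → Equiv.Perm (Fin N)) → C → Equiv.Perm (Fin N) := fun b z =>
    if f z = z then F₁ b z else (b z)⁻¹ * F₁ b (f z)
  have hH : ∀ b o, (∀ z, o = some z → f z ≠ z) → H' (F b) o = H b o := by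
    rintro b (_ | z) ho
    · rfl
    · simp [H, H', F, ho z rfl]
  have hH' : ∀ b o, (∀ z, o = some z → f z ≠ z) → H (F' b) o = H' b o := by
    rintro b (_ | z) ho
    · rfl
    · simp [H, H', F', ho z rfl, hff]
  let e : (C → Equiv.Perm (Fin N)) × (V → Fin N) ≃ (C → Equiv.Perm (Fin N)) × (V → Fin N) :=
    { toFun := fun x => ⟨F x.1, fun p => H x.1 (κ p) (x.2 p)⟩
      invFun := fun x => ⟨F' x.1, fun p => (H' x.1 (κ p))⁻¹ (x.2 p)⟩
      left_inv := by
        rintro ⟨b, i⟩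
        have h1 : ∀ z, f z = z → F₁ (F b) z = b z := by
          intro z hz
          simp only [F₁]
          rw [hH _ _ (hσ z), hH _ _ (hτ z)]
          simp only [F, if_pos hz]
          group
        refine Prod.ext (funext fun z => ?_) (funext fun p => ?_)
        · by_cases hz : f z = z
          · simp only [F', if_pos hz]
            exact h1 z hz
          · simp only [F', if_neg hz]
            rw [h1 _ (hff z)]
            simp only [F, if_neg hz]
            group
        · simp only
          rw [hH _ _ (hκ p)]
          simp
      right_inv := by
        rintro ⟨b, i⟩
        refine Prod.ext (funext fun z => ?_) (funext fun p => ?_)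
        · by_cases hz : f z = z
          · simp only [F, if_pos hz]
            rw [hH' _ _ (hσ z), hH' _ _ (hτ z)]
            simp only [F', if_pos hz, F₁]
            group
          · simp only [F, if_neg hz]
            simp only [F', if_neg hz, if_pos (hff z)]
            group
        · simp only
          rw [hH' _ _ (hκ p)]
          simp }
  have he : G.Solutions c (Fin N) ≃ G.Solutions (f ∘ c) (Fin N) := by
    refine e.subtypeEquiv fun x => forall_congr' fun d => ?_
    obtain ⟨b, i⟩ := x
    simp only [e, Equiv.coe_fn_mk, Function.comp_apply, hsrc, htgt]
    by_cases hz : f (c d) = c d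
    · simp [hz, F]
    · obtain ⟨h1, h2, h3, h4⟩ := hel d hz
      rw [h1, h2]
      simp only [F, hff, if_true, h3, h4, H, Option.elim]
      simp [Equiv.eq_symm_apply]
  rw [psi, psi, Nat.card_congr he]

/-- The graph with all edges reversed. -/
def rev : LabelledGraph V E K := ⟨G.tgt, G.src, G.gen⟩

theorem psi_rev {C : Type*} (c : E → C) (N : ℕ) : G.rev.psi c N = G.psi c N := by
  have e : G.rev.Solutions c (Fin N) ≃ G.Solutions c (Fin N) :=
    (Equiv.prodCongr (Equiv.inv _) (Equiv.refl _)).subtypeEquiv fun x => forall_congr' fun e => by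
      simp only [rev, Equiv.prodCongr_apply, Prod.map, Equiv.inv_apply, Pi.inv_apply,
        Equiv.refl_apply, Equiv.Perm.inv_eq_iff_eq]
      exact eq_comm
  rw [psi, psi, Nat.card_congr e]

theorem folded_rev_iff {S : Setoid V} : G.rev.Folded S ↔ G.Folded S :=
  forall₃_congr fun _ _ _ => Iff.comm

theorem edgeSetoid_rev {S : Setoid V} (hS : G.Folded S) : G.rev.edgeSetoid S = G.edgeSetoid S :=
  Setoid.ext fun e e' => and_congr_right fun h => (hS e e' h).symm

/-- An identification of edges compatible with an identification of vertices. -/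
def Compatible (S : Setoid V) (ε : Setoid E) : Prop :=
  ∀ e e', ε e e' → G.gen e = G.gen e' ∧ S (G.src e) (G.src e') ∧ S (G.tgt e) (G.tgt e')

theorem Compatible.rev {S : Setoid V} {ε : Setoid E} (h : G.Compatible S ε) :
    G.rev.Compatible S ε := fun e e' he => ⟨(h e e' he).1, (h e e' he).2.2, (h e e' he).2.1⟩

theorem compatible_edgeSetoid {S : Setoid V} (hS : G.Folded S) :
    G.Compatible S (G.edgeSetoid S) := fun e e' he => ⟨he.1, he.2, (hS e e' he.1).mp he.2⟩

theorem psi_merge_aux [Finite E] {S T : Setoid V} {ε : Setoid E} (hε : G.Compatible S ε)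
    (hT : G.Folded T) {a b : E} (hsrc : S (G.src a) (G.src b))
    (htgt : ¬ S (G.tgt a) (G.tgt b)) (hloop : ¬ S (G.src a) (G.tgt a)) (N : ℕ) :
    G.psi (Quotient.mk (G.edgeSetoid T ⊓ ε)) N =
      G.psi (Quotient.mk (G.edgeSetoid T ⊓ ε.merge a b)) N := by
  set θ := G.edgeSetoid T with hθ
  have hTc := G.compatible_edgeSetoid hT
  have hab : ¬ ε a b := fun h => htgt (hε _ _ h).2.2
  let ρ : E → E := fun e => (Quotient.mk (θ ⊓ ε) e).out
  have hρ : ∀ e, (θ ⊓ ε) (ρ e) e := fun e => Quotient.mk_out (s := θ ⊓ ε) e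
  have hρeq : ∀ e e', (θ ⊓ ε) e e' ↔ ρ e = ρ e' := by
    intro e e'
    constructor
    · intro h
      exact congrArg Quotient.out (Quotient.sound h)
    · intro h
      have h1 := (θ ⊓ ε).symm (hρ e)
      rw [h] at h1
      exact (θ ⊓ ε).trans h1 (hρ e')
  let P : E → Prop := fun x => ε x a ∧ ∃ y, ε y b ∧ θ y x
  have hPresp : ∀ x x', (θ ⊓ ε) x x' → P x → P x' := by
    rintro x x' ⟨h1, h2⟩ ⟨h3, y, h4, h5⟩
    exact ⟨ε.trans (ε.symm h2) h3, y, h4, θ.trans h5 h1⟩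
  let f : E → E := fun x => if h : P x then ρ h.2.choose else x
  have hfP : ∀ x y, P x → ε y b → θ y x → f x = ρ y := by
    intro x y hx hy hyx
    simp only [f, dif_pos hx]
    have := hx.2.choose_spec
    exact (hρeq _ _).mp ⟨θ.trans this.2 (θ.symm hyx), ε.trans this.1 (ε.symm hy)⟩
  have hfN : ∀ x, ¬ P x → f x = x := fun x hx => dif_neg hx
  have hfb : ∀ x, P x → ε (f x) b := by
    intro x hx
    obtain ⟨y, hy, hyx⟩ := hx.2
    rw [hfP x y hx hy hyx]
    exact ε.trans (hρ y).2 hy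
  have hnb : ∀ x, ε x b → ¬ P x := fun x hx h => hab (ε.trans (ε.symm h.1) hx)
  have hfne : ∀ x, f x ≠ x ↔ P x := by
    intro x
    constructor
    · intro h
      by_contra hx
      exact h (hfN x hx)
    · intro hx h
      have := hfb x hx
      rw [h] at this
      exact hnb x this hx
  let κ : V → Option E := fun p =>
    if h : ∃ e, P e ∧ S p (G.tgt e) ∧ T p (G.tgt e) then some (ρ h.choose) else none
  have hκ : ∀ p e, P e → S p (G.tgt e) → T p (G.tgt e) → κ p = some (ρ e) := by
    intro p e he hS hT'
    have h : ∃ e, P e ∧ S p (G.tgt e) ∧ T p (G.tgt e) := ⟨e, he, hS, hT'⟩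
    simp only [κ, dif_pos h]
    have h1 := h.choose_spec
    set e' := h.choose
    have h2 : ε e' e := ε.trans h1.1.1 (ε.symm he.1)
    have h3 := (hε _ _ h2).1
    congr 1
    exact (hρeq _ _).mp
      ⟨⟨h3, (hT _ _ h3).mpr (T.trans (T.symm h1.2.2) hT')⟩, h2⟩
  have hκ' : ∀ p z, κ p = some z → ∃ e, P e ∧ S p (G.tgt e) ∧ T p (G.tgt e) ∧ z = ρ e := by
    intro p z hz
    by_cases h : ∃ e, P e ∧ S p (G.tgt e) ∧ T p (G.tgt e)
    · simp only [κ, dif_pos h, Option.some.injEq] at hz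
      exact ⟨h.choose, h.choose_spec.1, h.choose_spec.2.1, h.choose_spec.2.2, hz.symm⟩
    · simp [κ, dif_neg h] at hz
  have hκnone : ∀ p, ¬ S p (G.tgt a) → κ p = none := by
    intro p hp
    by_contra h
    obtain ⟨z, hz⟩ := Option.ne_none_iff_exists'.mp h
    obtain ⟨e, he, h1, _⟩ := hκ' p z hz
    exact hp (S.trans h1 (hε _ _ he.1).2.2)
  have hκresp : ∀ p p', S p p' → T p p' → κ p = κ p' := by
    have : ∀ p p' z, S p p' → T p p' → κ p = some z → κ p' = some z := by
      intro p p' z h1 h2 hz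
      obtain ⟨e, he, h3, h4, rfl⟩ := hκ' p z hz
      exact hκ p' e he (S.trans (S.symm h1) h3) (T.trans (T.symm h2) h4)
    intro p p' h1 h2
    ext z
    exact ⟨this p p' z h1 h2, this p' p z (S.symm h1) (T.symm h2)⟩
  have hκne : ∀ p z, κ p = some z → f z ≠ z := by
    intro p z hz
    obtain ⟨e, he, _, _, rfl⟩ := hκ' p z hz
    exact (hfne _).mpr (hPresp _ _ ((θ ⊓ ε).symm (hρ e)) he)
  have hgauge := G.psi_eq_of_gauge ρ f κ (fun z => κ (G.src z)) (fun z => κ (G.tgt z))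
    (fun e => hκresp _ _ (S.symm (hε _ _ (hρ e).2).2.1) (T.symm (hTc _ _ (hρ e).1).2.1))
    (fun e => hκresp _ _ (S.symm (hε _ _ (hρ e).2).2.2) (T.symm (hTc _ _ (hρ e).1).2.2))
    (fun z => by
      by_cases hz : P z
      · exact hfN _ (hnb _ (hfb z hz))
      · rw [hfN z hz, hfN z hz])
    hκne (fun x z => hκne _ z) (fun x z => hκne _ z)
    (fun e he => by
      have hP := (hfne _).mp he
      have hb := hfb _ hP
      refine ⟨hκnone _ fun h => ?_, ?_, hκnone _ fun h => ?_, hκnone _ fun h => ?_⟩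
      · exact hloop (S.trans (S.symm (hε _ _ hP.1).2.1) h)
      · rw [hκ _ _ hP (S.refl _) (T.refl _)]
        exact congrArg some ((hρeq _ _).mp (hρ e))
      · exact hloop (S.trans hsrc (S.trans (S.symm (hε _ _ hb).2.1) h))
      · exact htgt (S.trans (S.symm h) (hε _ _ hb).2.2)) N
  rw [← G.psi_eq_psi_mk (c := ρ) hρeq, hgauge]
  refine G.psi_eq_psi_mk (C := E) (c := f ∘ ρ) (S := θ ⊓ ε.merge a b) (fun e e' => ?_) N
  have hfθ : ∀ x, θ (f x) x := by
    intro x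
    by_cases hx : P x
    · obtain ⟨y, hy, hyx⟩ := hx.2
      rw [hfP x y hx hy hyx]
      exact θ.trans (hρ y).1 hyx
    · rw [hfN x hx]
  have hfε : ∀ x, ε.merge a b (f x) x := by
    intro x
    by_cases hx : P x
    · exact Setoid.merge_iff.mpr (Or.inr (Or.inr ⟨hfb x hx, hx.1⟩))
    · rw [hfN x hx]
  have hcross : ∀ e e', θ e e' → ε e a → ε e' b → f (ρ e) = f (ρ e') := by
    intro e e' h1 h2 h3
    have hP : P e := ⟨h2, e', h3, θ.symm h1⟩
    rw [hfP (ρ e) e' (hPresp _ _ ((θ ⊓ ε).symm (hρ e)) hP) h3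
      (θ.symm (θ.trans (hρ e).1 h1)), hfN _ (hnb _ (ε.trans (hρ e').2 h3))]
  constructor
  · rintro ⟨h1, h2⟩
    rcases Setoid.merge_iff.mp h2 with h | ⟨h, h'⟩ | ⟨h, h'⟩
    · exact congrArg f ((hρeq _ _).mp ⟨h1, h⟩)
    · exact hcross e e' h1 h h'
    · exact (hcross e' e (θ.symm h1) h' h).symm
  · intro h
    simp only [Function.comp_apply] at h
    have h1 : ∀ e, (θ ⊓ ε.merge a b) (f (ρ e)) e := fun e =>
      ⟨θ.trans (hfθ _) (hρ e).1, (ε.merge a b).trans (hfε _) (ε.le_merge a b (hρ e).2)⟩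
    have h2 := (θ ⊓ ε.merge a b).symm (h1 e)
    rw [h] at h2
    exact (θ ⊓ ε.merge a b).trans h2 (h1 e')

end LabelledGraph
end Folding

section Vanishing

open Finset Filter
open scoped Classical Nat

namespace LabelledGraph

variable {V E K : Type*} (G : LabelledGraph V E K)

theorem join_rev (S : Setoid V) (B : Finset (V × V)) : G.rev.join S B = G.join S B := by
  simp only [join, folded_rev_iff]

theorem euler_rev {S : Setoid V} (hS : G.Folded S) : G.rev.euler S = G.euler S := by
  rw [euler, euler, G.edgeSetoid_rev hS]

theorem Compatible.merge {S : Setoid V} {ε : Setoid E} (h : G.Compatible S ε) {a b : E}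
    (hgen : G.gen a = G.gen b) (hsrc : S (G.src a) (G.src b)) :
    G.Compatible (S.merge (G.tgt a) (G.tgt b)) (ε.merge a b) := by
  have hle := S.le_merge (G.tgt a) (G.tgt b)
  have : ε.merge a b ≤ Setoid.ker G.gen ⊓ S.comap G.src ⊓
      (S.merge (G.tgt a) (G.tgt b)).comap G.tgt :=
    Setoid.merge_le (fun e e' he => ⟨⟨(h e e' he).1, (h e e' he).2.1⟩, hle (h e e' he).2.2⟩)
      ⟨⟨hgen, hsrc⟩, S.merge_rel _ _⟩
  intro e e' he
  exact ⟨(this he).1.1, hle (this he).1.2, (this he).2⟩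

/-- Folding a compatible pair does not lower the Euler characteristic, and does not change the
lift counts if it keeps the Euler characteristic. -/
def FoldsWell (S : Setoid V) (ε : Setoid E) : Prop :=
  (Nat.card (Quotient S) : ℤ) - Nat.card (Quotient ε) ≤ G.euler (G.join S ∅) ∧
  ((Nat.card (Quotient S) : ℤ) - Nat.card (Quotient ε) = G.euler (G.join S ∅) →
    ∀ T, G.Folded T → T ≤ G.join S ∅ → ∀ N,
      G.phi T N = G.psi (Quotient.mk (G.edgeSetoid T ⊓ ε)) N)

theorem FoldsWell.of_rev {S : Setoid V} {ε : Setoid E} (h : G.rev.FoldsWell S ε) :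
    G.FoldsWell S ε := by
  obtain ⟨h1, h2⟩ := h
  rw [G.join_rev, G.euler_rev (G.folded_join _ _)] at h1 h2
  refine ⟨h1, fun heq T hT hle N => ?_⟩
  have := h2 heq T (G.folded_rev_iff.mpr hT) hle N
  rwa [phi, psi_rev, psi_rev, G.edgeSetoid_rev hT] at this

theorem FoldsWell.rev {S : Setoid V} {ε : Setoid E} (h : G.FoldsWell S ε) :
    G.rev.FoldsWell S ε := FoldsWell.of_rev G.rev h

theorem psi_merge [Finite E] {S T : Setoid V} {ε : Setoid E} (hε : G.Compatible S ε)
    (hT : G.Folded T) {a b : E} (hsrc : S (G.src a) (G.src b))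
    (htgt : ¬ S (G.tgt a) (G.tgt b)) (N : ℕ) :
    G.psi (Quotient.mk (G.edgeSetoid T ⊓ ε)) N =
      G.psi (Quotient.mk (G.edgeSetoid T ⊓ ε.merge a b)) N := by
  by_cases hloop : S (G.src a) (G.tgt a)
  · rw [Setoid.merge_comm]
    refine G.psi_merge_aux hε hT (S.symm hsrc) (fun h => htgt (S.symm h)) (fun h => htgt ?_) N
    exact S.trans (S.symm hloop) (S.trans hsrc h)
  · exact G.psi_merge_aux hε hT hsrc htgt hloop N

theorem FoldsWell.of_merge [Finite V] [Finite E] {S : Setoid V} {ε : Setoid E}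
    (hε : G.Compatible S ε) {a b : E} (hgen : G.gen a = G.gen b) (hab : ¬ ε a b)
    (hsrc : S (G.src a) (G.src b))
    (h : G.FoldsWell (S.merge (G.tgt a) (G.tgt b)) (ε.merge a b)) : G.FoldsWell S ε := by
  have hjoin : G.join (S.merge (G.tgt a) (G.tgt b)) ∅ = G.join S ∅ := by
    refine le_antisymm ((G.join_le_iff (G.folded_join _ _)).mpr ⟨?_, by simp⟩)
      ((G.join_le_iff (G.folded_join _ _)).mpr ⟨(S.le_merge _ _).trans (G.le_join _ _), by simp⟩)
    exact Setoid.merge_le (G.le_join _ _)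
      ((G.folded_join S ∅ a b hgen).mp (G.le_join S ∅ hsrc))
  obtain ⟨h1, h2⟩ := h
  rw [hjoin] at h1 h2
  have hE := Setoid.card_quotient_merge hab
  by_cases htgt : S (G.tgt a) (G.tgt b)
  · rw [Setoid.merge_eq_self htgt] at h1
    exact ⟨by omega, fun h => by omega⟩
  · have hV := Setoid.card_quotient_merge htgt
    refine ⟨by omega, fun heq T hT hle N => ?_⟩
    rw [h2 (by omega) T hT hle N, ← G.psi_merge hε hT hsrc htgt]

theorem foldsWell_of_terminal {S : Setoid V} {ε : Setoid E}
    (hε : G.Compatible S ε) (h : ∀ a b, G.gen a = G.gen b →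
      (S (G.src a) (G.src b) ∨ S (G.tgt a) (G.tgt b)) → ε a b) : G.FoldsWell S ε := by
  have hS : G.Folded S := fun a b hgen =>
    ⟨fun h' => (hε _ _ (h a b hgen (Or.inl h'))).2.2,
      fun h' => (hε _ _ (h a b hgen (Or.inr h'))).2.1⟩
  have hεS : ε = G.edgeSetoid S := Setoid.ext fun a b =>
    ⟨fun h' => ⟨(hε _ _ h').1, (hε _ _ h').2.1⟩, fun h' => h a b h'.1 (Or.inl h'.2)⟩
  subst hεS
  rw [FoldsWell, G.join_empty hS]
  refine ⟨le_rfl, fun _ T hT hle N => ?_⟩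
  rw [phi, inf_eq_left.mpr (G.edgeSetoid_mono hle)]

theorem foldsWell_of_compatible [Finite V] [Finite E] {S : Setoid V} {ε : Setoid E}
    (hε : G.Compatible S ε) : G.FoldsWell S ε := by
  induction hn : Nat.card (Quotient ε) using Nat.strong_induction_on generalizing S ε with
  | _ n ih =>
  by_cases h : ∀ a b, G.gen a = G.gen b →
      (S (G.src a) (G.src b) ∨ S (G.tgt a) (G.tgt b)) → ε a b
  · exact G.foldsWell_of_terminal hε h
  · push Not at h
    obtain ⟨a, b, hgen, h, hab⟩ := h
    have hE := Setoid.card_quotient_merge hab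
    rcases h with h | h
    · exact FoldsWell.of_merge G hε hgen hab h (ih _ (by omega) (hε.merge G hgen h) rfl)
    · refine FoldsWell.of_rev G
        (FoldsWell.of_merge G.rev (hε.rev G) hgen hab h (FoldsWell.rev G ?_))
      exact ih _ (by omega) (fun e e' he => by
        have := (hε.rev G).merge G.rev hgen h e e' he
        exact ⟨this.1, this.2.2, this.2.1⟩) rfl

theorem join_merge {T : Setoid V} (u v : V) : G.join (T.merge u v) ∅ = G.join T {(u, v)} := by
  refine le_antisymm ((G.join_le_iff (G.folded_join _ _)).mpr ⟨?_, by simp⟩)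
    ((G.join_le_iff (G.folded_join _ _)).mpr ⟨(T.le_merge u v).trans (G.le_join _ _), ?_⟩)
  · exact Setoid.merge_le (G.le_join _ _) (G.join_rel (p := (u, v)) (by simp))
  · simpa using G.le_join (T.merge u v) ∅ (T.merge_rel u v)

theorem foldsWell_merge [Finite V] [Finite E] {T : Setoid V} (hT : G.Folded T) (u v : V) :
    G.FoldsWell (T.merge u v) (G.edgeSetoid T) :=
  G.foldsWell_of_compatible fun e e' he =>
    ⟨he.1, T.le_merge u v he.2, T.le_merge u v ((hT e e' he.1).mp he.2)⟩

theorem euler_join_singleton_ge [Finite V] [Finite E] {T : Setoid V} (hT : G.Folded T) (u v : V) :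
    G.euler T - 1 ≤ G.euler (G.join T {(u, v)}) := by
  by_cases h : T u v
  · rw [← G.join_merge, Setoid.merge_eq_self h, G.join_empty hT]
    omega
  · have h1 := (G.foldsWell_merge hT u v).1
    have h2 := Setoid.card_quotient_merge h
    have h3 : G.euler T = Nat.card (Quotient T) - Nat.card (Quotient (G.edgeSetoid T)) := rfl
    rw [G.join_merge] at h1
    omega

theorem phi_eq_of_euler_join [Finite V] [Finite E] {Δ T : Setoid V} (hΔ : G.Folded Δ) {u v : V}
    (huv : ¬ Δ u v) (h : G.euler (G.join Δ {(u, v)}) = G.euler Δ - 1) (hT : G.Folded T)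
    (hle : T ≤ G.join Δ {(u, v)}) (N : ℕ) : G.phi T N = G.phi (T ⊓ Δ) N := by
  have h1 := (G.foldsWell_merge hΔ u v).2
  have h2 := Setoid.card_quotient_merge huv
  rw [G.join_merge, h] at h1
  change _ = G.psi (Quotient.mk (G.edgeSetoid (T ⊓ Δ))) N
  rw [edgeSetoid_inf]
  refine h1 ?_ T hT hle N
  rw [euler]
  omega

/-- A folded partition is elementary over a smaller one if it arises by adding one relation that
lowers the Euler characteristic. -/
def Elementary (S : Setoid V) : Prop :=
  ∃ Δ u v, G.Folded Δ ∧ ¬ Δ u v ∧ G.join Δ {(u, v)} = S ∧ G.euler S = G.euler Δ - 1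

theorem join_insert (T : Setoid V) (p : V × V) (B : Finset (V × V)) :
    G.join T (insert p B) = G.join (G.join T B) {p} := by
  have h1 := G.folded_join T (insert p B)
  have h2 := G.folded_join (G.join T B) {p}
  refine le_antisymm ((G.join_le_iff h2).mpr ⟨(G.le_join _ _).trans (G.le_join _ _), ?_⟩)
    ((G.join_le_iff h1).mpr ⟨(G.join_le_iff h1).mpr ⟨G.le_join _ _, ?_⟩, ?_⟩)
  · intro q hq
    rcases Finset.mem_insert.mp hq with rfl | hq
    · exact G.join_rel (by simp)
    · exact G.le_join _ _ (G.join_rel hq)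
  · exact fun q hq => G.join_rel (by simp [hq])
  · exact fun q hq => G.join_rel (by simp_all)

theorem euler_join_ge [Finite V] [Finite E] {T : Setoid V} (hT : G.Folded T)
    (B : Finset (V × V)) : G.euler T - #B ≤ G.euler (G.join T B) ∧
      (G.euler T - #B = G.euler (G.join T B) →
        G.Elementary (G.join T B) ∨ (G.join T B = T ∧ B = ∅)) := by
  induction B using Finset.induction_on with
  | empty => simp [G.join_empty hT]
  | insert p B hp ih =>
    rw [G.join_insert, Finset.card_insert_of_notMem hp]
    have h1 := G.euler_join_singleton_ge (G.folded_join T B) p.1 p.2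
    push_cast
    refine ⟨by simp only [Prod.mk.eta] at h1; omega, fun h => Or.inl ?_⟩
    refine ⟨G.join T B, p.1, p.2, G.folded_join T B, fun h' => ?_, rfl, ?_⟩
    · have h2 : G.join (G.join T B) {p} = G.join T B := by
        refine le_antisymm ((G.join_le_iff (G.folded_join _ _)).mpr ⟨le_rfl, ?_⟩) (G.le_join _ _)
        simpa using h'
      rw [h2] at h
      omega
    · simp only [Prod.mk.eta] at h1
      omega

variable [Fintype V] [Fintype E]

/-- The lift counts are sums of terms over those folded partitions which are not elementary, and
these terms are asymptotic to powers of `N`. -/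
theorem exists_folded_terms_of_not_elementary : ∃ R : Setoid V → ℕ → ℝ,
    (∀ᶠ N in atTop, ∀ S, G.Folded S → G.phi S N = ∑ T with G.Folded T ∧ T ≤ S, R T N) ∧
    (∀ᶠ N in atTop, ∀ S, G.Folded S → G.Elementary S → R S N = 0) ∧
    ∀ S, G.Folded S → ¬ G.Elementary S →
      Tendsto (fun N => R S N / (N : ℝ) ^ G.euler S) atTop (nhds 1) := by
  obtain ⟨R, hR, hlim⟩ := G.exists_folded_terms
  have hR' : ∀ᶠ N in atTop, ∀ S, G.Folded S →
      G.phi S N = ∑ T with G.Folded T ∧ T ≤ S, R T N :=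
    eventually_all.mpr fun S => by
      by_cases hS : G.Folded S
      · filter_upwards [hR S hS] with N hN _ using hN
      · simp [hS]
  refine ⟨R, hR', ?_, fun S hS hbad => hlim S hS fun T B hT hTB hne => ?_⟩
  · filter_upwards [hR'] with N hN S hS ⟨Δ, u, v, hΔ, huv, hjoin, heuler⟩
    have key : ∀ T, G.Folded T → T ≤ S → ¬ T ≤ Δ → R T N = 0 := by
      intro T
      induction T using WellFoundedLT.induction with
      | _ T ih =>
      intro hT hTS hTΔ
      have h1 : G.phi T N = G.phi (T ⊓ Δ) N :=
        G.phi_eq_of_euler_join hΔ huv (by rw [hjoin, heuler]) hT (by rw [hjoin]; exact hTS) N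
      rw [hN T hT, hN _ (hT.inf G hΔ), ← Finset.sum_filter_add_sum_filter_not _ (· ≤ Δ)] at h1
      have h2 : (univ.filter fun U => G.Folded U ∧ U ≤ T).filter (· ≤ Δ) =
          univ.filter fun U => G.Folded U ∧ U ≤ T ⊓ Δ := by
        ext U
        simp [and_assoc]
      rw [h2, add_eq_left, Finset.sum_eq_single T] at h1
      · exact h1
      · intro U hU hne
        simp only [mem_filter, mem_univ, true_and] at hU
        exact ih U (lt_of_le_of_ne hU.1.2 hne) hU.1.1 (hU.1.2.trans hTS) hU.2
      · intro h
        exact absurd (by simp [hT, hTΔ]) h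
    refine key S hS le_rfl fun h => huv (h ?_)
    rw [← hjoin]
    exact G.join_rel (p := (u, v)) (by simp)
  · subst hTB
    obtain ⟨h1, h2⟩ := G.euler_join_ge hT B
    refine lt_of_le_of_ne h1 fun h => ?_
    rcases h2 h with h | h
    · exact hbad h
    · exact hne ⟨h.1.symm, h.2⟩

/-- If a folded partition has lift counts differing from those of the whole graph by an eventually
constant amount and all folded partitions not below it have negative Euler characteristic, then
these are all elementary. -/
theorem elementary_of_eventually_const {W : Setoid V} (hW : G.Folded W) {c : ℝ}
    (hc : ∀ᶠ N in atTop, G.phi ⊤ N - G.phi W N = c)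
    (hneg : ∀ S, G.Folded S → ¬ S ≤ W → G.euler S < 0) {S : Setoid V} (hS : G.Folded S)
    (hSW : ¬ S ≤ W) : G.Elementary S := by
  by_contra hbad
  obtain ⟨R, hR, hR0, hlim⟩ := G.exists_folded_terms_of_not_elementary
  have hD : ∀ᶠ N in atTop, c = ∑ T with G.Folded T ∧ ¬ T ≤ W, R T N := by
    filter_upwards [hR, hc] with N hN hcN
    rw [← hcN, hN ⊤ G.folded_top, hN W hW, sub_eq_iff_eq_add,
      ← Finset.sum_filter_add_sum_filter_not _ (· ≤ W), add_comm]
    congr 2 <;> ext U <;> simp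
  have hpos : ∀ T, G.Folded T → ∀ᶠ N in atTop, 0 ≤ R T N ∧ (¬ G.Elementary T → 0 < R T N) := by
    intro T hT
    by_cases h : G.Elementary T
    · filter_upwards [hR0] with N hN
      exact ⟨(hN T hT h).ge, fun h' => absurd h h'⟩
    · filter_upwards [(hlim T hT h).eventually (lt_mem_nhds zero_lt_one), eventually_ge_atTop 1]
        with N hN h1
      have : 0 < R T N := by
        have h2 : (0 : ℝ) < (N : ℝ) ^ G.euler T := zpow_pos (by positivity) _
        exact (div_pos_iff_of_pos_right h2).mp hN
      exact ⟨this.le, fun _ => this⟩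
  have hzero : ∀ T, G.Folded T → ¬ T ≤ W → Tendsto (R T) atTop (nhds 0) := by
    intro T hT hTW
    by_cases h : G.Elementary T
    · refine tendsto_const_nhds.congr' ?_
      filter_upwards [hR0] with N hN using (hN T hT h).symm
    · have h1 : Tendsto (fun N : ℕ => (N : ℝ) ^ G.euler T) atTop (nhds 0) := by
        have h2 := (tendsto_pow_atTop (n := (-G.euler T).toNat) (α := ℝ)
          (by have := hneg T hT hTW; omega)).comp tendsto_natCast_atTop_atTop
        refine (tendsto_inv_atTop_zero.comp h2).congr fun N => ?_
        simp only [Function.comp_apply]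
        rw [← zpow_natCast, ← zpow_neg]
        congr 1
        have := hneg T hT hTW
        omega
      have h2 := (hlim T hT h).mul h1
      rw [one_mul] at h2
      refine h2.congr' ?_
      filter_upwards [eventually_ge_atTop 1] with N hN
      have : (N : ℝ) ^ G.euler T ≠ 0 := (zpow_pos (by positivity) _).ne'
      field_simp
  have hc0 : c = 0 := by
    refine tendsto_nhds_unique (tendsto_const_nhds.congr' hD) ?_
    rw [← Finset.sum_const_zero (s := univ.filter fun T => G.Folded T ∧ ¬ T ≤ W)]
    refine tendsto_finsetSum _ fun T hT => ?_
    simp only [mem_filter, mem_univ, true_and] at hT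
    exact hzero T hT.1 hT.2
  have hall : ∀ᶠ N in atTop, ∀ T, G.Folded T → 0 ≤ R T N ∧ (¬ G.Elementary T → 0 < R T N) :=
    eventually_all.mpr fun T => by
      by_cases hT : G.Folded T
      · filter_upwards [hpos T hT] with N hN _ using hN
      · simp [hT]
  obtain ⟨N, h1, h2⟩ := (hD.and hall).exists
  have h3 : R S N ≤ ∑ T with G.Folded T ∧ ¬ T ≤ W, R T N :=
    Finset.single_le_sum (f := fun T => R T N) (fun T hT => (h2 T (by simp at hT; exact hT.1)).1)
      (by simp [hS, hSW])
  have h4 := (h2 S hS).2 hbad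
  linarith

end LabelledGraph
end Vanishing

section Words

open Finset Filter
open scoped Classical Nat

namespace CyclicWord

variable {α : Type*} {ℓ : ℕ} (l : ZMod ℓ → α × Bool)

/-- The inverse letter. -/
def flip (x : α × Bool) : α × Bool := (x.1, !x.2)

theorem flip_flip (x : α × Bool) : flip (flip x) = x := by simp [flip]

theorem flip_ne (x : α × Bool) : flip x ≠ x := by simp [flip, Prod.ext_iff]

/-- No letter of the cyclic word is followed by its inverse. -/
def Reduced : Prop := ∀ k, l (k + 1) ≠ flip (l k)

/-- The circle subdivided and labelled according to a cyclic word. -/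
def graph : LabelledGraph (ZMod ℓ) (ZMod ℓ) α where
  src k := if (l k).2 then k + 1 else k
  tgt k := if (l k).2 then k else k + 1
  gen k := (l k).1

variable {l}

theorem folded_iff {S : Setoid (ZMod ℓ)} : (graph l).Folded S ↔
    (∀ i j, l i = l j → (S i j ↔ S (i + 1) (j + 1))) ∧
    ∀ i j, l i = flip (l j) → (S (i + 1) j ↔ S i (j + 1)) := by
  constructor
  · intro h
    refine ⟨fun i j hij => ?_, fun i j hij => ?_⟩
    · have := h i j (congrArg Prod.fst hij)
      simp only [graph, hij] at this
      split_ifs at this with h1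
      · exact this.symm
      · exact this
    · have := h i j (show (l i).1 = (l j).1 by rw [hij]; rfl)
      simp only [graph, hij, flip, Bool.not_eq_true'] at this
      cases h1 : (l j).2 <;> simp only [h1, if_true, if_false, reduceCtorEq] at this
      · exact this
      · exact this.symm
  · rintro ⟨h1, h2⟩ i j hij
    simp only [graph] at hij ⊢
    have h3 : l i = l j ∨ l i = flip (l j) := by
      simp only [flip, Prod.ext_iff, hij, true_and]
      cases (l i).2 <;> cases (l j).2 <;> simp
    rcases h3 with h3 | h3
    · rw [h3]
      split_ifs
      · exact (h1 i j h3).symm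
      · exact h1 i j h3
    · have h4 := h2 i j h3
      rw [h3]
      simp only [flip, Bool.not_eq_true']
      cases h5 : (l j).2 <;> simp only [if_true, if_false, reduceCtorEq]
      · exact h4
      · exact h4.symm

variable (l)

/-- Positions are equivalent if the cyclic word reads the same from both of them. -/
def periodSetoid : Setoid (ZMod ℓ) := Setoid.ker fun i k => l (i + k)

variable {l}

theorem periodSetoid_iff {i j : ZMod ℓ} : periodSetoid l i j ↔ ∀ k, l (i + k) = l (j + k) :=
  funext_iff

theorem eq_of_periodSetoid {i j : ZMod ℓ} (h : periodSetoid l i j) : l i = l j := by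
  simpa using periodSetoid_iff.mp h 0

theorem folded_periodSetoid (hl : Reduced l) : (graph l).Folded (periodSetoid l) := by
  refine folded_iff.mpr ⟨fun i j hij => ?_, fun i j hij => ?_⟩
  · rw [periodSetoid_iff, periodSetoid_iff]
    constructor
    · intro h k
      rw [add_assoc, add_assoc]
      exact h _
    · intro h k
      simpa [add_assoc] using h (k - 1)
  · refine iff_of_false (fun h => hl i ?_) fun h => hl j ?_
    · rw [eq_of_periodSetoid h, hij, flip_flip]
    · rw [← eq_of_periodSetoid h, hij]

theorem edgeSetoid_eq (hl : Reduced l) {T : Setoid (ZMod ℓ)} (hT : (graph l).Folded T)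
    (hTW : T ≤ periodSetoid l) : (graph l).edgeSetoid T = T := by
  have h2 := (folded_iff.mp hT).2
  have hne : ∀ i j, l i = flip (l j) → ¬ T (i + 1) j := fun i j hij h =>
    hl i (by rw [eq_of_periodSetoid (hTW h), hij, flip_flip])
  have key : ∀ i j, l i = l j →
      (T ((graph l).src i) ((graph l).src j) ↔ T i j) := by
    intro i j hij
    simp only [graph, hij]
    split_ifs
    · exact ((folded_iff.mp hT).1 i j hij).symm
    · rfl
  ext i j
  rw [LabelledGraph.edgeSetoid_iff]
  constructor
  · rintro ⟨h3, h4⟩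
    have h5 : l i = l j ∨ l i = flip (l j) := by
      simp only [graph] at h3
      simp only [flip, Prod.ext_iff, h3, true_and]
      cases (l i).2 <;> cases (l j).2 <;> simp
    rcases h5 with h5 | h5
    · exact (key i j h5).mp h4
    · exfalso
      simp only [graph, h5, flip] at h4
      cases h6 : (l j).2 <;> simp [h6] at h4
      · exact hne i j h5 h4
      · exact hne i j h5 ((h2 i j h5).mpr h4)
  · intro h
    have h3 := eq_of_periodSetoid (hTW h)
    exact ⟨congrArg Prod.fst h3, (key i j h3).mpr h⟩

theorem phi_periodSetoid [NeZero ℓ] (hl : Reduced l) {N : ℕ} (hN : ℓ ≤ N) :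
    (graph l).phi (periodSetoid l) N =
      #{T | (graph l).Folded T ∧ T ≤ periodSetoid l} := by
  have hW := folded_periodSetoid hl
  rw [(graph l).phi_eq_sum hW (by rwa [Nat.card_zmod]), Finset.card_eq_sum_ones, Nat.cast_sum]
  refine Finset.sum_congr rfl fun T hT => ?_
  simp only [mem_filter, mem_univ, true_and] at hT
  rw [edgeSetoid_eq hl hW le_rfl, edgeSetoid_eq hl hT.1 hT.2, Nat.cast_one, div_self]
  have hcard : Nat.card (Quotient T) ≤ N :=
    (Nat.card_le_card_of_surjective _ Quotient.mk_surjective).trans (by rwa [Nat.card_zmod])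
  obtain ⟨g⟩ : Nonempty (Quotient T ↪ Fin N) :=
    Function.Embedding.nonempty_of_card_le (by
      rw [← Nat.card_eq_fintype_card, ← Nat.card_eq_fintype_card, Nat.card_fin]; exact hcard)
  have : Nonempty (FiberInjective (LabelledGraph.quotientProj T (periodSetoid l)) (Fin N)) :=
    ⟨g, fun x y _ h => g.injective h⟩
  exact_mod_cast Nat.card_pos.ne'

section Euler

variable {S : Setoid (ZMod ℓ)}

/-- The two half edges at a vertex of the quotient which come from a chosen preimage. -/
noncomputable def halfEdge (S : Setoid (ZMod ℓ)) (i : ZMod ℓ) (b : Bool) :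
    Quotient ((graph l).edgeSetoid S) × Bool :=
  if b then (Quotient.mk _ i, !(l i).2) else (Quotient.mk _ (i - 1), (l (i - 1)).2)

theorem halfEdge_true_eq_true {i j : ZMod ℓ} (h : halfEdge (l := l) S i true = halfEdge S j true) :
    l i = l j := by
  simp only [halfEdge, if_true, Prod.mk.injEq, Quotient.eq] at h
  have h1 : (l i).1 = (l j).1 := h.1.1
  exact Prod.ext h1 (by simpa using h.2)

theorem halfEdge_false_eq_false {i j : ZMod ℓ}
    (h : halfEdge (l := l) S i false = halfEdge S j false) : l (i - 1) = l (j - 1) := by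
  simp only [halfEdge, Bool.false_eq_true, if_false, Prod.mk.injEq, Quotient.eq] at h
  have h1 : (l (i - 1)).1 = (l (j - 1)).1 := h.1.1
  exact Prod.ext h1 h.2

theorem halfEdge_true_eq_false {i j : ZMod ℓ}
    (h : halfEdge (l := l) S i true = halfEdge S j false) : l i = flip (l (j - 1)) := by
  simp only [halfEdge, Bool.false_eq_true, if_true, if_false, Prod.mk.injEq, Quotient.eq] at h
  have h1 : (l i).1 = (l (j - 1)).1 := h.1.1
  exact Prod.ext h1 (by simp [flip, ← h.2])

/-- The vertex of a half edge. -/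
noncomputable def halfEdgeVertex (hS : (graph l).Folded S) :
    Quotient ((graph l).edgeSetoid S) × Bool → Quotient S :=
  fun x => Quotient.lift
    (fun e => Quotient.mk S (if x.2 then (graph l).src e else (graph l).tgt e))
    (fun e e' h => by
      have h1 := (graph l).compatible_edgeSetoid hS e e' h
      refine Quotient.sound ?_
      split_ifs
      · exact h1.2.1
      · exact h1.2.2) x.1

theorem halfEdgeVertex_halfEdge (hS : (graph l).Folded S) (i : ZMod ℓ) (b : Bool) :
    halfEdgeVertex hS (halfEdge S i b) = Quotient.mk S i := by
  cases b
  · simp only [halfEdge, Bool.false_eq_true, if_false, halfEdgeVertex, Quotient.lift_mk, graph]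
    cases h : (l (i - 1)).2 <;> simp
  · simp only [halfEdge, if_true, halfEdgeVertex, Quotient.lift_mk, graph]
    cases h : (l i).2 <;> simp

theorem halfEdge_out_injective (hl : Reduced l) (hS : (graph l).Folded S) :
    Function.Injective fun x : Quotient S × Bool => halfEdge (l := l) S x.1.out x.2 := by
  have hred : ∀ i : ZMod ℓ, l i ≠ flip (l (i - 1)) := fun i => by simpa using hl (i - 1)
  rintro ⟨q, b⟩ ⟨q', b'⟩ h
  have h1 := congrArg (halfEdgeVertex hS) h
  simp only [halfEdgeVertex_halfEdge, Quotient.out_eq] at h1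
  subst h1
  congr 1
  cases b <;> cases b' <;> try rfl
  · exact absurd (halfEdge_true_eq_false h.symm) (hred _)
  · exact absurd (halfEdge_true_eq_false h) (hred _)

theorem euler_nonpos [NeZero ℓ] (hl : Reduced l) (hS : (graph l).Folded S) :
    (graph l).euler S ≤ 0 := by
  have := Nat.card_le_card_of_injective _ (halfEdge_out_injective hl hS)
  rw [Nat.card_prod, Nat.card_prod, Nat.card_eq_fintype_card (α := Bool), Fintype.card_bool] at this
  rw [LabelledGraph.euler]
  omega

theorem turn_eq_or [NeZero ℓ] (hl : Reduced l) (hS : (graph l).Folded S)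
    (h0 : (graph l).euler S = 0)
    {i j : ZMod ℓ} (hij : S i j) :
    (l i = l j ∧ l (i - 1) = l (j - 1)) ∨
      (l i = flip (l (j - 1)) ∧ l (i - 1) = flip (l j)) := by
  have hred : ∀ i : ZMod ℓ, l i ≠ flip (l (i - 1)) := fun i => by simpa using hl (i - 1)
  have hinj := halfEdge_out_injective hl hS
  have hbij := (Nat.bijective_iff_injective_and_card _).mpr ⟨hinj, by
    rw [LabelledGraph.euler] at h0
    rw [Nat.card_prod, Nat.card_prod]
    congr 1
    omega⟩
  have key : ∀ k : ZMod ℓ, let m := (Quotient.mk S k).out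
      (l k = l m ∧ l (k - 1) = l (m - 1)) ∨ (l k = flip (l (m - 1)) ∧ l (k - 1) = flip (l m)) := by
    intro k m
    have h1 : ∀ b, ∃ b', halfEdge (l := l) S k b = halfEdge S m b' := by
      intro b
      obtain ⟨⟨q, b'⟩, hq⟩ := hbij.2 (halfEdge (l := l) S k b)
      refine ⟨b', ?_⟩
      have h2 := congrArg (halfEdgeVertex hS) hq
      simp only [halfEdgeVertex_halfEdge, Quotient.out_eq] at h2
      rw [← hq, h2]
    have hk := hred k
    obtain ⟨b, hb⟩ := h1 true
    obtain ⟨b', hb'⟩ := h1 false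
    cases b <;> cases b'
    · exact absurd (by rw [halfEdge_true_eq_false hb, halfEdge_false_eq_false hb']) hk
    · exact Or.inr ⟨halfEdge_true_eq_false hb, by
        rw [halfEdge_true_eq_false hb'.symm, flip_flip]⟩
    · exact Or.inl ⟨halfEdge_true_eq_true hb, halfEdge_false_eq_false hb'⟩
    · exact absurd (by rw [halfEdge_true_eq_true hb, halfEdge_true_eq_false hb'.symm]) hk
  have h1 := key i
  have h2 := key j
  rw [show Quotient.mk S i = Quotient.mk S j from Quotient.sound hij] at h1
  simp only at h1 h2
  rcases h1 with ⟨h1, h1'⟩ | ⟨h1, h1'⟩ <;> rcases h2 with ⟨h2, h2'⟩ | ⟨h2, h2'⟩ <;>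
    simp only [h1, h1', h2, h2', flip_flip, and_self, true_or, or_true]

theorem le_periodSetoid [NeZero ℓ] (hl : Reduced l) (hS : (graph l).Folded S)
    (h0 : (graph l).euler S = 0) :
    S ≤ periodSetoid l := by
  have hred : ∀ i : ZMod ℓ, l i ≠ flip (l (i - 1)) := fun i => by simpa using hl (i - 1)
  have hf := folded_iff.mp hS
  intro i j hij
  rcases turn_eq_or hl hS h0 hij with ⟨h1, _⟩ | ⟨h1, h1'⟩
  · have key : ∀ n : ℕ, S (i + n) (j + n) ∧ l (i + n) = l (j + n) := by
      intro n
      induction n with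
      | zero => simpa using ⟨hij, h1⟩
      | succ n ih =>
        have h2 := (hf.1 _ _ ih.2).mp ih.1
        push_cast
        rw [← add_assoc, ← add_assoc]
        refine ⟨h2, ?_⟩
        rcases turn_eq_or hl hS h0 h2 with h3 | h3
        · exact h3.1
        · exfalso
          refine hl (i + n) ?_
          rw [h3.1, ih.2, add_sub_cancel_right]
    refine periodSetoid_iff.mpr fun k => ?_
    simpa using (key k.val).2
  · exfalso
    have key : ∀ n : ℕ, S (i + n) (j - n) ∧ l (i + n) = flip (l (j - n - 1)) := by
      intro n
      induction n with
      | zero => simpa using ⟨hij, h1⟩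
      | succ n ih =>
        have h2 : S (i + n + 1) (j - n - 1) := (hf.2 _ _ ih.2).mpr (by simpa using ih.1)
        push_cast
        rw [← add_assoc, ← sub_sub]
        refine ⟨h2, ?_⟩
        rcases turn_eq_or hl hS h0 h2 with h3 | h3
        · exfalso
          refine hl (i + n) ?_
          rw [h3.1, ih.2, flip_flip]
        · exact h3.1
    have hj : j = i + ((j - i).val : ZMod ℓ) := by simp
    obtain ⟨n, hn | hn⟩ := Nat.even_or_odd' (j - i).val
    · rw [hn] at hj
      have h3 := (key n).2
      rw [hj] at h3
      push_cast at h3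
      rw [show i + 2 * (n : ZMod ℓ) - n - 1 = i + n - 1 by ring] at h3
      exact hred _ h3
    · rw [hn] at hj
      have h3 := (key n).2
      rw [hj] at h3
      push_cast at h3
      rw [show i + (2 * (n : ZMod ℓ) + 1) - n - 1 = i + n by ring] at h3
      exact flip_ne _ h3.symm

end Euler

end CyclicWord
end Words

section Lifts

open Finset Filter
open scoped Classical Nat

namespace CyclicWord

variable {α : Type*} {ℓ : ℕ} (l : ZMod ℓ → α × Bool)

/-- The product of the first `n` letters of a cyclic word. -/
def pre : ℕ → FreeGroup α
  | 0 => 1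
  | n + 1 => pre n * FreeGroup.mk [l n]

theorem pre_succ (n : ℕ) : pre l (n + 1) = pre l n * FreeGroup.mk [l n] := rfl

theorem val_add_one [NeZero ℓ] (k : ZMod ℓ) :
    (k + 1).val = k.val + 1 ∨ ((k + 1).val = 0 ∧ k.val + 1 = ℓ) := by
  have h : (k + 1).val = (k.val + 1) % ℓ := by
    rw [← ZMod.val_natCast, Nat.cast_add, Nat.cast_one, ZMod.natCast_zmod_val]
  have := ZMod.val_lt k
  rcases Nat.lt_or_ge (k.val + 1) ℓ with h1 | h1
  · exact Or.inl (by rw [h, Nat.mod_eq_of_lt h1])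
  · have h2 : k.val + 1 = ℓ := by omega
    exact Or.inr ⟨by rw [h, h2, Nat.mod_self], h2⟩

theorem graph_edge_iff {X : Type*} (g : α → Equiv.Perm X) (i : ZMod ℓ → X) (k : ZMod ℓ) :
    g ((graph l).gen k) (i ((graph l).src k)) = i ((graph l).tgt k) ↔
      FreeGroup.lift g (FreeGroup.mk [l k]) (i (k + 1)) = i k := by
  simp only [graph, FreeGroup.lift_mk, List.map_cons, List.map_nil, List.prod_cons, List.prod_nil,
    mul_one]
  cases (l k).2
  · simp only [Bool.false_eq_true, if_false, cond_false, Equiv.Perm.inv_eq_iff_eq]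
    exact eq_comm
  · simp

theorem apply_pre {X : Type*} {f : FreeGroup α →* Equiv.Perm X} {i : ZMod ℓ → X}
    (h : ∀ k, f (FreeGroup.mk [l k]) (i (k + 1)) = i k) (n : ℕ) : f (pre l n) (i n) = i 0 := by
  induction n with
  | zero => simp [pre]
  | succ n ih =>
    rw [pre_succ, map_mul, Equiv.Perm.mul_apply, Nat.cast_succ, h, ih]

theorem lifts_of_fixed [NeZero ℓ] {X : Type*} {f : FreeGroup α →* Equiv.Perm X} {x : X}
    (h : f (pre l ℓ) x = x) (k : ZMod ℓ) :
    f (FreeGroup.mk [l k]) ((f (pre l (k + 1).val))⁻¹ x) = (f (pre l k.val))⁻¹ x := by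
  have h1 : (f (pre l (k + 1).val))⁻¹ x = (f (pre l (k.val + 1)))⁻¹ x := by
    rcases val_add_one k with h1 | ⟨h1, h2⟩
    · rw [h1]
    · rw [h1, h2, Equiv.Perm.eq_inv_iff_eq]
      simp [pre, h]
  rw [h1, pre_succ, map_mul, mul_inv_rev, Equiv.Perm.mul_apply, ZMod.natCast_zmod_val]
  simp

/-- The number of pairs of an action of the free group on `N` points and a fixed point of `w`. -/
noncomputable def fixCount (w : FreeGroup α) (N : ℕ) : ℕ :=
  Nat.card {x : (FreeGroup α →* Equiv.Perm (Fin N)) × Fin N // x.1 w x.2 = x.2}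

theorem phi_top [Finite α] [NeZero ℓ] (N : ℕ) :
    (graph l).phi ⊤ N = fixCount (pre l ℓ) N / (N ! : ℝ) ^ Nat.card α := by
  have h : ∀ e e', (graph l).edgeSetoid ⊤ e e' ↔ (graph l).gen e = (graph l).gen e' :=
    fun e e' => and_iff_left trivial
  rw [LabelledGraph.phi, ← (graph l).psi_eq_psi_mk h, LabelledGraph.psi, fixCount]
  congr 2
  refine Nat.card_congr
    { toFun := fun y => ⟨⟨FreeGroup.lift y.1.1, y.1.2 0⟩, ?_⟩
      invFun := fun y => ⟨⟨FreeGroup.lift.symm y.1.1, fun k => (y.1.1 (pre l k.val))⁻¹ y.1.2⟩, ?_⟩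
      left_inv := fun y => ?_
      right_inv := fun y => ?_ }
  · have := apply_pre l (fun k => (graph_edge_iff l _ _ k).mp (y.2 k)) ℓ
    simpa using this
  · intro k
    rw [graph_edge_iff, Equiv.apply_symm_apply]
    exact lifts_of_fixed l y.2 k
  · refine Subtype.ext (Prod.ext (by simp) (funext fun k => ?_))
    have := apply_pre l (fun k => (graph_edge_iff l _ _ k).mp (y.2 k)) k.val
    rw [ZMod.natCast_zmod_val] at this
    simp only [Equiv.Perm.inv_eq_iff_eq]
    exact this.symm
  · refine Subtype.ext (Prod.ext (by simp) ?_)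
    simp [pre]

theorem elementary_of_fixCount [Finite α] [NeZero ℓ] (hl : Reduced l) {c : ℝ}
    (hc : ∀ᶠ N in atTop, fixCount (pre l ℓ) N / (N ! : ℝ) ^ Nat.card α = c)
    {S : Setoid (ZMod ℓ)} (hS : (graph l).Folded S) (hSW : ¬ S ≤ periodSetoid l) :
    (graph l).Elementary S := by
  refine (graph l).elementary_of_eventually_const (folded_periodSetoid hl)
    (c := c - #{T | (graph l).Folded T ∧ T ≤ periodSetoid l}) ?_ (fun T hT hTW => ?_) hS hSW
  · filter_upwards [hc, eventually_ge_atTop ℓ] with N hN h1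
    rw [phi_periodSetoid hl h1, phi_top, hN]
  · exact lt_of_le_of_ne (euler_nonpos hl hT) fun h => hTW (le_periodSetoid hl hT h)

theorem fixCount_of_pow [Finite α] (a : α) (d : ℕ) [NeZero d] : ∃ c : ℝ, ∀ᶠ N in atTop,
    fixCount (FreeGroup.of a ^ d) N / (N ! : ℝ) ^ Nat.card α = c := by
  let l : ZMod d → α × Bool := fun _ => (a, true)
  have hl : Reduced l := fun k => by simp [l, flip]
  have hpre : ∀ n, pre l n = FreeGroup.of a ^ n := by
    intro n
    induction n with
    | zero => rfl
    | succ n ih => rw [pre_succ, ih, pow_succ]; rfl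
  have hW : periodSetoid l = ⊤ := by
    ext i j
    simp [periodSetoid_iff, l]
  refine ⟨#{T | (graph l).Folded T ∧ T ≤ periodSetoid l}, ?_⟩
  filter_upwards [eventually_ge_atTop d] with N hN
  rw [← hpre, ← phi_top, ← hW, phi_periodSetoid hl hN]

/-- Every nontrivial element of a free group is conjugate to one given by a reduced cyclic
word. -/
theorem exists_cyclicWord {w : FreeGroup α} (hw : w ≠ 1) :
    ∃ (c : FreeGroup α) (ℓ : ℕ) (_ : NeZero ℓ) (l : ZMod ℓ → α × Bool),
      Reduced l ∧ w = c * pre l ℓ * c⁻¹ := by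
  set L := FreeGroup.reduceCyclically w.toWord with hL
  have hred : FreeGroup.IsCyclicallyReduced L :=
    FreeGroup.reduceCyclically.isCyclicallyReduced FreeGroup.isReduced_toWord
  have hconj : w = FreeGroup.mk (FreeGroup.reduceCyclically.conjugator w.toWord) *
      FreeGroup.mk L * (FreeGroup.mk (FreeGroup.reduceCyclically.conjugator w.toWord))⁻¹ := by
    rw [FreeGroup.inv_mk, FreeGroup.mul_mk, FreeGroup.mul_mk,
      FreeGroup.reduceCyclically.conj_conjugator_reduceCyclically, FreeGroup.mk_toWord]
  have hne : L ≠ [] := by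
    intro h
    rw [h] at hconj
    apply hw
    rw [hconj, show FreeGroup.mk ([] : List (α × Bool)) = 1 from rfl]
    group
  have hlen : 0 < L.length := List.length_pos_iff.mpr hne
  have hz : NeZero L.length := ⟨hlen.ne'⟩
  let l : ZMod L.length → α × Bool := fun k => L[k.val]'(ZMod.val_lt k)
  refine ⟨FreeGroup.mk (FreeGroup.reduceCyclically.conjugator w.toWord), L.length, hz, l,
    fun k => ?_, ?_⟩
  · have hsame : (l k).1 = (l (k + 1)).1 → (l k).2 = (l (k + 1)).2 := by
      rcases val_add_one k with h | ⟨h, h'⟩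
      · have h1 : k.val + 1 < L.length := h ▸ ZMod.val_lt (k + 1)
        have h2 := List.isChain_iff_getElem.mp hred.isReduced k.val h1
        simp only [l, h]
        exact h2
      · have h2 := hred.2 (l k) (by simp [l, List.getLast?_eq_getElem?, ← h'])
          (l (k + 1)) (by simp [l, h, List.head?_eq_getElem?, hlen])
        exact h2
    intro h
    rw [h] at hsame
    simp [flip] at hsame
  · have hpre : ∀ n ≤ L.length, pre l n = FreeGroup.mk (L.take n) := by
      intro n hn
      induction n with
      | zero => rfl
      | succ n ih =>
        have h1 : (l n) = L[n] := by simp only [l, ZMod.val_natCast, Nat.mod_eq_of_lt hn]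
        rw [pre_succ, ih (by omega), h1, FreeGroup.mul_mk, List.take_append_getElem]
    rw [hpre _ le_rfl, List.take_length]
    exact hconj

theorem fixCount_conj (c w : FreeGroup α) (N : ℕ) : fixCount (c * w * c⁻¹) N = fixCount w N := by
  refine Nat.card_congr
    { toFun := fun x => ⟨⟨x.1.1, (x.1.1 c)⁻¹ x.1.2⟩, ?_⟩
      invFun := fun x => ⟨⟨x.1.1, x.1.1 c x.1.2⟩, ?_⟩
      left_inv := fun x => by simp
      right_inv := fun x => by simp }
  · have := x.2
    simp only [map_mul, map_inv, Equiv.Perm.mul_apply] at this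
    rw [Equiv.Perm.eq_inv_iff_eq, this]
  · simp [x.2]

theorem fixCount_eq_of_card_fiber {v w : FreeGroup α} {N : ℕ} [Finite α]
    (h : ∀ σ : Equiv.Perm (Fin N),
      Nat.card {f : FreeGroup α →* Equiv.Perm (Fin N) // f v = σ} =
        Nat.card {f : FreeGroup α →* Equiv.Perm (Fin N) // f w = σ}) :
    fixCount v N = fixCount w N := by
  have : Finite (FreeGroup α →* Equiv.Perm (Fin N)) := Finite.of_equiv _ FreeGroup.lift
  have E := fun σ => (Finite.card_eq.mp (h σ)).some
  let e : (FreeGroup α →* Equiv.Perm (Fin N)) ≃ (FreeGroup α →* Equiv.Perm (Fin N)) :=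
    (Equiv.sigmaFiberEquiv fun f : FreeGroup α →* Equiv.Perm (Fin N) => f v).symm.trans
      ((Equiv.sigmaCongrRight fun σ => E σ).trans
        (Equiv.sigmaFiberEquiv fun f : FreeGroup α →* Equiv.Perm (Fin N) => f w))
  have he : ∀ f, e f w = f v := fun f => (E (f v) ⟨f, rfl⟩).2
  refine Nat.card_congr ((e.prodCongr (Equiv.refl _)).subtypeEquiv fun x => ?_)
  simp [he]

end CyclicWord
end Lifts

section Hopf

open Finset Filter

/-- A free group with a nontrivial central element is cyclic. -/
theorem FreeGroup.eq_of_central {X : Type*} {w : FreeGroup X} (hw : w ≠ 1)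
    (hc : ∀ g, g * w = w * g) (a b : X) : a = b := by
  classical
  have hne : w.toWord ≠ [] := fun h => hw (FreeGroup.toWord_eq_nil_iff.mp h)
  obtain ⟨⟨c, e⟩, L, hL⟩ := List.exists_cons_of_ne_nil hne
  have key : ∀ a, a = c := by
    intro a
    by_contra hac
    have h1 : (of a * w).toWord = (a, true) :: w.toWord := by
      have h2 : IsReduced ((a, true) :: w.toWord) := by
        have h3 := isReduced_toWord (x := w)
        rw [hL] at h3 ⊢
        exact isReduced_cons_cons.mpr ⟨fun h => absurd h hac, h3⟩
      conv_lhs => rw [← mk_toWord (x := w), of, mul_mk, toWord_mk]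
      exact h2.reduce_eq
    have h2 := toWord_mul_sublist w (of a)
    rw [← hc (of a), h1, toWord_of] at h2
    have h3 := h2.eq_of_length (by simp)
    rw [hL] at h3
    simp only [List.cons_append, List.cons.injEq, Prod.mk.injEq] at h3
    exact hac h3.1.1
  rw [key a, key b]

theorem FreeGroup.mem_zpowers_of_subsingleton {X : Type*} (h : ∀ a b : X, a = b) :
    ∃ g : FreeGroup X, ∀ x, x ∈ Subgroup.zpowers g := by
  have key : ∃ g : FreeGroup X, ∀ a : X, FreeGroup.of a ∈ Subgroup.zpowers g := by
    rcases isEmpty_or_nonempty X with hX | ⟨⟨a⟩⟩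
    · exact ⟨1, fun a => hX.elim a⟩
    · exact ⟨FreeGroup.of a, fun b => h a b ▸ Subgroup.mem_zpowers _⟩
  obtain ⟨g, hg⟩ := key
  refine ⟨g, fun x => ?_⟩
  have h1 : Subgroup.closure (Set.range (FreeGroup.of : X → _)) ≤ Subgroup.zpowers g := by
    rw [Subgroup.closure_le]
    rintro _ ⟨a, rfl⟩
    exact hg a
  exact h1 (by rw [FreeGroup.closure_range_of]; trivial)

theorem IsFreeGroup.mem_zpowers_of_central {G : Type*} [Group G] [IsFreeGroup G] {w : G}
    (hw : w ≠ 1) (hc : ∀ g, g * w = w * g) : ∃ g : G, ∀ x, x ∈ Subgroup.zpowers g := by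
  let e := IsFreeGroup.toFreeGroup G
  obtain ⟨g, hg⟩ := FreeGroup.mem_zpowers_of_subsingleton
    (FreeGroup.eq_of_central (w := e w) (by simpa using hw) fun g => by
      rw [← e.apply_symm_apply g, ← map_mul, ← map_mul, hc])
  refine ⟨e.symm g, fun x => ?_⟩
  obtain ⟨n, hn⟩ := hg (e x)
  exact ⟨n, by rw [← e.symm_apply_apply x, ← hn, map_zpow]⟩

namespace CyclicWord

open scoped Nat

variable {α : Type*} {ℓ : ℕ} {l : ZMod ℓ → α × Bool}

theorem tendsto_phi_top_div [NeZero ℓ] (hl : Reduced l) :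
    Tendsto (fun N : ℕ => (graph l).phi ⊤ N / N) atTop (nhds 0) := by
  classical
  obtain ⟨R, hR, hR0, hlim⟩ := (graph l).exists_folded_terms_of_not_elementary
  have h1 : ∀ T, (graph l).Folded T → Tendsto (fun N : ℕ => R T N / N) atTop (nhds 0) := by
    intro T hT
    by_cases h : (graph l).Elementary T
    · refine tendsto_const_nhds.congr' ?_
      filter_upwards [hR0] with N hN
      rw [hN T hT h, zero_div]
    · have he := euler_nonpos hl hT
      have h2 : Tendsto (fun N : ℕ => (N : ℝ) ^ ((graph l).euler T - 1)) atTop (nhds 0) := by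
        have h3 := (tendsto_pow_atTop (n := (1 - (graph l).euler T).toNat) (α := ℝ)
          (by omega)).comp tendsto_natCast_atTop_atTop
        refine (tendsto_inv_atTop_zero.comp h3).congr fun N => ?_
        simp only [Function.comp_apply]
        rw [← zpow_natCast, ← zpow_neg]
        congr 1
        omega
      have h3 := (hlim T hT h).mul h2
      rw [one_mul] at h3
      refine h3.congr' ?_
      filter_upwards [eventually_ge_atTop 1] with N hN
      have hN0 : (N : ℝ) ≠ 0 := by positivity
      rw [zpow_sub_one₀ hN0]
      have : (N : ℝ) ^ (graph l).euler T ≠ 0 := zpow_ne_zero _ hN0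
      field_simp
  have h2 := tendsto_finsetSum (univ.filter fun T => (graph l).Folded T ∧ T ≤ ⊤)
    fun T hT => h1 T (Finset.mem_filter.mp hT).2.1
  rw [Finset.sum_const_zero] at h2
  refine h2.congr' ?_
  filter_upwards [hR] with N hN
  rw [hN ⊤ (graph l).folded_top, Finset.sum_div]

theorem fixCount_of_forall_eq_one [Finite α] {w : FreeGroup α} {N : ℕ}
    (h : ∀ f : FreeGroup α →* Equiv.Perm (Fin N), f w = 1) :
    fixCount w N = (N !) ^ Nat.card α * N := by
  have e : {x : (FreeGroup α →* Equiv.Perm (Fin N)) × Fin N // x.1 w x.2 = x.2} ≃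
      (α → Equiv.Perm (Fin N)) × Fin N :=
    (Equiv.subtypeUnivEquiv fun x => by rw [h]; rfl).trans
      (FreeGroup.lift.symm.prodCongr (Equiv.refl _))
  rw [fixCount, Nat.card_congr e, Nat.card_prod, Nat.card_fun, Nat.card_perm, Nat.card_fin]

theorem exists_hom_ne_one [Finite α] {w : FreeGroup α} (hw : w ≠ 1) :
    ∃ (N : ℕ) (f : FreeGroup α →* Equiv.Perm (Fin N)), f w ≠ 1 := by
  by_contra! h
  obtain ⟨c, ℓ, _, l, hl, rfl⟩ := exists_cyclicWord hw
  have h1 := tendsto_phi_top_div hl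
  have h2 : Tendsto (fun _ : ℕ => (1 : ℝ)) atTop (nhds 0) := by
    refine h1.congr' ?_
    filter_upwards [eventually_ge_atTop 1] with N hN
    rw [phi_top, ← fixCount_conj c, fixCount_of_forall_eq_one (h N)]
    push_cast
    field_simp
  exact one_ne_zero (tendsto_nhds_unique tendsto_const_nhds h2)

end CyclicWord

/-- Free groups of finite rank are Hopfian. -/
theorem FreeGroup.injective_of_surjective {α : Type*} [Finite α]
    (θ : FreeGroup α →* FreeGroup α) (hθ : Function.Surjective θ) : Function.Injective θ := by
  rw [injective_iff_map_eq_one]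
  intro x hx
  by_contra hne
  obtain ⟨N, f, hf⟩ := CyclicWord.exists_hom_ne_one hne
  have : Finite (FreeGroup α →* Equiv.Perm (Fin N)) := Finite.of_equiv _ FreeGroup.lift
  have hinj : Function.Injective fun g : FreeGroup α →* Equiv.Perm (Fin N) => g.comp θ :=
    fun g g' h => (MonoidHom.cancel_right hθ).mp h
  obtain ⟨g, rfl⟩ := (Finite.injective_iff_surjective.mp hinj) f
  exact hf (by simp [hx])

end Hopf

section Algebra

open Finset Filter

namespace CyclicWord

variable {α : Type*} {ℓ : ℕ} (l : ZMod ℓ → α × Bool)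

/-- The subgroup carried by a partition of the vertices of a cyclic word, based at `0`. -/
def loops (S : Setoid (ZMod ℓ)) : Subgroup (FreeGroup α) :=
  Subgroup.closure (insert (pre l ℓ) {x | ∃ i j, S i j ∧ x = pre l j.val * (pre l i.val)⁻¹})

/-- Vertices of a cyclic word are identified if their prefixes lie in the same right coset. -/
def cosetSetoid (H : Subgroup (FreeGroup α)) : Setoid (ZMod ℓ) :=
  (QuotientGroup.rightRel H).comap fun i => pre l i.val

variable {l}

theorem cosetSetoid_iff {H : Subgroup (FreeGroup α)} {i j : ZMod ℓ} :
    cosetSetoid l H i j ↔ pre l j.val * (pre l i.val)⁻¹ ∈ H :=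
  QuotientGroup.rightRel_apply

theorem loops_le_iff {S : Setoid (ZMod ℓ)} {H : Subgroup (FreeGroup α)} :
    loops l S ≤ H ↔ pre l ℓ ∈ H ∧ S ≤ cosetSetoid l H := by
  rw [loops, Subgroup.closure_le, Set.insert_subset_iff]
  refine and_congr Iff.rfl ⟨fun h i j hij => cosetSetoid_iff.mpr (h ⟨i, j, hij, rfl⟩), ?_⟩
  rintro h _ ⟨i, j, hij, rfl⟩
  exact cosetSetoid_iff.mp (h hij)

theorem mk_flip (x : α × Bool) : FreeGroup.mk [flip x] = (FreeGroup.mk [x])⁻¹ := by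
  simp [FreeGroup.inv_mk, FreeGroup.invRev, flip]

theorem folded_cosetSetoid [NeZero ℓ] {H : Subgroup (FreeGroup α)} (hH : pre l ℓ ∈ H) :
    (graph l).Folded (cosetSetoid l H) := by
  set R := QuotientGroup.rightRel H with hR
  have step : ∀ i : ZMod ℓ, R (pre l (i + 1).val) (pre l i.val * FreeGroup.mk [l i]) := by
    intro i
    have h1 : pre l i.val * FreeGroup.mk [l i] = pre l (i.val + 1) := by
      rw [pre_succ, ZMod.natCast_zmod_val]
    rw [h1, hR, QuotientGroup.rightRel_apply]
    rcases val_add_one i with h | ⟨h, h'⟩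
    · rw [h, mul_inv_cancel]
      exact H.one_mem
    · rw [h, h', pre, inv_one, mul_one]
      exact hH
  have hmul : ∀ x y m : FreeGroup α, R (x * m) (y * m) ↔ R x y := by
    intro x y m
    rw [hR, QuotientGroup.rightRel_apply, QuotientGroup.rightRel_apply]
    simp [mul_assoc]
  rw [folded_iff]
  refine ⟨fun i j hij => ?_, fun i j hij => ?_⟩
  · change R _ _ ↔ R _ _
    rw [← hmul _ _ (FreeGroup.mk [l i])]
    have hi := step i
    have hj := step j
    rw [← hij] at hj
    exact ⟨fun h => R.trans hi (R.trans h (R.symm hj)), fun h => R.trans (R.symm hi) (R.trans h hj)⟩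
  · change R _ _ ↔ R _ _
    have hi := step i
    have hj := step j
    rw [hij, mk_flip] at hi
    have h1 := hmul (pre l i.val * (FreeGroup.mk [l j])⁻¹) (pre l j.val) (FreeGroup.mk [l j])
    rw [inv_mul_cancel_right] at h1
    exact ⟨fun h => R.trans (h1.mpr (R.trans (R.symm hi) h)) (R.symm hj),
      fun h => R.trans hi (h1.mp (R.trans h hj))⟩

theorem loops_join_le [NeZero ℓ] {Δ : Setoid (ZMod ℓ)} {u v : ZMod ℓ} {H : Subgroup (FreeGroup α)}
    (hΔ : loops l Δ ≤ H) (huv : pre l v.val * (pre l u.val)⁻¹ ∈ H) :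
    loops l ((graph l).join Δ {(u, v)}) ≤ H := by
  obtain ⟨h1, h2⟩ := loops_le_iff.mp hΔ
  rw [loops_le_iff, (graph l).join_le_iff (folded_cosetSetoid h1)]
  refine ⟨h1, h2, fun p hp => ?_⟩
  rw [Finset.mem_singleton.mp hp]
  exact cosetSetoid_iff.mpr huv

theorem pre_add (l : ZMod ℓ → α × Bool) (i n : ℕ) :
    pre l (i + n) = pre l i * pre (fun k => l ((i : ZMod ℓ) + k)) n := by
  induction n with
  | zero => simp [pre]
  | succ n ih => rw [← add_assoc, pre_succ, ih, pre_succ, mul_assoc]; push_cast; rfl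

theorem conj_pre [NeZero ℓ] (i : ZMod ℓ) :
    (pre l i.val)⁻¹ * pre l ℓ * pre l i.val = pre (fun k => l (i + k)) ℓ := by
  have h1 := pre_add l i.val ℓ
  have h2 := pre_add l ℓ i.val
  rw [ZMod.natCast_zmod_val] at h1
  rw [add_comm, h1] at h2
  simp only [CharP.cast_eq_zero, zero_add] at h2
  rw [mul_assoc, ← h2, inv_mul_cancel_left]

theorem commute_of_mem_loops [NeZero ℓ] {x : FreeGroup α} (hx : x ∈ loops l (periodSetoid l)) :
    x * pre l ℓ = pre l ℓ * x := by
  have h1 : loops l (periodSetoid l) ≤ Subgroup.centralizer {pre l ℓ} := by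
    rw [loops_le_iff]
    refine ⟨Subgroup.mem_centralizer_singleton_iff.mpr rfl, fun i j hij => cosetSetoid_iff.mpr ?_⟩
    have h2 : (fun k => l (i + k)) = fun k => l (j + k) := funext (periodSetoid_iff.mp hij)
    have h3 := conj_pre (l := l) i
    rw [h2, ← conj_pre] at h3
    rw [Subgroup.mem_centralizer_singleton_iff]
    have h4 : pre l ℓ * pre l i.val = pre l i.val * ((pre l j.val)⁻¹ * pre l ℓ * pre l j.val) := by
      rw [← h3]; group
    calc pre l j.val * (pre l i.val)⁻¹ * pre l ℓ
        = pre l j.val * (pre l i.val)⁻¹ * (pre l ℓ * pre l i.val) * (pre l i.val)⁻¹ := by group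
      _ = pre l ℓ * (pre l j.val * (pre l i.val)⁻¹) := by rw [h4]; group
  exact Subgroup.mem_centralizer_singleton_iff.mp (h1 hx)

theorem exists_root [NeZero ℓ] (hw : pre l ℓ ≠ 1) : ∃ (u : FreeGroup α) (m : ℕ), 1 ≤ m ∧
    u ^ m = pre l ℓ ∧ loops l (periodSetoid l) ≤ Subgroup.closure {u} := by
  have hmem : pre l ℓ ∈ loops l (periodSetoid l) := (loops_le_iff.mp le_rfl).1
  obtain ⟨g, hg⟩ := IsFreeGroup.mem_zpowers_of_central (G := loops l (periodSetoid l))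
    (w := ⟨pre l ℓ, hmem⟩) (fun h => hw (congrArg Subtype.val h))
    (fun x => Subtype.ext (commute_of_mem_loops x.2))
  have h1 : loops l (periodSetoid l) ≤ Subgroup.zpowers g.1 := by
    intro x hx
    obtain ⟨n, hn⟩ := hg ⟨x, hx⟩
    exact ⟨n, congrArg Subtype.val hn⟩
  obtain ⟨n, hn⟩ := h1 hmem
  simp only at hn
  rcases Int.lt_trichotomy n 0 with h | rfl | h
  · refine ⟨g.1⁻¹, n.natAbs, by omega, ?_, ?_⟩
    · rw [← zpow_natCast, inv_zpow', ← hn]; congr 1; omega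
    · rwa [← Subgroup.zpowers_eq_closure, Subgroup.zpowers_inv]
  · exact absurd (hn.symm.trans (zpow_zero _)) hw
  · refine ⟨g.1, n.natAbs, by omega, ?_, ?_⟩
    · rw [← zpow_natCast, ← hn]; congr 1; omega
    · rwa [← Subgroup.zpowers_eq_closure]

theorem loops_mono {S T : Setoid (ZMod ℓ)} (h : S ≤ T) : loops l S ≤ loops l T :=
  loops_le_iff.mpr ⟨(loops_le_iff.mp le_rfl).1, h.trans (loops_le_iff.mp le_rfl).2⟩

theorem exists_generators [NeZero ℓ] (hl : Reduced l) {u : FreeGroup α}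
    (hu : loops l (periodSetoid l) ≤ Subgroup.closure {u})
    (hE : ∀ S, (graph l).Folded S → ¬ S ≤ periodSetoid l → (graph l).Elementary S)
    (S : Setoid (ZMod ℓ)) (hS : (graph l).Folded S) : ∃ Y : Finset (FreeGroup α),
    (#Y : ℤ) ≤ -(graph l).euler S ∧ loops l S ≤ Subgroup.closure (insert u (Y : Set _)) := by
  classical
  induction S using WellFoundedLT.induction with
  | ind S ih =>
    by_cases h : S ≤ periodSetoid l
    · exact ⟨∅, by simpa using euler_nonpos hl hS, by simpa using (loops_mono h).trans hu⟩
    · obtain ⟨Δ, a, b, hΔ, hab, rfl, he⟩ := hE S hS h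
      have hlt : Δ < (graph l).join Δ {(a, b)} := by
        refine lt_of_le_of_ne ((graph l).le_join _ _) fun h => hab ?_
        rw [h]
        exact (graph l).join_rel (Finset.mem_singleton_self (a, b))
      obtain ⟨Y, hY, hΔY⟩ := ih Δ hlt hΔ
      refine ⟨insert (pre l b.val * (pre l a.val)⁻¹) Y, ?_, loops_join_le (hΔY.trans ?_) ?_⟩
      · have := Finset.card_insert_le (pre l b.val * (pre l a.val)⁻¹) Y
        omega
      · refine Subgroup.closure_mono (Set.insert_subset_insert ?_)
        rw [Finset.coe_insert]
        exact Set.subset_insert _ _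
      · refine Subgroup.subset_closure ?_
        rw [Finset.coe_insert]
        exact Or.inr (Or.inl rfl)

theorem pre_mem_loops_top [NeZero ℓ] {n : ℕ} (hn : n ≤ ℓ) : pre l n ∈ loops l ⊤ := by
  obtain ⟨h1, h2⟩ := loops_le_iff.mp (le_refl (loops l ⊤))
  rcases hn.eq_or_lt with rfl | hn
  · exact h1
  · have h3 := cosetSetoid_iff.mp (h2 (x := 0) (y := (n : ZMod ℓ)) trivial)
    rwa [ZMod.val_natCast_of_lt hn, ZMod.val_zero, pre, inv_one, mul_one] at h3

theorem of_mem_loops_top [NeZero ℓ] (k : ZMod ℓ) : FreeGroup.of (l k).1 ∈ loops l ⊤ := by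
  have h1 := pre_mem_loops_top (l := l) (ZMod.val_lt k).le
  have h2 := pre_mem_loops_top (l := l) (n := k.val + 1) (ZMod.val_lt k)
  rw [pre_succ, Subgroup.mul_mem_cancel_left _ h1, ZMod.natCast_zmod_val] at h2
  rcases hk : l k with ⟨a, _ | _⟩
  · rw [hk] at h2
    have h3 := mk_flip (a, false)
    have h4 := Subgroup.inv_mem _ h2
    rw [← h3] at h4
    exact h4
  · rw [hk] at h2
    exact h2

theorem euler_top [NeZero ℓ] :
    (graph l).euler ⊤ = 1 - Nat.card (Set.range fun k => (l k).1) := by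
  have h1 : (graph l).edgeSetoid ⊤ = Setoid.ker fun k => (l k).1 := by
    ext i j
    rw [LabelledGraph.edgeSetoid_iff]
    exact ⟨fun h => h.1, fun h => ⟨h, trivial⟩⟩
  rw [LabelledGraph.euler, h1, Nat.card_congr (Setoid.quotientKerEquivRange _)]
  have h2 : Subsingleton (Quotient (⊤ : Setoid (ZMod ℓ))) :=
    ⟨fun a b => Quotient.inductionOn₂ a b fun _ _ => Quotient.sound trivial⟩
  have h3 : Nonempty (Quotient (⊤ : Setoid (ZMod ℓ))) := ⟨Quotient.mk _ 0⟩
  rw [Nat.card_unique]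
  rfl

theorem exists_mulAut_of_closure [Finite α] (x : α) (u : FreeGroup α) {Z : Finset (FreeGroup α)}
    (hZ : #Z + 1 ≤ Nat.card α) (hc : Subgroup.closure (insert u (Z : Set (FreeGroup α))) = ⊤) :
    ∃ θ : MulAut (FreeGroup α), θ (FreeGroup.of x) = u := by
  classical
  have := Fintype.ofFinite α
  rw [Nat.card_eq_fintype_card] at hZ
  have hcard : Fintype.card Z ≤ Fintype.card {a : α // a ≠ x} := by
    rw [Fintype.card_coe, Fintype.card_subtype_compl, Fintype.card_subtype_eq]
    omega
  obtain ⟨e⟩ := Function.Embedding.nonempty_of_card_le hcard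
  let f : α → FreeGroup α := fun a =>
    if h : a ≠ x then Function.extend e Subtype.val (fun _ => 1) ⟨a, h⟩ else u
  have hfx : f x = u := dif_neg (by simp)
  have hsurj : Function.Surjective (FreeGroup.lift f) := by
    rw [← MonoidHom.range_eq_top, FreeGroup.range_lift_eq_closure, eq_top_iff, ← hc]
    refine Subgroup.closure_mono (Set.insert_subset ⟨x, hfx⟩ fun z hz => ?_)
    refine ⟨(e ⟨z, hz⟩).1, ?_⟩
    rw [show f (e ⟨z, hz⟩).1 = _ from dif_pos (e ⟨z, hz⟩).2]
    exact e.injective.extend_apply _ _ ⟨z, hz⟩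
  refine ⟨MulEquiv.ofBijective (FreeGroup.lift f)
    ⟨FreeGroup.injective_of_surjective _ hsurj, hsurj⟩, ?_⟩
  exact FreeGroup.lift_apply_of.trans hfx

theorem exists_mulAut_of_loops_top [Finite α] [NeZero ℓ] (x : α) {u : FreeGroup α}
    {Y : Finset (FreeGroup α)} (hY : (#Y : ℤ) ≤ -(graph l).euler ⊤)
    (hc : loops l ⊤ ≤ Subgroup.closure (insert u (Y : Set _))) :
    ∃ θ : MulAut (FreeGroup α), θ (FreeGroup.of x) = u := by
  classical
  have := Fintype.ofFinite α
  set A : Finset α := univ.image fun k => (l k).1 with hA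
  have hAc : Nat.card (Set.range fun k => (l k).1) = #A := by
    rw [Nat.card_coe_set_eq, ← Set.ncard_coe_finset, hA, coe_image, coe_univ, Set.image_univ]
  refine exists_mulAut_of_closure x u (Z := Y ∪ Aᶜ.image FreeGroup.of) ?_ ?_
  · rw [euler_top, hAc] at hY
    have h1 := card_union_le Y (Aᶜ.image FreeGroup.of)
    have h2 : #(Aᶜ.image (FreeGroup.of (α := α))) ≤ #Aᶜ := card_image_le
    have h3 := card_add_card_compl A
    rw [Nat.card_eq_fintype_card]
    omega
  · rw [eq_top_iff, ← FreeGroup.closure_range_of, Subgroup.closure_le]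
    rintro _ ⟨a, rfl⟩
    by_cases ha : a ∈ A
    · obtain ⟨k, -, rfl⟩ := mem_image.mp ha
      refine Subgroup.closure_mono (Set.insert_subset_insert ?_) (hc (of_mem_loops_top k))
      simp
    · refine Subgroup.subset_closure (Or.inr ?_)
      simpa using Or.inr ⟨a, ha, rfl⟩

end CyclicWord

end Algebra

section Determination

open Finset Filter

theorem orderOf_finRotate_succ (n : ℕ) : orderOf (finRotate (n + 1)) = n + 1 := by
  rcases n with _ | n
  · exact orderOf_eq_one_iff.mpr (Subsingleton.elim (α := Equiv.Perm (Fin 1)) _ _)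
  · rw [Equiv.Perm.IsCycle.orderOf (isCycle_finRotate), support_finRotate, card_univ,
      Fintype.card_fin]

theorem dvd_of_pow_perm_eq_pow {m d : ℕ} (hm : 1 ≤ m)
    (h : ∀ g : Equiv.Perm (Fin m), ∃ k : Equiv.Perm (Fin m), k ^ m = g ^ d) : m ∣ d := by
  have h1 : m ∣ Monoid.exponent (Equiv.Perm (Fin m)) := by
    obtain ⟨n, rfl⟩ := Nat.exists_eq_add_of_le' hm
    have := Monoid.order_dvd_exponent (finRotate (n + 1))
    rwa [orderOf_finRotate_succ] at this
  obtain ⟨k, hk⟩ := h1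
  have hk0 : 0 < k := by
    refine Nat.pos_of_ne_zero ?_
    rintro rfl
    exact Monoid.exponent_ne_zero_of_finite hk
  have h2 : Monoid.exponent (Equiv.Perm (Fin m)) ∣ d * k := by
    refine Monoid.exponent_dvd_of_forall_pow_eq_one fun g => ?_
    obtain ⟨x, hx⟩ := h g
    rw [pow_mul, ← hx, ← pow_mul, ← hk, Monoid.pow_exponent_eq_one]
  rw [hk] at h2
  exact Nat.dvd_of_mul_dvd_mul_right hk0 h2

namespace CyclicWord

open scoped Nat

variable {α : Type*} [Finite α]

theorem not_eventually_fixCount_one {c : ℝ}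
    (hc : ∀ᶠ N in atTop, fixCount (1 : FreeGroup α) N / (N ! : ℝ) ^ Nat.card α = c) : False := by
  have h1 : ∀ N : ℕ, fixCount (1 : FreeGroup α) N / (N ! : ℝ) ^ Nat.card α = N := by
    intro N
    rw [fixCount_of_forall_eq_one fun f => map_one f]
    push_cast
    field_simp
  simp only [h1] at hc
  obtain ⟨M, hM⟩ := eventually_atTop.mp hc
  have h2 := hM M le_rfl
  have h3 := hM (M + 1) (by omega)
  push_cast at h3
  linarith

theorem exists_mulAut_pow (a : α) {w : FreeGroup α} {c : ℝ}
    (hc : ∀ᶠ N in atTop, fixCount w N / (N ! : ℝ) ^ Nat.card α = c) :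
    ∃ (θ : MulAut (FreeGroup α)) (m : ℕ), 1 ≤ m ∧ θ (FreeGroup.of a ^ m) = w := by
  have hw : w ≠ 1 := by
    rintro rfl
    exact not_eventually_fixCount_one hc
  obtain ⟨x, ℓ, _, l, hl, rfl⟩ := exists_cyclicWord hw
  have hp : pre l ℓ ≠ 1 := by
    intro h
    simp [h] at hw
  simp only [fixCount_conj] at hc
  obtain ⟨u, m, hm, hum, hu⟩ := exists_root hp
  obtain ⟨Y, hY, hYc⟩ := exists_generators hl hu
    (fun S hS hSW => elementary_of_fixCount l hl hc hS hSW) ⊤ (graph l).folded_top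
  obtain ⟨θ, hθ⟩ := exists_mulAut_of_loops_top a hY hYc
  exact ⟨MulAut.conj x * θ, m, hm, by
    rw [MulAut.mul_apply, map_pow, hθ, hum, MulAut.conj_apply]⟩

theorem exists_hom_iff {v w : FreeGroup α} {N : ℕ} {σ : Equiv.Perm (Fin N)}
    (h : Nat.card {f : FreeGroup α →* Equiv.Perm (Fin N) // f v = σ} =
      Nat.card {f : FreeGroup α →* Equiv.Perm (Fin N) // f w = σ}) :
    (∃ f : FreeGroup α →* Equiv.Perm (Fin N), f v = σ) ↔
      ∃ f : FreeGroup α →* Equiv.Perm (Fin N), f w = σ := by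
  have : Finite (FreeGroup α →* Equiv.Perm (Fin N)) := Finite.of_equiv _ FreeGroup.lift
  rw [← nonempty_subtype, ← nonempty_subtype, ← Finite.card_pos_iff, ← Finite.card_pos_iff, h]

end CyclicWord

theorem exists_hom_mulAut_pow {α G : Type*} [Group G] (a : α) (θ : MulAut (FreeGroup α)) (m : ℕ)
    (σ : G) : (∃ f : FreeGroup α →* G, f (θ (FreeGroup.of a ^ m)) = σ) ↔ ∃ g : G, g ^ m = σ := by
  constructor
  · rintro ⟨f, rfl⟩
    exact ⟨f (θ (FreeGroup.of a)), by rw [map_pow, map_pow]⟩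
  · rintro ⟨g, rfl⟩
    refine ⟨(FreeGroup.lift fun _ => g).comp θ⁻¹.toMonoidHom, ?_⟩
    change FreeGroup.lift (fun _ => g) (θ⁻¹ (θ (FreeGroup.of a ^ m))) = _
    rw [MulAut.inv_apply_self, map_pow, FreeGroup.lift_apply_of]

end Determination

/-- If `w` in the free group `F_r` (`r ≥ 1`) induces the same measure as `x₁ ^ d`
(`d ≥ 1`) on the symmetric group `S_N` for every `N ≥ 1` — i.e. for every `N` and
every permutation `σ ∈ S_N`, the number of homomorphisms `φ : F_r →* S_N` with
`φ w = σ` equals the number with `φ (x₁ ^ d) = σ` — then some automorphism of `F_r`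
maps `x₁ ^ d` to `w`. -/
theorem power_of_generator_determined_by_symmetric_groups
    (r : ℕ) (hr : 1 ≤ r) (d : ℕ) (hd : 1 ≤ d) (w : FreeGroup (Fin r))
    (h : ∀ N : ℕ, 1 ≤ N → ∀ σ : Equiv.Perm (Fin N),
      Nat.card {φ : FreeGroup (Fin r) →* Equiv.Perm (Fin N) // φ w = σ} =
        Nat.card {φ : FreeGroup (Fin r) →* Equiv.Perm (Fin N) //
          φ ((FreeGroup.of (⟨0, hr⟩ : Fin r)) ^ d) = σ}) :
    ∃ θ : MulAut (FreeGroup (Fin r)), θ ((FreeGroup.of (⟨0, hr⟩ : Fin r)) ^ d) = w := by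
  have : NeZero d := ⟨by omega⟩
  obtain ⟨c, hc⟩ := CyclicWord.fixCount_of_pow (⟨0, hr⟩ : Fin r) d
  have hcw : ∀ᶠ N : ℕ in Filter.atTop,
      CyclicWord.fixCount w N / (N.factorial : ℝ) ^ Nat.card (Fin r) = c := by
    filter_upwards [hc, Filter.eventually_ge_atTop 1] with N hN hN1
    rw [CyclicWord.fixCount_eq_of_card_fiber (h N hN1)]
    exact hN
  obtain ⟨θ, m, hm, rfl⟩ := CyclicWord.exists_mulAut_pow (⟨0, hr⟩ : Fin r) hcw
  have hpow : ∀ N : ℕ, 1 ≤ N → ∀ σ : Equiv.Perm (Fin N),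
      (∃ g : Equiv.Perm (Fin N), g ^ m = σ) ↔ ∃ g : Equiv.Perm (Fin N), g ^ d = σ := by
    intro N hN σ
    have h1 := CyclicWord.exists_hom_iff (h N hN σ)
    have h2 := exists_hom_mulAut_pow (⟨0, hr⟩ : Fin r) 1 d σ
    rw [exists_hom_mulAut_pow] at h1
    exact h1.trans h2
  have hmd : m = d := Nat.dvd_antisymm
    (dvd_of_pow_perm_eq_pow hm fun g => (hpow m hm (g ^ d)).mpr ⟨g, rfl⟩)
    (dvd_of_pow_perm_eq_pow hd fun g => (hpow d hd (g ^ m)).mp ⟨g, rfl⟩)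
  exact ⟨θ, by rw [hmd]⟩
end

section
/- Let d, N ∈ ℤ_{≥1}. A permutation σ ∈ S_N is a d-th power in S_N (i.e., σ = τ^d for some τ ∈ S_N) if and only if for every t ∈ ℤ_{≥1}, the product ∏_{p | t} p^{ν_p(d)}, taken over all prime divisors p of t, divides c_t(σ). In particular, when d | t, the condition on c_t is that d | c_t(σ). -/
/-- `cycleCount σ t` is the number of `t`-cycles in the cycle decomposition of the
permutation `σ` (for `t = 1` this counts the fixed points): the cycles of length `t`
correspond to the `⟨σ⟩`-orbits of size `t`, each of which contains `t` points. -/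
noncomputable def cycleCount {N : ℕ} (σ : Equiv.Perm (Fin N)) (t : ℕ) : ℕ :=
  Nat.card {x : Fin N // Nat.card {y : Fin N // σ.SameCycle x y} = t} / t

open Function

theorem Equiv.Perm.card_sameCycle_eq_minimalPeriod {α : Type*} [Finite α] (σ : Equiv.Perm α)
    (x : α) : Nat.card {y : α // σ.SameCycle x y} = minimalPeriod σ x := by
  have := Fintype.ofFinite (MulAction.orbit (Subgroup.zpowers σ) x)
  have h := MulAction.minimalPeriod_eq_card (a := σ) (b := x)
  rw [← Nat.card_eq_fintype_card] at h
  refine Eq.trans (Nat.card_congr (Equiv.subtypeEquivRight fun y => ?_)) h.symm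
  rw [MulAction.mem_orbit_iff]
  constructor
  · rintro ⟨i, hi⟩
    exact ⟨⟨σ ^ i, i, rfl⟩, hi⟩
  · rintro ⟨⟨_, i, rfl⟩, hi⟩
    exact ⟨i, hi⟩

theorem Equiv.Perm.minimalPeriod_pos {α : Type*} [Finite α] (σ : Equiv.Perm α) (x : α) :
    0 < minimalPeriod σ x :=
  minimalPeriod_pos_of_mem_periodicPts (σ.injective.mem_periodicPts x)

/-- A permutation all of whose cycles have length `t` is isomorphic to a disjoint union of
copies of the translation by `1` on `ZMod t`. -/
theorem Equiv.Perm.exists_equiv_prod_zmod {α : Type*} [Finite α] (σ : Equiv.Perm α) (t : ℕ)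
    [NeZero t] (h : ∀ x, minimalPeriod σ x = t) :
    ∃ (c : ℕ) (e : Fin c × ZMod t ≃ α), ∀ i z, e (i, z + 1) = σ (e (i, z)) := by
  let Q := Quotient (SameCycle.setoid σ)
  have : Finite Q := Quotient.finite _
  let r : Q → α := Quotient.out
  have hr : ∀ a : α, σ.SameCycle (r (Quotient.mk _ a)) a := fun a =>
    Quotient.exact (Quotient.out_eq (Quotient.mk (SameCycle.setoid σ) a))
  let f : Q × ZMod t → α := fun p => σ^[p.2.val] (r p.1)
  have hmod : ∀ (n : ℕ) (x : α), σ^[n % t] x = σ^[n] x := fun n x => by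
    conv_lhs => rw [← h x]
    exact iterate_mod_minimalPeriod_eq
  have hstep : ∀ q z, f (q, z + 1) = σ (f (q, z)) := fun q z => by
    change σ^[(z + 1).val] (r q) = σ (σ^[z.val] (r q))
    rw [← Function.iterate_succ_apply' σ, ← hmod (z.val + 1), ZMod.val_add, ← hmod]
    simp [ZMod.val_one_eq_one_mod]
  have hsame : ∀ p, Quotient.mk (SameCycle.setoid σ) (f p) = p.1 := fun p => by
    have h1 : σ.SameCycle (f p) (r p.1) := by
      refine SameCycle.symm ⟨p.2.val, ?_⟩
      rw [zpow_natCast, coe_pow]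
    exact (Quotient.sound h1).trans (Quotient.out_eq p.1)
  have hbij : Bijective f := by
    constructor
    · rintro ⟨q, z⟩ ⟨q', z'⟩ hf
      have hq : q = q' := (hsame (q, z)).symm.trans
        ((congrArg (Quotient.mk (SameCycle.setoid σ)) hf).trans (hsame (q', z')))
      subst hq
      have hz := (iterate_eq_iterate_iff_of_lt_minimalPeriod
        (by rw [h]; exact ZMod.val_lt z) (by rw [h]; exact ZMod.val_lt z')).1 hf
      exact congrArg (Prod.mk q) (ZMod.val_injective t hz)
    · intro a
      obtain ⟨n, -, hn⟩ := (hr a).exists_pow_eq'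
      refine ⟨(Quotient.mk _ a, (n : ZMod t)), ?_⟩
      change σ^[(n : ZMod t).val] (r _) = a
      rw [ZMod.val_natCast, hmod, ← coe_pow, hn]
  let e := Equiv.ofBijective f hbij
  exact ⟨Nat.card Q, ((Finite.equivFin Q).symm.prodCongr (Equiv.refl _)).trans e,
    fun i z => hstep _ z⟩

theorem Equiv.Perm.dvd_card_of_minimalPeriod_eq {α : Type*} [Finite α] (σ : Equiv.Perm α) (t : ℕ)
    (h : ∀ x, minimalPeriod σ x = t) : t ∣ Nat.card α := by
  rcases isEmpty_or_nonempty α with _ | ⟨⟨x⟩⟩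
  · simp
  have : NeZero t := ⟨by rw [← h x]; exact (σ.minimalPeriod_pos x).ne'⟩
  obtain ⟨c, e, -⟩ := σ.exists_equiv_prod_zmod t h
  rw [← Nat.card_congr e]
  simp

/-- Two permutations all of whose cycles have length `t`, on sets of the same cardinality,
are conjugate. -/
theorem Equiv.Perm.exists_permCongr_eq_of_minimalPeriod_eq {α β : Type*} [Finite α] [Finite β]
    (σ : Equiv.Perm α) (ρ : Equiv.Perm β) (t : ℕ) [NeZero t] (hσ : ∀ x, minimalPeriod σ x = t)
    (hρ : ∀ y, minimalPeriod ρ y = t) (hc : Nat.card α = Nat.card β) :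
    ∃ e : β ≃ α, e.permCongr ρ = σ := by
  obtain ⟨c, e, he⟩ := σ.exists_equiv_prod_zmod t hσ
  obtain ⟨c', e', he'⟩ := ρ.exists_equiv_prod_zmod t hρ
  have hcc : c = c' := by
    rw [← Nat.card_congr e, ← Nat.card_congr e'] at hc
    simpa [NeZero.ne t] using hc
  subst hcc
  refine ⟨e'.symm.trans e, Equiv.ext fun x => ?_⟩
  obtain ⟨⟨i, z⟩, rfl⟩ := e.surjective x
  simp [Equiv.permCongr_apply, ← he, ← he']

/-- In a disjoint union of copies of the translation by `1` on `ZMod n`, every point has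
minimal period `n` (for `n = 0`, no point is periodic). -/
theorem minimalPeriod_prodCongr_addRight_one {κ : Type*} (n : ℕ) (p : κ × ZMod n) :
    minimalPeriod ((Equiv.refl κ).prodCongr (Equiv.addRight (1 : ZMod n))) p = n := by
  have hit : ∀ j : ℕ, ((Equiv.refl κ).prodCongr (Equiv.addRight (1 : ZMod n)))^[j] p
      = (p.1, p.2 + j) := fun j => by
    induction j with
    | zero => simp
    | succ j ih => rw [Function.iterate_succ_apply', ih]; simp [add_assoc]
  refine Nat.dvd_right_iff_eq.1 fun j => ?_
  rw [← isPeriodicPt_iff_minimalPeriod_dvd, IsPeriodicPt, IsFixedPt, hit, Prod.ext_iff]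
  simp [ZMod.natCast_eq_zero_iff]

theorem Equiv.Perm.exists_pow_eq_of_minimalPeriod_eq {α : Type*} [Finite α] (σ : Equiv.Perm α)
    {d m t : ℕ} (hd : d ≠ 0) (ht : t ≠ 0) (hσ : ∀ x, minimalPeriod σ x = t)
    (hgcd : (m * t).gcd d = m) (hc : m * t ∣ Nat.card α) :
    ∃ τ : Equiv.Perm α, τ ^ d = σ := by
  have hm : m ≠ 0 := by rintro rfl; simp [hd] at hgcd
  have : NeZero t := ⟨ht⟩
  have : NeZero (m * t) := ⟨mul_ne_zero hm ht⟩
  obtain ⟨k, hk⟩ := hc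
  let π : Equiv.Perm (Fin k × ZMod (m * t)) :=
    (Equiv.refl (Fin k)).prodCongr (Equiv.addRight (1 : ZMod (m * t)))
  obtain ⟨e, he⟩ := σ.exists_permCongr_eq_of_minimalPeriod_eq (π ^ d) t hσ
    (fun y => by
      rw [coe_pow, minimalPeriod_iterate_eq_div_gcd hd, minimalPeriod_prodCongr_addRight_one,
        hgcd, Nat.mul_div_cancel_left _ (Nat.pos_of_ne_zero hm)])
    (by rw [hk, mul_comm]; simp)
  refine ⟨e.permCongr π, ?_⟩
  rw [← he]
  exact (map_pow e.permCongrHom π d).symm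

theorem Equiv.Perm.minimalPeriod_apply_eq_iff {α : Type*} [Finite α] (σ : Equiv.Perm α) (t : ℕ)
    (x : α) : minimalPeriod σ (σ x) = t ↔ minimalPeriod σ x = t := by
  rw [minimalPeriod_apply (σ.injective.mem_periodicPts x)]

/-- The restriction of a permutation to the union of its cycles of length `t`. -/
abbrev Equiv.Perm.restrictMinimalPeriod {α : Type*} [Finite α] (σ : Equiv.Perm α) (t : ℕ) :
    Equiv.Perm {x : α // minimalPeriod σ x = t} :=
  σ.subtypePerm (σ.minimalPeriod_apply_eq_iff t)

theorem Equiv.Perm.minimalPeriod_restrictMinimalPeriod {α : Type*} [Finite α] (σ : Equiv.Perm α)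
    (t : ℕ) (x : {x : α // minimalPeriod σ x = t}) :
    minimalPeriod (σ.restrictMinimalPeriod t) x = t := by
  refine Eq.trans (minimalPeriod_eq_minimalPeriod_iff.2 fun n => ?_) x.2
  rw [IsPeriodicPt, IsPeriodicPt, IsFixedPt, IsFixedPt, ← coe_pow, ← coe_pow, subtypePerm_pow,
    Subtype.ext_iff, subtypePerm_apply]

theorem Equiv.Perm.dvd_card_minimalPeriod_eq {α : Type*} [Finite α] (σ : Equiv.Perm α) (t : ℕ) :
    t ∣ Nat.card {x : α // minimalPeriod σ x = t} :=
  dvd_card_of_minimalPeriod_eq _ t (σ.minimalPeriod_restrictMinimalPeriod t)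

theorem Equiv.Perm.exists_pow_eq_of_restrict {α : Type*} [Finite α] (σ : Equiv.Perm α) (d : ℕ)
    (h : ∀ t, ∃ τ, τ ^ d = σ.restrictMinimalPeriod t) : ∃ τ : Equiv.Perm α, τ ^ d = σ := by
  choose τ hτ using h
  let E := Equiv.sigmaFiberEquiv (fun x => minimalPeriod σ x)
  refine ⟨E.permCongrHom (sigmaCongrRightHom _ τ), ?_⟩
  rw [← map_pow, ← map_pow]
  ext x
  obtain ⟨⟨t, y, hy⟩, rfl⟩ := E.surjective x
  have h1 : (τ ^ d) t ⟨y, hy⟩ = σ.restrictMinimalPeriod t ⟨y, hy⟩ := by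
    rw [Pi.pow_apply, hτ]
  change E (sigmaCongrRightHom _ (τ ^ d) (E.symm (E ⟨t, y, hy⟩))) = _
  rw [Equiv.symm_apply_apply]
  exact congrArg Subtype.val h1

theorem prod_primeFactors_pow_factorization_dvd_gcd {d s t : ℕ} (hd : d ≠ 0) (ht : t ≠ 0)
    (hs : s = t * s.gcd d) :
    (∏ p ∈ t.primeFactors, p ^ d.factorization p) ∣ s.gcd d := by
  have hg : s.gcd d ≠ 0 := Nat.gcd_ne_zero_right hd
  have hs0 : s ≠ 0 := by rw [hs]; exact mul_ne_zero ht hg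
  refine Finset.prod_dvd_of_isRelPrime (fun p hp q hq hpq => ?_) fun p hp => ?_
  · exact Nat.coprime_iff_isRelPrime.1 (Nat.Coprime.pow _ _ ((Nat.coprime_primes
      (Nat.prime_of_mem_primeFactors hp) (Nat.prime_of_mem_primeFactors hq)).2 hpq))
  · have hpp := Nat.prime_of_mem_primeFactors hp
    rw [hpp.pow_dvd_iff_le_factorization hg]
    have h1 := congrArg (fun n => n.factorization p) hs
    have h2 := hpp.factorization_pos_of_dvd ht (Nat.dvd_of_mem_primeFactors hp)
    have h3 := congrArg (fun f => f p) (Nat.factorization_gcd hs0 hd)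
    simp only [Nat.factorization_mul ht hg, Finsupp.add_apply, Finsupp.inf_apply] at h1 h3
    grind

theorem gcd_prod_primeFactors_pow_factorization_mul {d t : ℕ} (hd : d ≠ 0) (ht : t ≠ 0) :
    ((∏ p ∈ t.primeFactors, p ^ d.factorization p) * t).gcd d
      = ∏ p ∈ t.primeFactors, p ^ d.factorization p := by
  set m := ∏ p ∈ t.primeFactors, p ^ d.factorization p with hm
  have hm0 : m ≠ 0 := Finset.prod_ne_zero_iff.2 fun p hp =>
    pow_ne_zero _ (Nat.prime_of_mem_primeFactors hp).ne_zero
  have hfac : ∀ p, m.factorization p = if p ∈ t.primeFactors then d.factorization p else 0 := by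
    intro p
    rw [hm, Nat.factorization_prod_apply fun q hq =>
      pow_ne_zero _ (Nat.prime_of_mem_primeFactors hq).ne_zero]
    rw [← Finset.sum_ite_eq' t.primeFactors p d.factorization]
    refine Finset.sum_congr rfl fun q hq => ?_
    rw [(Nat.prime_of_mem_primeFactors hq).factorization_pow, Finsupp.single_apply]
  refine Nat.eq_of_factorization_eq (Nat.gcd_ne_zero_right hd) hm0 fun p => ?_
  rw [Nat.factorization_gcd (mul_ne_zero hm0 ht) hd, Nat.factorization_mul hm0 ht,
    Finsupp.inf_apply, Finsupp.add_apply, hfac]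
  split_ifs with hp
  · simp
  · rw [← Nat.support_factorization, Finsupp.notMem_support_iff] at hp
    simp [hp]

theorem prod_primeFactors_pow_factorization_eq_of_dvd {d t : ℕ} (hd : d ≠ 0) (ht : t ≠ 0)
    (h : d ∣ t) : ∏ p ∈ t.primeFactors, p ^ d.factorization p = d := by
  conv_rhs => rw [← Nat.prod_factorization_pow_eq_self hd]
  refine (Finsupp.prod_of_support_subset _ ?_ _ (by simp)).symm
  exact Nat.primeFactors_mono h ht

theorem Equiv.Perm.mul_dvd_card_minimalPeriod_pow_eq {α : Type*} [Finite α] (τ : Equiv.Perm α)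
    {d t : ℕ} (hd : d ≠ 0) (ht : t ≠ 0) :
    (∏ p ∈ t.primeFactors, p ^ d.factorization p) * t
      ∣ Nat.card {x : α // minimalPeriod (τ ^ d : Equiv.Perm α) x = t} := by
  classical
  have := Fintype.ofFinite α
  rw [Nat.card_eq_fintype_card, Fintype.card_subtype,
    Finset.card_eq_sum_card_image (fun x => minimalPeriod τ x)]
  refine Finset.dvd_sum fun s hs => ?_
  obtain ⟨x, hx, rfl⟩ := Finset.mem_image.1 hs
  have key : ∀ y, minimalPeriod (τ ^ d : Equiv.Perm α) y
      = minimalPeriod τ y / (minimalPeriod τ y).gcd d := fun y => by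
    rw [coe_pow, minimalPeriod_iterate_eq_div_gcd hd]
  simp only [Finset.mem_filter, Finset.mem_univ, true_and, key] at hx
  have hst : minimalPeriod τ x = t * (minimalPeriod τ x).gcd d := by
    rw [← hx, Nat.div_mul_cancel (Nat.gcd_dvd_left _ _)]
  have hcard := τ.dvd_card_minimalPeriod_eq (minimalPeriod τ x)
  rw [Nat.card_eq_fintype_card, Fintype.card_subtype] at hcard
  rw [Finset.filter_filter]
  rw [Finset.filter_congr (q := fun y => minimalPeriod τ y = minimalPeriod τ x)
    fun y _ => ⟨And.right, fun h => ⟨by rw [key, h, hx], h⟩⟩]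
  refine dvd_trans ?_ hcard
  conv_rhs => rw [hst, mul_comm]
  exact Nat.mul_dvd_mul_right (prod_primeFactors_pow_factorization_dvd_gcd hd ht hst) t

theorem dvd_cycleCount_iff {N : ℕ} (σ : Equiv.Perm (Fin N)) (m t : ℕ) :
    m ∣ cycleCount σ t ↔ m * t ∣ Nat.card {x : Fin N // minimalPeriod σ x = t} := by
  simp only [cycleCount, Equiv.Perm.card_sameCycle_eq_minimalPeriod]
  rw [Nat.dvd_div_iff_mul_dvd (σ.dvd_card_minimalPeriod_eq t), mul_comm]

/-- A permutation `σ ∈ S_N` is a `d`-th power if and only if for every `t ≥ 1` the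
number `∏_{p ∣ t} p^{ν_p(d)}` (product over the prime divisors of `t`) divides
`c_t(σ)`, the number of `t`-cycles of `σ`.  In particular, when `d ∣ t`, the
condition on `c_t` is exactly that `d ∣ c_t(σ)`. -/
theorem isPower_iff_cycleCounts
    (d N : ℕ) (hd : 1 ≤ d) (hN : 1 ≤ N) (σ : Equiv.Perm (Fin N)) :
    ((∃ τ : Equiv.Perm (Fin N), σ = τ ^ d) ↔
      ∀ t : ℕ, 1 ≤ t →
        (∏ p ∈ t.primeFactors, p ^ (d.factorization p)) ∣ cycleCount σ t) ∧
    (∀ t : ℕ, 1 ≤ t → d ∣ t →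
      (((∏ p ∈ t.primeFactors, p ^ (d.factorization p)) ∣ cycleCount σ t) ↔
        d ∣ cycleCount σ t)) := by
  have hd0 : d ≠ 0 := Nat.one_le_iff_ne_zero.1 hd
  refine ⟨⟨?_, fun h => ?_⟩, fun t ht hdt => ?_⟩
  · rintro ⟨τ, rfl⟩ t ht
    have ht0 := Nat.one_le_iff_ne_zero.1 ht
    rw [dvd_cycleCount_iff]
    exact τ.mul_dvd_card_minimalPeriod_pow_eq hd0 ht0
  · obtain ⟨τ, hτ⟩ := σ.exists_pow_eq_of_restrict d fun t => by
      rcases Nat.eq_zero_or_pos t with rfl | ht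
      · exact ⟨1, Equiv.ext fun x => absurd x.2 (σ.minimalPeriod_pos x).ne'⟩
      · exact Equiv.Perm.exists_pow_eq_of_minimalPeriod_eq _ hd0 ht.ne'
          (σ.minimalPeriod_restrictMinimalPeriod t)
          (gcd_prod_primeFactors_pow_factorization_mul hd0 ht.ne')
          ((dvd_cycleCount_iff σ _ t).1 (h t ht))
    exact ⟨τ, hτ.symm⟩
  · rw [prod_primeFactors_pow_factorization_eq_of_dvd hd0 (Nat.one_le_iff_ne_zero.1 ht) hdt]
end
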